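/- arXiv:2011.01053 — 5 statements merged into one kernel-verified Lean document; each statement's English description precedes it below -/
import Mathlib

section
/- Let n ≥ 2 be an integer. Then every (n, n, 2n−1)-fractionally balanced tripartite hypergraph contains a matching of size max(⌈(2n−1)/3⌉, ⌈3n/5⌉). -/
/-- `f` is a balanced weight function on the tripartite hypergraph `H`:
nonnegative, vanishing outside `H`, with constant degrees on each of the three sides. -/
def TriBalanced {a b c : ℕ} (H : Finset (Fin a × Fin b × Fin c))
    (f : Fin a × Fin b × Fin c → ℝ) : Prop :=
  (∀ e, 0 ≤ f e) ∧ (∀ e, e ∉ H → f e = 0) ∧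
    (∀ v w : Fin a, (∑ e : Fin a × Fin b × Fin c, if e.1 = v then f e else 0) =
      ∑ e : Fin a × Fin b × Fin c, if e.1 = w then f e else 0) ∧
    (∀ v w : Fin b, (∑ e : Fin a × Fin b × Fin c, if e.2.1 = v then f e else 0) =
      ∑ e : Fin a × Fin b × Fin c, if e.2.1 = w then f e else 0) ∧
    (∀ v w : Fin c, (∑ e : Fin a × Fin b × Fin c, if e.2.2 = v then f e else 0) =
      ∑ e : Fin a × Fin b × Fin c, if e.2.2 = w then f e else 0)

/-- `H` is an `(a,b,c)`-fractionally balanced tripartite hypergraph. -/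
def TriFracBalanced {a b c : ℕ} (H : Finset (Fin a × Fin b × Fin c)) : Prop :=
  ∃ f, TriBalanced H f ∧ f ≠ 0

/-- `M` is a matching in `H`: a set of edges of `H` any two distinct members of
which differ in all three coordinates. -/
def TriMatching {a b c : ℕ} (H M : Finset (Fin a × Fin b × Fin c)) : Prop :=
  M ⊆ H ∧ ∀ e ∈ M, ∀ f ∈ M, e ≠ f → e.1 ≠ f.1 ∧ e.2.1 ≠ f.2.1 ∧ e.2.2 ≠ f.2.2

namespace BM
open Finset

variable {V : Type*} [Fintype V] [DecidableEq V]

/-- Augmented boundary of a mod-2 chain. -/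
def bd (c : Finset V → ZMod 2) (σ : Finset V) : ZMod 2 :=
  ∑ v, if v ∈ σ then 0 else c (insert v σ)

theorem bd_add (c d : Finset V → ZMod 2) : bd (c + d) = bd c + bd d := by
  funext σ
  simp only [bd, Pi.add_apply, ← Finset.sum_add_distrib]
  refine Finset.sum_congr rfl fun v _ => ?_
  split_ifs <;> simp

theorem bd_sum {ι : Type*} (s : Finset ι) (c : ι → Finset V → ZMod 2) :
    bd (∑ i ∈ s, c i) = ∑ i ∈ s, bd (c i) := by
  classical
  induction s using Finset.induction_on with
  | empty => funext σ; simp [bd]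
  | insert a s ha ih => rw [Finset.sum_insert ha, Finset.sum_insert ha, bd_add, ih]

theorem sum_swap_zero {W : Type*} [Fintype W] (g : W → W → ZMod 2) (hs : ∀ v w, g v w = g w v) (hd : ∀ v, g v v = 0) :
    ∑ v, ∑ w, g v w = 0 := by
  rw [← Finset.sum_product']
  refine Finset.sum_involution (fun p _ => (p.2, p.1)) ?_ ?_ ?_ ?_
  · rintro ⟨v, w⟩ _
    simp only [hs w v]
    exact CharTwo.add_self_eq_zero _
  · rintro ⟨v, w⟩ _ h h'
    simp only [Prod.mk.injEq] at h'
    apply h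
    simp only
    rw [h'.1]; exact hd _
  · intros; simp
  · intros; rfl

theorem bd_bd (c : Finset V → ZMod 2) : bd (bd c) = 0 := by
  funext σ
  have : bd (bd c) σ = ∑ v, ∑ w, if v ∈ σ ∨ w ∈ σ ∨ v = w then 0
      else c (insert v (insert w σ)) := by
    unfold bd
    refine Finset.sum_congr rfl fun v _ => ?_
    by_cases hv : v ∈ σ
    · simp [hv]
    · simp only [hv, if_false, false_or]
      refine Finset.sum_congr rfl fun w _ => ?_
      by_cases hw : w ∈ σ
      · simp [hw]
      · by_cases hvw : v = w
        · simp [hvw]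
        · simp only [Finset.mem_insert, hw, hvw, Ne.symm hvw, or_false, if_false]
          rw [Finset.insert_comm]
  rw [this]
  apply sum_swap_zero
  · intro v w
    rw [Finset.insert_comm]
    congr 1
    simp only [eq_iff_iff]; tauto
  · intro v; simp

/-- `σ` is an independent set of size `j` contained in `S`. -/
def Ind (L : V → V → Prop) (S : Finset V) (j : ℕ) (σ : Finset V) : Prop :=
  σ ⊆ S ∧ σ.card = j ∧ ∀ s ∈ σ, ∀ t ∈ σ, ¬ L s t

/-- Homological connectivity of the independence complex of `L` on `S`. -/
def Conn (L : V → V → Prop) (S : Finset V) (m : ℕ) : Prop :=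
  ∀ j < m, ∀ c : Finset V → ZMod 2, (∀ σ, c σ ≠ 0 → Ind L S j σ) → bd c = 0 →
    ∃ w : Finset V → ZMod 2, (∀ σ, w σ ≠ 0 → Ind L S (j + 1) σ) ∧ bd w = c

theorem Conn.congr {L L' : V → V → Prop} {S : Finset V} {m : ℕ}
    (h : ∀ s ∈ S, ∀ t ∈ S, L s t ↔ L' s t) (hc : Conn L S m) : Conn L' S m := by
  have key : ∀ j σ, Ind L S j σ ↔ Ind L' S j σ := by
    intro j σ
    unfold Ind
    constructor
    · rintro ⟨h1, h2, h3⟩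
      exact ⟨h1, h2, fun s hs t ht hl => h3 s hs t ht ((h s (h1 hs) t (h1 ht)).2 hl)⟩
    · rintro ⟨h1, h2, h3⟩
      exact ⟨h1, h2, fun s hs t ht hl => h3 s hs t ht ((h s (h1 hs) t (h1 ht)).1 hl)⟩
  intro j hj c hcs hb
  obtain ⟨w, hw, hbw⟩ := hc j hj c (fun σ hσ => (key _ _).2 (hcs σ hσ)) hb
  exact ⟨w, fun σ hσ => (key _ _).1 (hw σ hσ), hbw⟩

/-- An isolated vertex makes the complex a cone. -/
theorem conn_isolated (L : V → V → Prop) (S : Finset V) (f : V) (hf : f ∈ S)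
    (h1 : ∀ s ∈ S, ¬ L s f) (h2 : ∀ s ∈ S, ¬ L f s) (m : ℕ) : Conn L S m := by
  intro j _ c hc hb
  refine ⟨fun σ => if f ∈ σ then c (σ.erase f) else 0, ?_, ?_⟩
  · intro σ hσ
    by_cases hfσ : f ∈ σ
    · simp only [hfσ, if_true] at hσ
      obtain ⟨a1, a2, a3⟩ := hc _ hσ
      have hsub : σ ⊆ S := by
        intro s hs
        by_cases hsf : s = f
        · exact hsf ▸ hf
        · exact a1 (Finset.mem_erase.2 ⟨hsf, hs⟩)
      refine ⟨hsub, ?_, ?_⟩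
      · rw [← a2, Finset.card_erase_add_one hfσ]
      · intro s hs t ht hl
        by_cases hsf : s = f
        · subst hsf; exact h2 t (hsub ht) hl
        · by_cases htf : t = f
          · subst htf; exact h1 s (hsub hs) hl
          · exact a3 s (Finset.mem_erase.2 ⟨hsf, hs⟩) t (Finset.mem_erase.2 ⟨htf, ht⟩) hl
    · simp [hfσ] at hσ
  · funext σ
    by_cases hfσ : f ∈ σ
    · have e1 : bd c (σ.erase f) = 0 := by rw [hb]; rfl
      unfold bd at e1 ⊢
      rw [← Finset.add_sum_erase _ _ (Finset.mem_univ f)] at e1 ⊢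
      simp only [hfσ, if_true, zero_add, Finset.notMem_erase, if_false,
        Finset.insert_erase hfσ] at e1 ⊢
      have e2 : ∀ v ∈ (univ : Finset V).erase f, (if v ∈ σ then 0 else
          if f ∈ insert v σ then c ((insert v σ).erase f) else 0) =
          if v ∈ σ.erase f then 0 else c (insert v (σ.erase f)) := by
        intro v hv
        have hvf : v ≠ f := Finset.ne_of_mem_erase hv
        simp only [Finset.mem_erase, hvf, ne_eq, not_false_eq_true, true_and,
          Finset.mem_insert, hfσ, or_true, if_true]
        rw [Finset.erase_insert_of_ne hvf]
      rw [Finset.sum_congr rfl e2]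
      exact (CharTwo.add_eq_zero.1 e1).symm
    · unfold bd
      rw [Finset.sum_eq_single f]
      · simp [hfσ]
      · intro v _ hv
        simp [hfσ, hv.symm]
      · simp

/-- The deletion/explosion step. -/
theorem conn_explode (L L' : V → V → Prop) (S T : Finset V) (x y : V)
    (hx : x ∈ S) (hy : y ∈ S) (hxy : L x y) (hirr : ∀ s, ¬ L s s) (hsym : ∀ s t, L s t → L t s)
    (hL' : ∀ s t, L' s t ↔ L s t ∧ ¬ (s = x ∧ t = y) ∧ ¬ (s = y ∧ t = x))
    (hT : ∀ s, s ∈ T ↔ s ∈ S ∧ ¬ L s x ∧ ¬ L s y) (m : ℕ)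
    (h1 : Conn L' S (m + 1)) (h2 : Conn L T m) : Conn L S (m + 1) := by
  have hne : x ≠ y := fun h => hirr y (h ▸ hxy)
  have hxT : x ∉ T := fun h => ((hT x).1 h).2.2 hxy
  have hyT : y ∉ T := fun h => ((hT y).1 h).2.1 (hsym _ _ hxy)
  intro j hj z hz hbz
  obtain ⟨w, hw, hbw⟩ := h1 j hj z (fun σ hσ => by
    obtain ⟨a1, a2, a3⟩ := hz σ hσ
    exact ⟨a1, a2, fun s hs t ht hl => a3 s hs t ht ((hL' s t).1 hl).1⟩) hbz
  have hgood : ∀ σ, w σ ≠ 0 → ¬ (x ∈ σ ∧ y ∈ σ) → Ind L S (j + 1) σ := by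
    intro σ hσ hn
    obtain ⟨a1, a2, a3⟩ := hw σ hσ
    refine ⟨a1, a2, fun s hs t ht hl => a3 s hs t ht ((hL' s t).2 ⟨hl, ?_, ?_⟩)⟩
    · rintro ⟨rfl, rfl⟩; exact hn ⟨hs, ht⟩
    · rintro ⟨rfl, rfl⟩; exact hn ⟨ht, hs⟩
  obtain _ | k := j
  · refine ⟨w, fun σ hσ => hgood σ hσ ?_, hbw⟩
    rintro ⟨b1, b2⟩
    have := (hw σ hσ).2.1
    exact hne (Finset.card_le_one.1 this.le x b1 y b2)
  set u : Finset V → ZMod 2 := fun τ => if x ∈ τ ∨ y ∈ τ then 0 else w (insert x (insert y τ))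
    with hu
  have hus : ∀ τ, u τ ≠ 0 → Ind L T k τ := by
    intro τ hτ
    by_cases hc : x ∈ τ ∨ y ∈ τ
    · simp [hu, hc] at hτ
    · simp only [hu, hc, if_false] at hτ
      push Not at hc
      obtain ⟨a1, a2, a3⟩ := hw _ hτ
      have nx : ∀ s ∈ τ, s ≠ x := fun s hs h => hc.1 (h ▸ hs)
      have ny : ∀ s ∈ τ, s ≠ y := fun s hs h => hc.2 (h ▸ hs)
      refine ⟨?_, ?_, ?_⟩
      · intro s hs
        have hs' : s ∈ insert x (insert y τ) := by simp [hs]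
        refine (hT s).2 ⟨a1 hs', fun hl => ?_, fun hl => ?_⟩
        · exact a3 s hs' x (by simp) ((hL' _ _).2
            ⟨hl, fun h => nx s hs h.1, fun h => ny s hs h.1⟩)
        · exact a3 s hs' y (by simp) ((hL' _ _).2
            ⟨hl, fun h => nx s hs h.1, fun h => ny s hs h.1⟩)
      · rw [Finset.card_insert_of_notMem (by simp [hne, hc.1]),
          Finset.card_insert_of_notMem hc.2] at a2
        omega
      · intro s hs t ht hl
        exact a3 s (by simp [hs]) t (by simp [ht]) ((hL' _ _).2
            ⟨hl, fun h => nx s hs h.1, fun h => ny s hs h.1⟩)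
  have hbu : bd u = 0 := by
    funext τ
    by_cases hc : x ∈ τ ∨ y ∈ τ
    · unfold bd
      refine Finset.sum_eq_zero fun v _ => ?_
      have : x ∈ insert v τ ∨ y ∈ insert v τ := by
        rcases hc with h | h <;> simp [h]
      simp only [hu, this, if_true, ite_self]
    · push Not at hc
      have e1 : bd w (insert x (insert y τ)) = 0 := by
        rw [hbw]
        by_contra hne'
        exact (hz _ hne').2.2 x (by simp) y (by simp) hxy
      rw [show (0 : Finset V → ZMod 2) τ = 0 from rfl, ← e1]
      unfold bd
      refine Finset.sum_congr rfl fun v _ => ?_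
      by_cases hvx : v = x
      · subst hvx; simp [hu]
      by_cases hvy : v = y
      · subst hvy; simp [hu]
      by_cases hvτ : v ∈ τ
      · simp [hvτ]
      · have : ¬ (x ∈ insert v τ ∨ y ∈ insert v τ) := by
          simp [hc, Ne.symm hvx, Ne.symm hvy]
        have h' : v ∉ insert x (insert y τ) := by simp [hvx, hvy, hvτ]
        simp only [hvτ, if_false, hu, this, h']
        congr 1
        ext a; simp only [Finset.mem_insert]; tauto
  obtain ⟨v, hv, hbv⟩ := h2 k (by omega) u hus hbu
  have hvx : ∀ τ, x ∈ τ → v τ = 0 := fun τ h => by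
    by_contra hn; exact hxT ((hv τ hn).1 h)
  have hvy : ∀ τ, y ∈ τ → v τ = 0 := fun τ h => by
    by_contra hn; exact hyT ((hv τ hn).1 h)
  set q : Finset V → ZMod 2 := fun σ =>
    if x ∈ σ ∧ y ∈ σ then v ((σ.erase x).erase y) else 0 with hq
  -- the values of the boundary of q
  have q2 : ∀ σ, x ∈ σ → y ∈ σ → bd q σ = w σ := by
    intro σ b1 b2
    have e1 : bd v ((σ.erase x).erase y) = w σ := by
      rw [hbv]
      simp only [hu, Finset.mem_erase, ne_eq, not_true_eq_false, false_and, and_false, or_self,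
        if_false]
      congr 1
      ext a
      simp only [Finset.mem_insert, Finset.mem_erase]
      by_cases ha : a = x
      · simp [ha, b1]
      · by_cases ha' : a = y
        · simp [ha', b2]
        · simp [ha, ha']
    rw [← e1]
    unfold bd
    refine Finset.sum_congr rfl fun a _ => ?_
    by_cases hax : a = x
    · subst hax
      simp [b1, hvx]
    by_cases hay : a = y
    · subst hay
      simp [b2, hvy]
    by_cases haσ : a ∈ σ
    · simp [haσ, hax, hay]
    · simp only [haσ, if_false, hq, Finset.mem_insert, b1, b2, or_true, and_self, if_true,
        Finset.mem_erase, and_false]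
      rw [Finset.erase_insert_of_ne hax, Finset.erase_insert_of_ne hay]
  have q1 : ∀ σ, bd q σ ≠ 0 → ¬ (x ∈ σ ∧ y ∈ σ) → Ind L S (k + 1 + 1) σ := by
    have main : ∀ p r : V, p ∈ S → (∀ s ∈ T, ¬ L s p) → p ∉ T → ∀ σ, p ∈ σ → 
        v (σ.erase p) ≠ 0 → Ind L S (k + 1 + 1) σ := by
      intro p r hpS hpT hpn σ hp hne'
      obtain ⟨a1, a2, a3⟩ := hv _ hne'
      refine ⟨?_, ?_, ?_⟩
      · intro s hs
        by_cases hsp : s = p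
        · exact hsp ▸ hpS
        · exact ((hT s).1 (a1 (Finset.mem_erase.2 ⟨hsp, hs⟩))).1
      · rw [← a2, Finset.card_erase_add_one hp]
      · intro s hs t ht hl
        by_cases hsp : s = p
        · by_cases htp : t = p
          · rw [hsp, htp] at hl; exact hirr _ hl
          · rw [hsp] at hl
            exact hpT t (a1 (Finset.mem_erase.2 ⟨htp, ht⟩)) (hsym _ _ hl)
        · by_cases htp : t = p
          · rw [htp] at hl
            exact hpT s (a1 (Finset.mem_erase.2 ⟨hsp, hs⟩)) hl
          · exact a3 s (Finset.mem_erase.2 ⟨hsp, hs⟩) t (Finset.mem_erase.2 ⟨htp, ht⟩) hl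
    intro σ hσ hn
    by_cases b1 : x ∈ σ
    · have b2 : y ∉ σ := fun h => hn ⟨b1, h⟩
      refine main x y hx (fun s hs => ((hT s).1 hs).2.1) hxT σ b1 ?_
      intro h0
      apply hσ
      unfold bd
      refine Finset.sum_eq_zero fun a _ => ?_
      by_cases hay : a = y
      · subst hay
        simp only [b2, if_false, hq, Finset.mem_insert, b1, or_true, true_or, and_self, if_true]
        rw [Finset.erase_insert_of_ne hne.symm, Finset.erase_insert (by simp [b2]), h0]
      · simp [hq, b2, Ne.symm hay]
    · by_cases b2 : y ∈ σ
      · refine main y x hy (fun s hs => ((hT s).1 hs).2.2) hyT σ b2 ?_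
        intro h0
        apply hσ
        unfold bd
        refine Finset.sum_eq_zero fun a _ => ?_
        by_cases hax : a = x
        · subst hax
          simp only [b1, if_false, hq, Finset.mem_insert, b2, or_true, true_or, and_self, if_true]
          rw [Finset.erase_insert b1, h0]
        · simp [hq, b1, Ne.symm hax]
      · exfalso
        apply hσ
        unfold bd
        refine Finset.sum_eq_zero fun a _ => ?_
        by_cases hax : a = x
        · subst hax; simp [hq, b2, hne.symm]
        · simp [hq, b1, Ne.symm hax]
  refine ⟨w + bd q, ?_, ?_⟩
  · intro σ hσ
    by_cases hc : x ∈ σ ∧ y ∈ σ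
    · exfalso
      apply hσ
      rw [Pi.add_apply, q2 σ hc.1 hc.2]
      exact CharTwo.add_self_eq_zero _
    · by_cases hwσ : w σ = 0
      · rw [Pi.add_apply, hwσ, zero_add] at hσ
        exact q1 σ hσ hc
      · exact hgood σ hwσ hc
  · rw [bd_add, bd_bd, add_zero, hbw]

/-- The connectivity game: weights, closed neighbourhoods of weight at most three. -/
theorem conn_game (L : V → V → Prop) (hirr : ∀ s, ¬ L s s) (hsym : ∀ s t, L s t → L t s)
    [DecidableRel L] (w : V → ℕ)
    (h1 : ∀ e, ∑ s ∈ univ.filter (fun s => s = e ∨ L s e), w s ≤ 3)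
    (h2 : ∀ f, 0 < w f → ∃ r : V → ℕ, ∀ e s, L e f → L s f → r e ≤ r s → 0 < w s →
      s = e ∨ L s e) :
    ∀ (m : ℕ) (S : Finset V), 3 * m ≤ ∑ s ∈ S, w s + 2 → Conn L S m := by
  intro m
  induction m with
  | zero => intro S _ j hj; omega
  | succ m ih =>
    intro S hS
    obtain ⟨f, hfS, hwf⟩ : ∃ f ∈ S, 0 < w f := by
      by_contra hcon
      push Not at hcon
      have : ∑ s ∈ S, w s = 0 := Finset.sum_eq_zero fun s hs => Nat.le_zero.1 (hcon s hs)
      omega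
    obtain ⟨r, hr⟩ := h2 f hwf
    have claim : ∀ (k : ℕ) (D : Finset V),
        (S.filter (fun e => L e f ∧ e ∉ D)).card = k →
        Conn (fun s t => L s t ∧ ¬ (s = f ∧ t ∈ D) ∧ ¬ (t = f ∧ s ∈ D)) S (m + 1) := by
      intro k
      induction k with
      | zero =>
        intro D hD
        have hD' : ∀ s ∈ S, L s f → s ∈ D := by
          intro s hs hl
          by_contra hn
          have : s ∈ S.filter (fun e => L e f ∧ e ∉ D) := by simp [hs, hl, hn]
          rw [Finset.card_eq_zero.1 hD] at this
          simp at this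
        refine conn_isolated _ S f hfS ?_ ?_ _
        · rintro s hs ⟨a1, _, a3⟩
          exact a3 ⟨rfl, hD' s hs a1⟩
        · rintro s hs ⟨a1, a2, _⟩
          exact a2 ⟨rfl, hD' s hs (hsym _ _ a1)⟩
      | succ k ihk =>
        intro D hD
        have hne : (S.filter (fun e => L e f ∧ e ∉ D)).Nonempty := by
          rw [← Finset.card_pos]; omega
        obtain ⟨e, heU, hmin⟩ := Finset.exists_min_image _ r hne
        obtain ⟨heS, hef, heD⟩ := Finset.mem_filter.1 heU
        have hnef : e ≠ f := fun h => hirr f (h ▸ hef)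
        have hstep := ihk (insert e D) (by
          have : S.filter (fun e' => L e' f ∧ e' ∉ insert e D) =
              (S.filter (fun e => L e f ∧ e ∉ D)).erase e := by
            ext s; simp only [Finset.mem_filter, Finset.mem_erase, Finset.mem_insert]; tauto
          rw [this, Finset.card_erase_of_mem heU, hD]; rfl)
        set T := S.filter (fun s => ¬ (L s e ∧ ¬ (s = f ∧ e ∈ D) ∧ ¬ (e = f ∧ s ∈ D)) ∧
            ¬ (L s f ∧ ¬ (s = f ∧ f ∈ D) ∧ ¬ (f = f ∧ s ∈ D))) with hT
        refine conn_explode _ _ S T e f heS hfS ?_ ?_ ?_ ?_ ?_ m hstep ?_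
        · exact ⟨hef, fun h => hnef h.1, fun h => heD h.2⟩
        · exact fun s h => hirr s h.1
        · rintro s t ⟨a1, a2, a3⟩
          exact ⟨hsym _ _ a1, a3, a2⟩
        · intro s t
          simp only [Finset.mem_insert]
          tauto
        · intro s
          simp only [hT, Finset.mem_filter]
        · have hfT : f ∉ T := by
            intro h
            exact (Finset.mem_filter.1 h).2.1
              ⟨hsym _ _ hef, fun h => heD h.2, fun h => hnef h.1⟩
          refine Conn.congr (L := L) ?_ (ih T ?_)
          · intro s hs t ht
            have : s ≠ f := fun h => hfT (h ▸ hs)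
            have : t ≠ f := fun h => hfT (h ▸ ht)
            tauto
          · have e1 : ∑ s ∈ S, w s ≤ ∑ s ∈ T, w s +
                ∑ s ∈ univ.filter (fun s => s = e ∨ L s e), w s := by
              rw [← Finset.sum_filter_of_ne (s := S) (p := fun s => 0 < w s)
                (fun s _ h => Nat.pos_of_ne_zero h)]
              refine (Finset.sum_le_sum_of_subset (t := T ∪
                univ.filter (fun s => s = e ∨ L s e)) ?_).trans ?_
              · intro s hs
                obtain ⟨hsS, hws⟩ := Finset.mem_filter.1 hs
                by_cases hsT : s ∈ T
                · exact Finset.mem_union_left _ hsT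
                · refine Finset.mem_union_right _ (Finset.mem_filter.2 ⟨Finset.mem_univ _, ?_⟩)
                  by_cases hse : L s e
                  · exact Or.inr hse
                  · have hsf : L s f ∧ s ∉ D := by
                      by_contra hcon
                      apply hsT
                      refine Finset.mem_filter.2 ⟨hsS, fun h => hse h.1, fun h => hcon ⟨h.1, ?_⟩⟩
                      exact fun h' => h.2.2 ⟨rfl, h'⟩
                    exact hr e s hef hsf.1
                      (hmin s (Finset.mem_filter.2 ⟨hsS, hsf⟩)) hws
              · rw [← Finset.sum_union_inter]
                exact Nat.le_add_right _ _
            have := h1 e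
            omega
    have := claim _ ∅ rfl
    simpa using this

theorem bd_adjoint (c g : Finset V → ZMod 2) :
    ∑ σ, c σ * ∑ v ∈ σ, g (σ.erase v) = ∑ τ, g τ * bd c τ := by
  have l : ∀ σ : Finset V, c σ * ∑ v ∈ σ, g (σ.erase v) =
      ∑ v, if v ∈ σ then c σ * g (σ.erase v) else 0 := by
    intro σ
    rw [Finset.mul_sum, ← Finset.sum_filter]
    refine Finset.sum_congr ?_ fun _ _ => rfl
    ext; simp
  have r : ∀ τ : Finset V, g τ * bd c τ =
      ∑ v, if v ∉ τ then g τ * c (insert v τ) else 0 := by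
    intro τ
    rw [bd, Finset.mul_sum]
    refine Finset.sum_congr rfl fun v _ => ?_
    by_cases h : v ∈ τ <;> simp [h]
  simp only [l, r]
  rw [Finset.sum_comm, Finset.sum_comm (s := (univ : Finset (Finset V)))]
  refine Finset.sum_congr rfl fun v _ => ?_
  rw [← Finset.sum_filter, ← Finset.sum_filter]
  refine Finset.sum_bij' (fun σ _ => σ.erase v) (fun τ _ => insert v τ) ?_ ?_ ?_ ?_ ?_
  · intro σ _; simp
  · intro σ _; simp
  · intro σ h; exact Finset.insert_erase (Finset.mem_filter.1 h).2
  · intro σ h; exact Finset.erase_insert (Finset.mem_filter.1 h).2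
  · intro σ h
    rw [Finset.insert_erase (Finset.mem_filter.1 h).2, mul_comm]

theorem count_identity {α : Type*} [DecidableEq α] (col : V → α) (a : α) (J : Finset α)
    (ha : a ∉ J) (σ : Finset V) (hσ : ∀ v ∈ σ, col v ∈ insert a J) :
    ∑ v ∈ σ, ∏ b ∈ J, (((σ.erase v).filter (fun s => col s = b)).card : ZMod 2) =
      ∏ b ∈ insert a J, ((σ.filter (fun s => col s = b)).card : ZMod 2) := by
  have hn : ∀ v ∈ σ, ∀ b, b ≠ col v → (σ.erase v).filter (fun s => col s = b) =
      σ.filter (fun s => col s = b) := by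
    intro v _ b hb
    ext s
    simp only [Finset.mem_filter, Finset.mem_erase]
    constructor
    · tauto
    · rintro ⟨h1, h2⟩
      exact ⟨⟨fun h => hb (by rw [← h2, h]), h1⟩, h2⟩
  rw [← Finset.sum_fiberwise_of_maps_to hσ, Finset.sum_insert ha, Finset.prod_insert ha]
  have z : ∑ b ∈ J, ∑ v ∈ σ.filter (fun v => col v = b), ∏ b ∈ J,
      (((σ.erase v).filter (fun s => col s = b)).card : ZMod 2) = 0 := by
    refine Finset.sum_eq_zero fun b hb => ?_
    have : ∀ v ∈ σ.filter (fun v => col v = b), ∏ b ∈ J,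
        (((σ.erase v).filter (fun s => col s = b)).card : ZMod 2) =
        ((σ.filter (fun s => col s = b)).card - 1 : ZMod 2) *
        ∏ b ∈ J.erase b, ((σ.filter (fun s => col s = b)).card : ZMod 2) := by
      intro v hv
      obtain ⟨hv1, hv2⟩ := Finset.mem_filter.1 hv
      rw [← Finset.mul_prod_erase _ _ hb]
      congr 1
      · rw [Finset.filter_erase, Finset.card_erase_of_mem hv,
          Nat.cast_sub (Finset.card_pos.2 ⟨v, hv⟩), Nat.cast_one]
      · refine Finset.prod_congr rfl fun b' hb' => ?_
        rw [hn v hv1 b' (by rw [hv2]; exact Finset.ne_of_mem_erase hb')]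
    rw [Finset.sum_congr rfl this, Finset.sum_const, nsmul_eq_mul, ← mul_assoc]
    have key : ∀ x : ZMod 2, x * (x - 1) = 0 := by decide
    rw [key, zero_mul]
  rw [z, add_zero]
  have : ∀ v ∈ σ.filter (fun v => col v = a), ∏ b ∈ J,
        (((σ.erase v).filter (fun s => col s = b)).card : ZMod 2) =
        ∏ b ∈ J, ((σ.filter (fun s => col s = b)).card : ZMod 2) := by
    intro v hv
    obtain ⟨hv1, hv2⟩ := Finset.mem_filter.1 hv
    refine Finset.prod_congr rfl fun b' hb' => ?_
    rw [hn v hv1 b' (by rw [hv2]; exact fun h => ha (h ▸ hb'))]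
  rw [Finset.sum_congr rfl this, Finset.sum_const, nsmul_eq_mul]

/-- Topological Hall theorem (homological, mod 2). -/
theorem rainbow {α : Type*} [Fintype α] [DecidableEq α] (L : V → V → Prop) (S : Finset V)
    (col : V → α)
    (h : ∀ I : Finset α, Conn L (S.filter (fun s => col s ∈ I)) I.card) :
    ∃ σ : Finset V, σ ⊆ S ∧ (∀ s ∈ σ, ∀ t ∈ σ, ¬ L s t) ∧ ∀ a, ∃ s ∈ σ, col s = a := by
  have build : ∀ m : ℕ, ∃ c : Finset α → Finset V → ZMod 2,
      c ∅ = (fun σ => if σ = ∅ then 1 else 0) ∧ ∀ I : Finset α, I.card ≤ m →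
        (∀ σ, c I σ ≠ 0 → Ind L (S.filter (fun s => col s ∈ I)) I.card σ) ∧
        bd (c I) = ∑ a ∈ I, c (I.erase a) := by
    intro m
    induction m with
    | zero =>
      refine ⟨fun _ σ => if σ = ∅ then 1 else 0, rfl, ?_⟩
      intro I hI
      have hI' : I = ∅ := Finset.card_eq_zero.1 (Nat.le_zero.1 hI)
      subst hI'
      refine ⟨?_, ?_⟩
      · intro σ hσ
        have : σ = ∅ := by
          by_contra hn; simp [hn] at hσ
        subst this
        simp [Ind]
      · funext σ
        simp [bd]
    | succ m ih =>
      obtain ⟨c, hc0, hc⟩ := ih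
      have ex : ∀ I : Finset α, I.card = m + 1 → ∃ w : Finset V → ZMod 2,
          (∀ σ, w σ ≠ 0 → Ind L (S.filter (fun s => col s ∈ I)) I.card σ) ∧
          bd w = ∑ a ∈ I, c (I.erase a) := by
        intro I hI
        have hcard : ∀ a ∈ I, (I.erase a).card = m := fun a ha => by
          rw [Finset.card_erase_of_mem ha, hI]; rfl
        have := h I m (by omega) (∑ a ∈ I, c (I.erase a)) ?_ ?_
        · rw [hI]; exact this
        · intro σ hσ
          rw [Finset.sum_apply] at hσ
          obtain ⟨a, ha, hne⟩ := Finset.exists_ne_zero_of_sum_ne_zero hσ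
          obtain ⟨a1, a2, a3⟩ := (hc _ (hcard a ha).le).1 σ hne
          refine ⟨fun s hs => ?_, a2.trans (hcard a ha), a3⟩
          have := Finset.mem_filter.1 (a1 hs)
          exact Finset.mem_filter.2 ⟨this.1, Finset.mem_of_mem_erase this.2⟩
        · rw [bd_sum, Finset.sum_congr rfl fun a ha => (hc _ (hcard a ha).le).2]
          funext σ
          simp only [Finset.sum_apply]
          have e : ∑ a ∈ I, ∑ b ∈ I.erase a, c ((I.erase a).erase b) σ =
              ∑ a, ∑ b, if a ∈ I ∧ b ∈ I ∧ a ≠ b then c ((I.erase a).erase b) σ else 0 := by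
            rw [← Finset.sum_subset (Finset.subset_univ I)]
            · refine Finset.sum_congr rfl fun a ha => ?_
              rw [← Finset.sum_filter]
              refine Finset.sum_congr ?_ fun _ _ => rfl
              ext b; simp only [Finset.mem_erase, Finset.mem_filter, Finset.mem_univ]; tauto
            · intro a _ ha
              simp [ha]
          rw [e]
          apply sum_swap_zero
          · intro a b
            rw [Finset.erase_right_comm]
            congr 1
            simp only [eq_iff_iff]; tauto
          · intro a; simp
      choose! w hw using ex
      have hlt : ∀ I : Finset α, I.card ≤ m → ¬ I.card = m + 1 := fun I h1 h2 => by omega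
      refine ⟨fun I => if I.card = m + 1 then w I else c I, ?_, ?_⟩
      · simp [hc0]
      · intro I hI
        have herase : ∑ a ∈ I, (if (I.erase a).card = m + 1 then w (I.erase a)
            else c (I.erase a)) = ∑ a ∈ I, c (I.erase a) := by
          refine Finset.sum_congr rfl fun a ha => ?_
          rw [if_neg]
          rw [Finset.card_erase_of_mem ha]; omega
        rw [herase]
        by_cases hI' : I.card = m + 1
        · simp only [if_pos hI']
          exact hw I hI'
        · simp only [if_neg hI']
          exact hc I (by omega)
  obtain ⟨c, hc0, hc⟩ := build (Fintype.card α)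
  replace hc := fun I : Finset α => hc I (Finset.card_le_univ I)
  have cnt : ∀ I : Finset α, ∑ σ, c I σ *
      ∏ b ∈ I, ((σ.filter (fun s => col s = b)).card : ZMod 2) = 1 := by
    intro I
    induction I using Finset.induction_on with
    | empty => simp [hc0]
    | insert a J ha ih =>
      have e1 : ∀ σ, c (insert a J) σ * ∏ b ∈ insert a J,
          ((σ.filter (fun s => col s = b)).card : ZMod 2) = c (insert a J) σ *
          ∑ v ∈ σ, ∏ b ∈ J, (((σ.erase v).filter (fun s => col s = b)).card : ZMod 2) := by
        intro σ
        by_cases h0 : c (insert a J) σ = 0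
        · simp [h0]
        · rw [count_identity col a J ha σ]
          intro v hv
          exact (Finset.mem_filter.1 (((hc _).1 σ h0).1 hv)).2
      rw [Finset.sum_congr rfl fun σ _ => e1 σ,
        bd_adjoint (c (insert a J)) (fun σ => ∏ b ∈ J,
          ((σ.filter (fun s => col s = b)).card : ZMod 2)), (hc _).2]
      rw [← ih]
      refine Finset.sum_congr rfl fun τ _ => ?_
      rw [Finset.sum_insert ha, Finset.erase_insert ha, Pi.add_apply, mul_add,
        Finset.sum_apply, Finset.mul_sum]
      rw [Finset.sum_eq_zero, add_zero, mul_comm]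
      intro b hb
      by_cases h0 : c ((insert a J).erase b) τ = 0
      · rw [h0, mul_zero]
      · rw [Finset.prod_eq_zero hb, zero_mul]
        rw [Finset.card_eq_zero.2, Nat.cast_zero]
        rw [Finset.filter_eq_empty_iff]
        intro v hv hvb
        have := (Finset.mem_filter.1 (((hc _).1 τ h0).1 hv)).2
        rw [hvb] at this
        simp at this
  have h1 := cnt univ
  obtain ⟨σ, _, hσ⟩ := Finset.exists_ne_zero_of_sum_ne_zero
    (show ∑ σ, c univ σ * ∏ b, ((σ.filter (fun s => col s = b)).card : ZMod 2) ≠ 0 by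
      rw [h1]; exact one_ne_zero)
  have hσ1 := left_ne_zero_of_mul hσ
  have hσ2 := right_ne_zero_of_mul hσ
  obtain ⟨a1, _, a3⟩ := (hc _).1 σ hσ1
  refine ⟨σ, fun s hs => (Finset.mem_filter.1 (a1 hs)).1, a3, fun a => ?_⟩
  have := Finset.prod_ne_zero_iff.1 hσ2 a (Finset.mem_univ a)
  have hne : (σ.filter (fun s => col s = a)).Nonempty := by
    rw [Finset.nonempty_iff_ne_empty]
    intro h0
    rw [h0] at this
    simp at this
  obtain ⟨s, hs⟩ := hne
  exact ⟨s, (Finset.mem_filter.1 hs).1, (Finset.mem_filter.1 hs).2⟩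

section application

variable {α β γ : Type*} [Fintype α] [DecidableEq α] [Fintype β] [DecidableEq β]
  [Fintype γ] [DecidableEq γ]

/-- Compatibility of two (possibly dummy) pairs: they meet. -/
def meet {d : ℕ} : (β × γ) ⊕ Fin d → (β × γ) ⊕ Fin d → Prop
  | Sum.inl p, Sum.inl q => p.1 = q.1 ∨ p.2 = q.2
  | Sum.inr i, Sum.inr j => i = j
  | Sum.inl _, Sum.inr _ => False
  | Sum.inr _, Sum.inl _ => False

/-- The conflict graph. -/
def adj {d : ℕ} (x y : α × ((β × γ) ⊕ Fin d)) : Prop := x ≠ y ∧ meet x.2 y.2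

/-- The available vertices of the conflict graph. -/
def avail {d : ℕ} (H : Finset (α × β × γ)) : α × ((β × γ) ⊕ Fin d) → Prop
  | (a, Sum.inl p) => (a, p) ∈ H
  | (_, Sum.inr _) => True

/-- The weights. -/
def wt {d : ℕ} (F : Finset (α × β × γ)) (a₀ : α) : α × ((β × γ) ⊕ Fin d) → ℕ
  | (a, Sum.inl p) => if (a, p) ∈ F then 1 else 0
  | (a, Sum.inr _) => if a = a₀ then 3 else 0

/-- The ranks. -/
def rk {d : ℕ} (b : β) : α × ((β × γ) ⊕ Fin d) → ℕ
  | (_, Sum.inl p) => if p.1 = b then 0 else 1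
  | (_, Sum.inr _) => 0

theorem core (H : Finset (α × β × γ)) (d : ℕ)
    (hF : ∀ I : Finset α, I.Nonempty → ∃ F ⊆ H, (∀ e ∈ F, e.1 ∈ I) ∧
      (∀ b, (F.filter (fun e => e.2.1 = b)).card ≤ 2) ∧
      (∀ e ∈ F, ∀ e' ∈ F, e.2.2 = e'.2.2 → e = e') ∧ 3 * I.card ≤ F.card + 3 * d + 2) :
    ∃ M ⊆ H, (∀ e ∈ M, ∀ f ∈ M, e ≠ f → e.1 ≠ f.1 ∧ e.2.1 ≠ f.2.1 ∧ e.2.2 ≠ f.2.2) ∧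
      Fintype.card α ≤ M.card + d := by
  classical
  obtain ⟨σ, hσS, hσi, hσc⟩ := rainbow (adj (d := d)) (univ.filter (avail (d := d) H)) Prod.fst (by
    intro I
    rcases I.eq_empty_or_nonempty with rfl | hI
    · intro j hj; simp at hj
    obtain ⟨F, hFH, hFI, hFb, hFc, hcard⟩ := hF I hI
    obtain ⟨a₀, ha₀⟩ := hI
    refine conn_game adj ?_ ?_ (wt F a₀) ?_ ?_ _ _ ?_
    · exact fun s h => h.1 rfl
    · rintro ⟨a, p | i⟩ ⟨a', q | j⟩ ⟨h1, h2⟩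
      · exact ⟨h1.symm, h2.imp Eq.symm Eq.symm⟩
      · exact h2.elim
      · exact h2.elim
      · exact ⟨h1.symm, Eq.symm h2⟩
    · rintro ⟨a, ⟨b, c⟩ | j⟩
      · refine (Finset.sum_le_sum_of_ne_zero (t := ((F.filter (fun e => e.2.1 = b)) ∪
          (F.filter (fun e => e.2.2 = c))).image (fun e => (e.1, Sum.inl e.2))) ?_).trans ?_
        · rintro ⟨a', ⟨b', c'⟩ | j⟩ hs hw
          · have hin : (a', b', c') ∈ F := by
              by_contra hn; simp [wt, hn] at hw
            refine Finset.mem_image.2 ⟨(a', b', c'), ?_, rfl⟩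
            rcases (Finset.mem_filter.1 hs).2 with h | h
            · simp only [Prod.mk.injEq, Sum.inl.injEq] at h
              exact Finset.mem_union_left _ (Finset.mem_filter.2 ⟨hin, h.2.1⟩)
            · rcases h.2 with h | h
              · exact Finset.mem_union_left _ (Finset.mem_filter.2 ⟨hin, h⟩)
              · exact Finset.mem_union_right _ (Finset.mem_filter.2 ⟨hin, h⟩)
          · exfalso
            rcases (Finset.mem_filter.1 hs).2 with h | h
            · simp at h
            · exact h.2
        · refine (Finset.sum_le_card_nsmul _ _ 1 ?_).trans ?_
          · rintro ⟨a', ⟨b', c'⟩ | j⟩ hs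
            · simp only [wt]; split_ifs <;> simp
            · simp at hs
          · rw [smul_eq_mul, mul_one]
            refine Finset.card_image_le.trans ((Finset.card_union_le _ _).trans ?_)
            have h1 := hFb b
            have h2 : (F.filter (fun e => e.2.2 = c)).card ≤ 1 := by
              rw [Finset.card_le_one]
              intro x hx y hy
              rw [Finset.mem_filter] at hx hy
              exact hFc x hx.1 y hy.1 (hx.2.trans hy.2.symm)
            omega
      · refine (Finset.sum_le_sum_of_ne_zero (t := {(a₀, Sum.inr j)}) ?_).trans ?_
        · rintro ⟨a', ⟨b', c'⟩ | j'⟩ hs hw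
          · exfalso
            rcases (Finset.mem_filter.1 hs).2 with h | h
            · simp at h
            · exact h.2
          · have : a' = a₀ := by by_contra hn; simp [wt, hn] at hw
            rcases (Finset.mem_filter.1 hs).2 with h | h
            · simp only [Prod.mk.injEq, Sum.inr.injEq] at h
              simp [this, h.2]
            · have h' : j' = j := h.2
              simp [this, h']
        · simp [wt]
    · rintro ⟨a₁, ⟨b₁, c₁⟩ | j⟩ hf
      · have hfF : (a₁, b₁, c₁) ∈ F := by
          by_contra hn; simp [wt, hn] at hf
        refine ⟨rk b₁, ?_⟩
        rintro ⟨a, ⟨b, c⟩ | j⟩ ⟨a', ⟨b', c'⟩ | j'⟩ he hs hr hw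
        · have hsF : (a', b', c') ∈ F := by
            by_contra hn; simp [wt, hn] at hw
          by_cases hse : ((a', Sum.inl (b', c')) : α × ((β × γ) ⊕ Fin d)) = (a, Sum.inl (b, c))
          · exact Or.inl hse
          refine Or.inr ⟨hse, ?_⟩
          have he2 : b = b₁ ∨ c = c₁ := he.2
          have hs2 : b' = b₁ ∨ c' = c₁ := hs.2
          change b' = b ∨ c' = c
          simp only [rk] at hr
          by_cases hb : b = b₁
          · rcases hs2 with h | h
            · left; rw [h, hb]
            · have := hFc _ hsF _ hfF h
              simp only [Prod.mk.injEq] at this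
              left; rw [this.2.1, hb]
          · have hc := he2.resolve_left hb
            by_cases hb' : b' = b₁
            · simp [hb, hb'] at hr
            · right; rw [hs2.resolve_left hb', hc]
        · exact hs.2.elim
        · exact he.2.elim
        · exact he.2.elim
      · refine ⟨fun _ => 0, ?_⟩
        rintro ⟨a, p | i⟩ ⟨a', p' | i'⟩ he hs _ _
        · exact he.2.elim
        · exact he.2.elim
        · exact hs.2.elim
        · by_cases hse : ((a', Sum.inr i') : α × ((β × γ) ⊕ Fin d)) = (a, Sum.inr i)
          · exact Or.inl hse
          have h1 : i = j := he.2
          have h2 : i' = j := hs.2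
          exact Or.inr ⟨hse, h2.trans h1.symm⟩
    · have e1 : F.card + 3 * d ≤ ∑ s ∈ (univ.filter (avail (d := d) H)).filter
          (fun s => s.1 ∈ I), wt F a₀ s := by
        have hsub : (F.image (fun e => ((e.1, Sum.inl e.2) : α × ((β × γ) ⊕ Fin d)))) ∪
            ((univ : Finset (Fin d)).image (fun j => (a₀, Sum.inr j))) ⊆
            (univ.filter (avail (d := d) H)).filter (fun s => s.1 ∈ I) := by
          intro s hs
          rcases Finset.mem_union.1 hs with h | h
          · obtain ⟨e, he, rfl⟩ := Finset.mem_image.1 h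
            simp only [Finset.mem_filter, Finset.mem_univ, true_and]
            exact ⟨hFH he, hFI e he⟩
          · obtain ⟨j, _, rfl⟩ := Finset.mem_image.1 h
            simp only [Finset.mem_filter, Finset.mem_univ, true_and]
            exact ⟨trivial, ha₀⟩
        refine le_trans ?_ (Finset.sum_le_sum_of_subset hsub)
        rw [Finset.sum_union, Finset.sum_image, Finset.sum_image]
        · simp only [wt, Prod.mk.eta, if_true, Finset.sum_const, Finset.card_univ,
            Fintype.card_fin, smul_eq_mul]
          rw [Finset.sum_congr rfl fun e he => if_pos he]
          simp only [Finset.sum_const, smul_eq_mul, mul_one]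
          omega
        · intro i _ j _ h
          simpa using h
        · rintro ⟨a, p⟩ _ ⟨a', p'⟩ _ h
          simpa using h
        · rw [Finset.disjoint_left]
          intro s h1 h2
          obtain ⟨e, he, rfl⟩ := Finset.mem_image.1 h1
          obtain ⟨j, _, h⟩ := Finset.mem_image.1 h2
          simp at h
      omega)
  choose s hs hsa using hσc
  refine ⟨H.filter (fun e => s e.1 = (e.1, Sum.inl e.2)), Finset.filter_subset _ _, ?_, ?_⟩
  · rintro ⟨a, b, c⟩ he ⟨a', b', c'⟩ hf hne
    have h1 := (Finset.mem_filter.1 he).2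
    have h2 := (Finset.mem_filter.1 hf).2
    simp only at h1 h2
    have h3 : ¬ adj (s a) (s a') := hσi _ (hs a) _ (hs a')
    have haa : a ≠ a' := by
      rintro rfl
      rw [h1] at h2
      simp only [Prod.mk.injEq, Sum.inl.injEq, true_and] at h2
      exact hne (by rw [h2.1, h2.2])
    rw [h1, h2] at h3
    refine ⟨haa, fun h => h3 ⟨?_, Or.inl h⟩, fun h => h3 ⟨?_, Or.inr h⟩⟩ <;>
    · intro h; exact haa (congrArg Prod.fst h)
  · set M := H.filter (fun e => s e.1 = (e.1, Sum.inl e.2)) with hM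
    set A2 := (univ : Finset α).filter (fun a => ∃ j, (s a).2 = Sum.inr j) with hA2
    have hcov : (univ : Finset α) ⊆ M.image Prod.fst ∪ A2 := by
      intro a _
      rcases hsa' : (s a).2 with p | j
      · have hform : s a = (a, Sum.inl p) := Prod.ext (hsa a) hsa'
        refine Finset.mem_union_left _ (Finset.mem_image.2 ⟨(a, p), ?_, rfl⟩)
        refine Finset.mem_filter.2 ⟨?_, hform⟩
        have := (Finset.mem_filter.1 (hσS (hs a))).2
        rw [hform] at this
        exact this
      · exact Finset.mem_union_right _ (Finset.mem_filter.2 ⟨Finset.mem_univ _, j, hsa'⟩)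
    have hA2c : A2.card ≤ d := by
      have := Finset.card_le_card_of_forall_subsingleton (s := A2) (t := (univ : Finset (Fin d)))
        (fun a j => (s a).2 = Sum.inr j) (fun a ha => by
          obtain ⟨j, hj⟩ := (Finset.mem_filter.1 ha).2
          exact ⟨j, Finset.mem_univ _, hj⟩) (by
          rintro j _ a ⟨_, ha⟩ a' ⟨_, ha'⟩
          by_contra hne
          apply hσi _ (hs a) _ (hs a')
          refine ⟨fun h => hne ?_, ?_⟩
          · rw [← hsa a, ← hsa a', h]
          · rw [ha, ha']; rfl)
      simpa using this
    calc Fintype.card α = (univ : Finset α).card := rfl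
      _ ≤ _ := Finset.card_le_card hcov
      _ ≤ _ := Finset.card_union_le _ _
      _ ≤ _ := Nat.add_le_add Finset.card_image_le hA2c

end application

theorem deg_sum {E κ : Type*} [Fintype E] [Fintype κ] [DecidableEq κ] (f : E → ℝ) (g : E → κ)
    (h : ∀ v w : κ, (∑ e, if g e = v then f e else 0) = ∑ e, if g e = w then f e else 0)
    (I : Finset κ) :
    (Fintype.card κ : ℝ) * (∑ e, if g e ∈ I then f e else 0) = I.card * ∑ e, f e := by
  have key : ∀ J : Finset κ, (∑ e, if g e ∈ J then f e else 0) =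
      ∑ v ∈ J, ∑ e, if g e = v then f e else 0 := by
    intro J
    rw [Finset.sum_comm]
    refine Finset.sum_congr rfl fun e _ => ?_
    rw [Finset.sum_ite_eq]
  have hall := key univ
  simp only [Finset.mem_univ, if_true] at hall
  rw [key I, hall, Finset.mul_sum, Finset.mul_sum]
  rcases I.eq_empty_or_nonempty with rfl | ⟨v₀, hv₀⟩
  · simp
  obtain ⟨δ, hδ⟩ : ∃ δ, ∀ v, (∑ e, if g e = v then f e else 0) = δ := ⟨_, fun v => h v v₀⟩
  simp only [hδ, Finset.sum_const, nsmul_eq_mul, Finset.card_univ]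
  ring

theorem total_pos {E : Type*} [Fintype E] (f : E → ℝ) (h0 : ∀ e, 0 ≤ f e) (hne : f ≠ 0) :
    0 < ∑ e, f e := by
  obtain ⟨e, he⟩ := Function.ne_iff.1 hne
  exact Finset.sum_pos' (fun e _ => h0 e) ⟨e, Finset.mem_univ _, lt_of_le_of_ne (h0 e) (Ne.symm he)⟩

theorem cover_ineq {n : ℕ} (hn : 2 ≤ n) (H : Finset (Fin n × Fin n × Fin (2 * n - 1)))
    (hH : TriFracBalanced H) (I P : Finset (Fin n)) (N : Finset (Fin (2 * n - 1)))
    (hc : ∀ e ∈ H, e.1 ∈ I → e.2.1 ∈ P → e.2.2 ∈ N) :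
    (I.card + P.card) * (2 * n - 1) ≤ n * (2 * n - 1) + n * N.card := by
  obtain ⟨f, ⟨h0, hout, h1, h2, h3⟩, hne⟩ := hH
  have hT := total_pos f h0 hne
  have d1 := deg_sum f (fun e => e.1) h1 I
  have d2 := deg_sum f (fun e => e.2.1) h2 P
  have d3 := deg_sum f (fun e => e.2.2) h3 N
  rw [Fintype.card_fin] at d1 d2 d3
  have hle : (∑ e, if e.1 ∈ I then f e else 0) + (∑ e, if e.2.1 ∈ P then f e else 0) ≤
      (∑ e, f e) + ∑ e, if e.2.2 ∈ N then f e else 0 := by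
    rw [← Finset.sum_add_distrib, ← Finset.sum_add_distrib]
    refine Finset.sum_le_sum fun e _ => ?_
    have := h0 e
    by_cases he : e ∈ H
    · have := hc e he
      by_cases a1 : e.1 ∈ I <;> by_cases a2 : e.2.1 ∈ P <;> by_cases a3 : e.2.2 ∈ N <;>
        simp_all
    · simp [hout e he]
  set T := ∑ e, f e
  have hn0 : (0 : ℝ) < n := by exact_mod_cast (by omega : 0 < n)
  have hm0 : (0 : ℝ) < ((2 * n - 1 : ℕ) : ℝ) := by exact_mod_cast (by omega : 0 < 2 * n - 1)
  set m : ℝ := ((2 * n - 1 : ℕ) : ℝ) with hm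
  have fin : ((I.card : ℝ) + P.card) * m * T ≤ ((n : ℝ) * m + n * N.card) * T := by
    have := mul_le_mul_of_nonneg_left hle (mul_pos hn0 hm0).le
    linear_combination this - m * d1 - m * d2 + (n : ℝ) * d3
  have := le_of_mul_le_mul_right fin hT
  rw [hm] at this
  exact_mod_cast this

theorem arith_aux (n i p N : ℕ) (hn : 1 ≤ n) (hi : i ≤ n) (hp : p ≤ n)
    (h : (i + p) * (2 * n - 1) ≤ n * (2 * n - 1) + n * N)
    (h' : N + 2 * n + 2 ≤ 2 * p + 2 * i) : False := by
  obtain ⟨m, rfl⟩ : ∃ m, n = m + 1 := ⟨n - 1, by omega⟩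
  have e : 2 * (m + 1) - 1 = 2 * m + 1 := by omega
  rw [e] at h
  nlinarith

theorem star_exists {n : ℕ} (hn : 2 ≤ n) (H : Finset (Fin n × Fin n × Fin (2 * n - 1)))
    (hH : TriFracBalanced H) (I : Finset (Fin n)) (hI : I.Nonempty) :
    ∃ F ⊆ H, (∀ e ∈ F, e.1 ∈ I) ∧
      (∀ b, (F.filter (fun e => e.2.1 = b)).card ≤ 2) ∧
      (∀ e ∈ F, ∀ e' ∈ F, e.2.2 = e'.2.2 → e = e') ∧ 2 * I.card ≤ F.card + 1 := by
  classical
  have hIn : I.card ≤ n := by simpa using Finset.card_le_univ I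
  have hI1 : 1 ≤ I.card := Finset.card_pos.2 hI
  set D := 2 * n - 2 * I.card + 1 with hD
  set t : Fin n × Fin 2 → Finset (Fin (2 * n - 1) ⊕ Fin D) := fun x =>
    (univ.filter (fun c => ∃ a ∈ I, (a, x.1, c) ∈ H)).disjSum univ with ht
  have hall : ∀ s : Finset (Fin n × Fin 2), s.card ≤ (s.biUnion t).card := by
    intro s
    rcases s.eq_empty_or_nonempty with rfl | ⟨x₀, hx₀⟩
    · simp
    set P := s.image Prod.fst with hP
    set N := (univ : Finset (Fin (2 * n - 1))).filter (fun c => ∃ b ∈ P, ∃ a ∈ I, (a, b, c) ∈ H)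
      with hN
    have hs : s.card ≤ P.card * 2 := by
      have : s ⊆ P ×ˢ (univ : Finset (Fin 2)) := by
        intro x hx
        exact Finset.mem_product.2 ⟨Finset.mem_image_of_mem _ hx, Finset.mem_univ _⟩
      simpa using Finset.card_le_card this
    have hPn : P.card ≤ n := by simpa using Finset.card_le_univ P
    have hb : N.card + D ≤ (s.biUnion t).card := by
      have : N.disjSum (univ : Finset (Fin D)) ⊆ s.biUnion t := by
        intro y hy
        rw [Finset.mem_biUnion]
        rcases y with c | j
        · rw [Finset.inl_mem_disjSum] at hy
          obtain ⟨b, hb, a, ha, hab⟩ := (Finset.mem_filter.1 hy).2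
          obtain ⟨x, hx, rfl⟩ := Finset.mem_image.1 hb
          refine ⟨x, hx, ?_⟩
          simp only [ht, Finset.inl_mem_disjSum, Finset.mem_filter, Finset.mem_univ, true_and]
          exact ⟨a, ha, hab⟩
        · exact ⟨x₀, hx₀, by simp [ht]⟩
      have := Finset.card_le_card this
      rwa [Finset.card_disjSum, Finset.card_univ, Fintype.card_fin] at this
    have hcov := cover_ineq hn H hH I P N (by
      rintro ⟨a, b, c⟩ he ha hb
      exact Finset.mem_filter.2 ⟨Finset.mem_univ _, b, hb, a, ha, he⟩)
    have hfin : 2 * P.card + 2 * I.card ≤ N.card + 2 * n + 1 := by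
      by_contra hcon
      push Not at hcon
      exact arith_aux n I.card P.card N.card (by omega) hIn hPn hcov (by omega)
    omega
  obtain ⟨g, hg, hgt⟩ := (Finset.all_card_le_biUnion_card_iff_exists_injective t).1 hall
  set X := (univ : Finset (Fin n × Fin 2)).filter (fun x => ∃ c, g x = Sum.inl c) with hX
  have ex : ∀ x : Fin n × Fin 2, (∃ c, g x = Sum.inl c) →
      ∃ e : Fin n × Fin n × Fin (2 * n - 1),
      e ∈ H ∧ e.1 ∈ I ∧ e.2.1 = x.1 ∧ g x = Sum.inl e.2.2 := by
    rintro x ⟨c, hc⟩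
    have := hgt x
    rw [hc] at this
    simp only [ht, Finset.inl_mem_disjSum, Finset.mem_filter, Finset.mem_univ, true_and] at this
    obtain ⟨a, ha, haH⟩ := this
    exact ⟨(a, x.1, c), haH, ha, rfl, hc⟩
  have : Nonempty (Fin n × Fin n × Fin (2 * n - 1)) :=
    ⟨(⟨0, by omega⟩, ⟨0, by omega⟩, ⟨0, by omega⟩)⟩
  choose! q hq using ex
  have hqX : ∀ x ∈ X, q x ∈ H ∧ (q x).1 ∈ I ∧ (q x).2.1 = x.1 ∧ g x = Sum.inl (q x).2.2 :=
    fun x hx => hq x (Finset.mem_filter.1 hx).2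
  have hXX : ∀ x ∈ X, ∀ y ∈ X, (q x).2.2 = (q y).2.2 → x = y := by
    intro x hx y hy h
    apply hg
    rw [(hqX x hx).2.2.2, (hqX y hy).2.2.2, h]
  refine ⟨X.image q, ?_, ?_, ?_, ?_, ?_⟩
  · intro e he
    obtain ⟨x, hx, rfl⟩ := Finset.mem_image.1 he
    exact (hqX x hx).1
  · intro e he
    obtain ⟨x, hx, rfl⟩ := Finset.mem_image.1 he
    exact (hqX x hx).2.1
  · intro b
    have : (X.image q).filter (fun e => e.2.1 = b) ⊆
        (({b} : Finset (Fin n)) ×ˢ (univ : Finset (Fin 2))).image q := by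
      intro e he
      obtain ⟨he1, he2⟩ := Finset.mem_filter.1 he
      obtain ⟨x, hx, rfl⟩ := Finset.mem_image.1 he1
      refine Finset.mem_image_of_mem _ (Finset.mem_product.2 ⟨?_, Finset.mem_univ _⟩)
      rw [Finset.mem_singleton, ← he2, (hqX x hx).2.2.1]
    refine (Finset.card_le_card this).trans (Finset.card_image_le.trans ?_)
    simp
  · intro e he e' he' h
    obtain ⟨x, hx, rfl⟩ := Finset.mem_image.1 he
    obtain ⟨y, hy, rfl⟩ := Finset.mem_image.1 he'
    rw [hXX x hx y hy h]
  · rw [Finset.card_image_of_injOn (fun x hx y hy h => hXX x hx y hy (by rw [h]))]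
    have hY : (univ.filter (fun x : Fin n × Fin 2 => ¬ ∃ c, g x = Sum.inl c)).card ≤ D := by
      have := Finset.card_le_card_of_forall_subsingleton
        (s := univ.filter (fun x : Fin n × Fin 2 => ¬ ∃ c, g x = Sum.inl c))
        (t := (univ : Finset (Fin D))) (fun x j => g x = Sum.inr j) (fun x hx => by
          have := (Finset.mem_filter.1 hx).2
          rcases hgx : g x with c | j
          · exact (this ⟨c, hgx⟩).elim
          · exact ⟨j, Finset.mem_univ _, rfl⟩) (by
          rintro j _ x ⟨_, hx⟩ y ⟨_, hy⟩
          exact hg (hx.trans hy.symm))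
      simpa using this
    have hsum := Finset.card_filter_add_card_filter_not (s := (univ : Finset (Fin n × Fin 2)))
      (fun x => ∃ c, g x = Sum.inl c)
    rw [Finset.card_univ, Fintype.card_prod, Fintype.card_fin, Fintype.card_fin, ← hX] at hsum
    omega

theorem fin_two_aux : ∀ a b : Fin 2, b = a ∨ b = a + 1 := by decide

theorem fin_two_aux' : ∀ a t : Fin 2, a + t ≠ a + 1 + t := by decide

theorem two_case (H : Finset (Fin 2 × Fin 2 × Fin 3)) (hH : TriFracBalanced H) :
    ∃ M, TriMatching H M ∧ M.card = 2 := by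
  classical
  obtain ⟨f, ⟨h0, hout, h1, h2, h3⟩, hne⟩ := hH
  have hT := total_pos f h0 hne
  by_contra hcon
  push Not at hcon
  have hno : ∀ a b c b' c', f (a, b, c) ≠ 0 → f (a + 1, b', c') ≠ 0 → b ≠ b' → c = c' := by
    intro a b c b' c' hf hf' hb
    by_contra hc
    have haa : a ≠ a + 1 := by simpa using fin_two_aux' a 0
    have m1 : (a, b, c) ∈ H := by by_contra h; exact hf (hout _ h)
    have m2 : (a + 1, b', c') ∈ H := by by_contra h; exact hf' (hout _ h)
    refine hcon {(a, b, c), (a + 1, b', c')} ⟨?_, ?_⟩ ?_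
    · intro e he
      simp only [Finset.mem_insert, Finset.mem_singleton] at he
      rcases he with rfl | rfl <;> assumption
    · intro e he e' he' hee
      simp only [Finset.mem_insert, Finset.mem_singleton] at he he'
      rcases he with rfl | rfl <;> rcases he' with rfl | rfl
      · exact (hee rfl).elim
      · exact ⟨haa, hb, hc⟩
      · exact ⟨haa.symm, hb.symm, Ne.symm hc⟩
      · exact (hee rfl).elim
    · rw [Finset.card_pair]
      simp [haa]
  have hbal : ∀ a t : Fin 2, ∑ c, f (a, a + t, c) = ∑ c, f (a + 1, a + 1 + t, c) := by
    have e1 := h1 0 1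
    have e2 := h2 0 1
    simp only [Fintype.sum_prod_type, Fin.sum_univ_two] at e1 e2
    simp at e1 e2
    intro a t
    fin_cases a <;> fin_cases t <;> simp <;> linarith
  have hk : ∀ t : Fin 2, ∃ k : Fin 3, ∀ a c, f (a, a + t, c) ≠ 0 → c = k := by
    intro t
    by_cases hex : ∃ a c, f (a, a + t, c) ≠ 0
    · obtain ⟨a, k, hak⟩ := hex
      refine ⟨k, ?_⟩
      have hp : ∑ c, f (a + 1, a + 1 + t, c) ≠ 0 := by
        rw [← hbal a t]
        exact (Finset.sum_pos' (f := fun c => f (a, a + t, c)) (fun c _ => h0 _) ⟨k, Finset.mem_univ _,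
          lt_of_le_of_ne (h0 _) (Ne.symm hak)⟩).ne'
      obtain ⟨k', _, hk'⟩ := Finset.exists_ne_zero_of_sum_ne_zero hp
      have hd : a + t ≠ a + 1 + t := fin_two_aux' a t
      have hkk := hno a _ k _ k' hak hk' hd
      intro a' c hc
      have : a' = a ∨ a' = a + 1 := fin_two_aux a a'
      rcases this with rfl | rfl
      · rw [hno a' _ c _ k' hc hk' hd, hkk]
      · exact (hno a _ k _ c hak hc hd).symm
    · push Not at hex
      exact ⟨0, fun a c h => (h (hex a c)).elim⟩
  choose k hk using hk
  have d3 := deg_sum f (fun e => e.2.2) h3 {k 0, k 1}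
  have hs : (∑ e, if e.2.2 ∈ ({k 0, k 1} : Finset (Fin 3)) then f e else 0) = ∑ e, f e := by
    refine Finset.sum_congr rfl ?_
    rintro ⟨a, b, c⟩ _
    by_cases hf : f (a, b, c) = 0
    · simp [hf]
    · rw [if_pos]
      have hb : b = a + 0 ∨ b = a + 1 := by simpa using fin_two_aux a b
      simp only [Finset.mem_insert, Finset.mem_singleton]
      rcases hb with rfl | rfl
      · exact Or.inl (hk 0 a c hf)
      · exact Or.inr (hk 1 a c hf)
  rw [hs, Fintype.card_fin] at d3
  have hc2 : (({k 0, k 1} : Finset (Fin 3)).card : ℝ) ≤ 2 := by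
    exact_mod_cast Finset.card_le_two
  have := mul_le_mul_of_nonneg_right hc2 hT.le
  push_cast at d3
  linarith

end BM

/-- For `n ≥ 2`, every `(n, n, 2n-1)`-fractionally balanced tripartite hypergraph
has a matching of size `max (⌈(2n-1)/3⌉) (⌈3n/5⌉)`. -/
theorem bm_n_n_2n1 (n : ℕ) (hn : 2 ≤ n)
    (H : Finset (Fin n × Fin n × Fin (2 * n - 1)))
    (hH : TriFracBalanced H) :
    ∃ M, TriMatching H M ∧
      M.card = max ⌈((2 * n - 1 : ℕ) : ℝ) / 3⌉₊ ⌈((3 * n : ℕ) : ℝ) / 5⌉₊ := by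
  set K := max ⌈((2 * n - 1 : ℕ) : ℝ) / 3⌉₊ ⌈((3 * n : ℕ) : ℝ) / 5⌉₊ with hK
  have hKle : ∀ k : ℕ, 2 * n - 1 ≤ 3 * k → 3 * n ≤ 5 * k → K ≤ k := by
    intro k h1 h2
    refine max_le (Nat.ceil_le.2 ?_) (Nat.ceil_le.2 ?_)
    · rw [div_le_iff₀ (by norm_num)]
      exact_mod_cast (by omega : 2 * n - 1 ≤ k * 3)
    · rw [div_le_iff₀ (by norm_num)]
      exact_mod_cast (by omega : 3 * n ≤ k * 5)
  have hex : ∃ M, TriMatching H M ∧ K ≤ M.card := by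
    rcases Nat.lt_or_ge 2 n with h3 | h2
    · obtain ⟨M, hMH, hM, hcard⟩ := BM.core H ((n + 1) / 3) (by
        intro I hI
        obtain ⟨F, a1, a2, a3, a4, a5⟩ := BM.star_exists hn H hH I hI
        have hIn : I.card ≤ n := by simpa using Finset.card_le_univ I
        exact ⟨F, a1, a2, a3, a4, by omega⟩)
      rw [Fintype.card_fin] at hcard
      exact ⟨M, ⟨hMH, hM⟩, hKle _ (by omega) (by omega)⟩
    · obtain rfl : n = 2 := by omega
      obtain ⟨M, hM, hc⟩ := BM.two_case H hH
      exact ⟨M, hM, hKle _ (by omega) (by omega)⟩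
  obtain ⟨M, hM, hle⟩ := hex
  obtain ⟨M', hsub, hc⟩ := Finset.exists_subset_card_eq hle
  exact ⟨M', ⟨hsub.trans hM.1, fun e he f hf => hM.2 e (hsub he) f (hsub hf)⟩, hc⟩
end

section
/- Let k and n be integers with 1 ≤ k ≤ n. Then every (k, n, n)-fractionally balanced tripartite hypergraph contains a matching of size min(k, ⌈n/2⌉). -/
set_option linter.unusedSectionVars false

namespace BMKNN

open Finset

section chains

variable {α : Type} [Fintype α] [DecidableEq α]

/-- mod 2 boundary (reduced) -/
def bd (z : Finset α → ZMod 2) (σ : Finset α) : ZMod 2 :=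
  ∑ v, if v ∈ σ then 0 else z (insert v σ)

def cone (w : α) (u : Finset α → ZMod 2) (σ : Finset α) : ZMod 2 :=
  if w ∈ σ then u (σ.erase w) else 0

def lk (w : α) (z : Finset α → ZMod 2) (σ : Finset α) : ZMod 2 :=
  if w ∈ σ then 0 else z (insert w σ)

def dl (w : α) (z : Finset α → ZMod 2) (σ : Finset α) : ZMod 2 :=
  if w ∈ σ then 0 else z σ

lemma two_cancel (a : ZMod 2) : a + a = 0 := CharTwo.add_self_eq_zero a

lemma bd_add (u v : Finset α → ZMod 2) : bd (u + v) = bd u + bd v := by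
  funext σ
  simp only [bd, Pi.add_apply, ← Finset.sum_add_distrib]
  refine Finset.sum_congr rfl fun x _ => ?_
  split_ifs <;> simp

lemma bd_sum {ι : Type} (s : Finset ι) (u : ι → Finset α → ZMod 2) :
    bd (∑ i ∈ s, u i) = ∑ i ∈ s, bd (u i) := by
  classical
  induction s using Finset.induction_on with
  | empty => funext σ; simp [bd]
  | insert a s ha ih => rw [Finset.sum_insert ha, Finset.sum_insert ha, bd_add, ih]

lemma bd_cone (w : α) (u : Finset α → ZMod 2) (hu : ∀ σ, w ∈ σ → u σ = 0) :
    bd (cone w u) = u + cone w (bd u) := by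
  funext σ
  simp only [bd, cone, Pi.add_apply]
  by_cases hw : w ∈ σ
  · simp only [hw, if_true, hu σ hw, zero_add, Finset.mem_insert, or_true]
    refine Finset.sum_congr rfl fun x _ => ?_
    by_cases hx : x = w
    · subst hx
      simp [hw, Finset.insert_erase hw, hu σ hw]
    · by_cases hxs : x ∈ σ
      · simp [hxs, hx]
      · simp only [hxs, Finset.mem_erase, if_false, and_false]
        rw [Finset.erase_insert_of_ne hx]
  · simp only [hw, if_false, add_zero, Finset.mem_insert, or_false]
    rw [Finset.sum_eq_single w]
    · simp [hw]
    · intro b _ hb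
      simp [hb.symm]
    · simp

lemma decomp (w : α) (z : Finset α → ZMod 2) : z = dl w z + cone w (lk w z) := by
  funext σ
  simp only [dl, cone, lk, Pi.add_apply]
  by_cases hw : w ∈ σ
  · simp [hw, Finset.insert_erase hw]
  · simp [hw]

lemma bd_lk (w : α) (z : Finset α → ZMod 2) (hz : bd z = 0) : bd (lk w z) = 0 := by
  funext σ
  by_cases hw : w ∈ σ
  · simp [bd, lk, hw]
  · have := congrFun hz (insert w σ)
    simp only [bd, Pi.zero_apply] at this ⊢
    refine Eq.trans ?_ this
    refine Finset.sum_congr rfl fun x _ => ?_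
    by_cases hx : x = w
    · subst hx; simp [hw, lk]
    · have hx' : ¬ w = x := fun h => hx h.symm
      simp [lk, hw, hx, hx', Finset.insert_comm]

lemma bd_dl (w : α) (z : Finset α → ZMod 2) (hz : bd z = 0) : bd (dl w z) = lk w z := by
  have h := bd_add (dl w z) (cone w (lk w z))
  rw [← decomp, hz, bd_cone _ _ (by intro σ h; simp [lk, h]), bd_lk w z hz] at h
  funext σ
  have h := congrFun h σ
  simp only [Pi.add_apply, Pi.zero_apply, cone, ite_self, add_zero] at h
  exact CharTwo.add_eq_zero.mp h.symm

def Indep (R : α → α → Prop) (σ : Finset α) : Prop :=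
  ∀ x ∈ σ, ∀ y ∈ σ, x ≠ y → ¬ R x y

def Supp (R : α → α → Prop) (E : Finset α) (s : ℕ) (z : Finset α → ZMod 2) : Prop :=
  ∀ σ, z σ ≠ 0 → σ ⊆ E ∧ Indep R σ ∧ σ.card = s

lemma Supp.add {R : α → α → Prop} {E : Finset α} {s : ℕ} {u v : Finset α → ZMod 2}
    (hu : Supp R E s u) (hv : Supp R E s v) : Supp R E s (u + v) := by
  intro σ h
  by_cases h1 : u σ = 0
  · by_cases h2 : v σ = 0
    · simp [h1, h2] at h
    · exact hv σ h2
  · exact hu σ h1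

lemma Supp.sum {ι : Type} {R : α → α → Prop} {E : Finset α} {s : ℕ} (t : Finset ι)
    {u : ι → Finset α → ZMod 2}
    (hu : ∀ i ∈ t, Supp R E s (u i)) : Supp R E s (∑ i ∈ t, u i) := by
  intro σ h
  rw [Finset.sum_apply] at h
  obtain ⟨i, hi, h⟩ := Finset.exists_ne_zero_of_sum_ne_zero h
  exact hu i hi σ h

lemma Supp.mono {R : α → α → Prop} {E F : Finset α} {s : ℕ} {u : Finset α → ZMod 2}
    (hu : Supp R E s u) (h : E ⊆ F) : Supp R F s u := fun σ hσ =>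
  ⟨(hu σ hσ).1.trans h, (hu σ hσ).2⟩

/-- coning a chain with a vertex compatible with the support -/
lemma Supp.cone {R : α → α → Prop} (hR : ∀ x y, R x y → R y x) {E F : Finset α} {s : ℕ}
    {u : Finset α → ZMod 2} {w : α}
    (hu : Supp R F s u) (h : F ⊆ E) (hw : w ∈ E)
    (hu0 : ∀ σ, u σ ≠ 0 → w ∉ σ ∧ ∀ x ∈ σ, ¬ R w x) :
    Supp R E (s + 1) (BMKNN.cone w u) := by
  intro σ hσ
  unfold BMKNN.cone at hσ
  split_ifs at hσ with hwσ
  · obtain ⟨h1, h2, h3⟩ := hu _ hσ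
    obtain ⟨h4, h5⟩ := hu0 _ hσ
    refine ⟨?_, ?_, ?_⟩
    · intro x hx
      by_cases hxw : x = w
      · exact hxw ▸ hw
      · exact h (h1 (Finset.mem_erase.2 ⟨hxw, hx⟩))
    · intro x hx y hy hxy hr
      by_cases hxw : x = w
      · subst hxw
        exact h5 y (Finset.mem_erase.2 ⟨hxy.symm, hy⟩) hr
      · by_cases hyw : y = w
        · subst hyw
          exact h5 x (Finset.mem_erase.2 ⟨hxy, hx⟩) (hR _ _ hr)
        · exact h2 x (Finset.mem_erase.2 ⟨hxw, hx⟩) y (Finset.mem_erase.2 ⟨hyw, hy⟩) hxy hr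
    · rw [← h3, Finset.card_erase_add_one hwσ]
  · exact absurd rfl hσ

/-- Low dimensional cycles are boundaries. -/
lemma fill (R : α → α → Prop) [DecidableRel R] (hR : ∀ x y, R x y → R y x) (wt : α → ℕ) :
    ∀ (N : ℕ) (E I : Finset α) (s : ℕ) (z : Finset α → ZMod 2), E.card = N → I ⊆ E →
      Indep R I → (∀ w ∈ E, (∑ v ∈ I, if R w v then wt v else 0) ≤ 2) →
      2 * s + 1 ≤ ∑ v ∈ I, wt v → Supp R E s z → bd z = 0 →
      ∃ u, Supp R E (s + 1) u ∧ bd u = z := by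
  intro N
  induction N using Nat.strong_induction_on with
  | _ N ih =>
  intro E I s z hN hIE hI hwt hs hz hbz
  have hIne : I.Nonempty := by
    rw [Finset.nonempty_iff_ne_empty]
    rintro rfl
    simp at hs
  obtain ⟨v, hv⟩ := hIne
  have hdl : ∀ w, Supp R (E.erase w) s (dl w z) := by
    intro w σ hσ
    unfold dl at hσ
    split_ifs at hσ with hw
    · exact absurd rfl hσ
    · obtain ⟨h1, h2⟩ := hz σ hσ
      exact ⟨Finset.subset_erase.2 ⟨h1, hw⟩, h2⟩
  by_cases hc : s = 0 ∨ ∀ w ∈ E, w ≠ v → ¬ R v w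
  · refine ⟨cone v (dl v z), (hdl v).cone hR (Finset.erase_subset _ _) (hIE hv) ?_, ?_⟩
    · intro σ hσ
      obtain ⟨h1, h2, h3⟩ := hdl v σ hσ
      refine ⟨fun h => by simpa using h1 h, fun x hx => ?_⟩
      rcases hc with rfl | hc
      · rw [Finset.card_eq_zero] at h3
        subst h3
        simp at hx
      · have := Finset.mem_erase.1 (h1 hx)
        exact hc x this.2 this.1
    · rw [bd_cone _ _ (by intro σ h; simp [dl, h]), bd_dl v z hbz, ← decomp]
  · push Not at hc
    obtain ⟨hs0, w, hwE, hwv, hRvw⟩ := hc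
    obtain ⟨s, rfl⟩ := Nat.exists_eq_succ_of_ne_zero hs0
    have hwI : w ∉ I := fun h => hI v hv w h hwv.symm hRvw
    set E' := E.filter (fun x => x ≠ w ∧ ¬ R w x) with hE'
    have hE'E : E' ⊆ E := Finset.filter_subset _ _
    have hlt : E'.card < N := by
      rw [← hN]
      refine Finset.card_lt_card ⟨hE'E, fun h => ?_⟩
      have := h hwE
      simp [hE'] at this
    have hlk : Supp R E' s (lk w z) := by
      intro σ hσ
      unfold lk at hσ
      split_ifs at hσ with hw
      · exact absurd rfl hσ
      · obtain ⟨h1, h2, h3⟩ := hz _ hσ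
        refine ⟨fun x hx => ?_, fun x hx y hy => h2 x (Finset.mem_insert_of_mem hx) y
          (Finset.mem_insert_of_mem hy), ?_⟩
        · have hxw : x ≠ w := fun h => hw (h ▸ hx)
          simp only [hE', Finset.mem_filter]
          exact ⟨h1 (Finset.mem_insert_of_mem hx), hxw,
            h2 w (Finset.mem_insert_self _ _) x (Finset.mem_insert_of_mem hx) hxw.symm⟩
        · rw [Finset.card_insert_of_notMem hw] at h3
          omega
    obtain ⟨u, hu, hbu⟩ := ih E'.card hlt E' (I.filter (fun x => ¬ R w x)) s (lk w z) rfl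
      (by
        intro x hx
        simp only [Finset.mem_filter, hE'] at hx ⊢
        exact ⟨hIE hx.1, fun h => hwI (h ▸ hx.1), hx.2⟩)
      (fun x hx y hy => hI x (Finset.mem_filter.1 hx).1 y (Finset.mem_filter.1 hy).1)
      (fun x hx => (Finset.sum_le_sum_of_subset (Finset.filter_subset _ _)).trans
        (hwt x (hE'E hx)))
      (by
        have h1 := hwt w hwE
        rw [← Finset.sum_filter] at h1
        have h2 := Finset.sum_filter_add_sum_filter_not I (fun x => R w x) wt
        omega)
      hlk (bd_lk w z hbz)
    have hu' : ∀ σ, u σ ≠ 0 → w ∉ σ ∧ ∀ x ∈ σ, ¬ R w x := by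
      intro σ hσ
      obtain ⟨h1, _⟩ := hu σ hσ
      refine ⟨fun h => ?_, fun x hx => ?_⟩
      · have := h1 h
        simp [hE'] at this
      · have := h1 hx
        simp only [hE', Finset.mem_filter] at this
        exact this.2.2
    have hbe : bd (dl w z + u) = 0 := by
      rw [bd_add, bd_dl w z hbz, hbu]
      funext σ
      exact two_cancel _
    obtain ⟨t, ht, hbt⟩ := ih (E.erase w).card
      (by rw [← hN]; exact Finset.card_erase_lt_of_mem hwE) (E.erase w) I (s + 1) (dl w z + u) rfl
      (Finset.subset_erase.2 ⟨hIE, hwI⟩) hI (fun x hx => hwt x (Finset.mem_of_mem_erase hx)) hs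
      ((hdl w).add (hu.mono (by
        intro x hx
        simp only [hE', Finset.mem_filter] at hx
        exact Finset.mem_erase.2 ⟨hx.2.1, hx.1⟩))) hbe
    refine ⟨t + cone w u, (ht.mono (Finset.erase_subset _ _)).add
      (hu.cone hR hE'E hwE hu'), ?_⟩
    rw [bd_add, hbt, bd_cone _ _ (fun σ h => by
      by_contra h'
      exact (hu' σ h').1 h), hbu]
    conv_rhs => rw [decomp w z]
    funext σ
    simp only [Pi.add_apply]
    have := two_cancel (u σ)
    linear_combination this

end chains

section hall

variable {α κ : Type} [Fintype α] [DecidableEq α] [DecidableEq κ]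

/-- double boundary over colour sets vanishes -/
lemma double_erase {A : Type} [AddCommGroup A] (hA : ∀ a : A, a + a = 0)
    (φ : Finset κ → A) (K : Finset κ) :
    ∑ c ∈ K, ∑ c' ∈ K.erase c, φ ((K.erase c).erase c') = 0 := by
  rw [Finset.sum_sigma']
  refine Finset.sum_involution (fun p _ => ⟨p.2, p.1⟩) ?_ ?_ ?_ ?_
  · rintro ⟨a, b⟩ _
    simp only [Finset.erase_right_comm (a := a) (b := b)]
    exact hA _
  · rintro ⟨a, b⟩ h _ h'
    simp only [Finset.mem_sigma, Finset.mem_erase] at h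
    simp only [Sigma.mk.injEq, heq_eq_eq] at h'
    exact h.2.1 h'.1
  · rintro ⟨a, b⟩ h
    simp only [Finset.mem_sigma, Finset.mem_erase] at h ⊢
    exact ⟨h.2.2, fun h' => h.2.1 h'.symm, h.1⟩
  · rintro ⟨a, b⟩ _
    rfl

/-- number of vertices of colour `c`, mod 2 -/
def cnt (col : α → κ) (c : κ) (σ : Finset α) : ZMod 2 := ((σ.filter (fun x => col x = c)).card : ZMod 2)

def pr (col : α → κ) (K : Finset κ) (σ : Finset α) : ZMod 2 := ∏ c ∈ K, cnt col c σ

lemma cnt_erase (col : α → κ) (c : κ) (σ : Finset α) (v : α) (hv : v ∈ σ) :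
    cnt col c (σ.erase v) = cnt col c σ + if col v = c then 1 else 0 := by
  unfold cnt
  have he : (σ.erase v).filter (fun x => col x = c) = (σ.filter (fun x => col x = c)).erase v := by
    ext x
    simp only [Finset.mem_filter, Finset.mem_erase]
    tauto
  rw [he]
  split_ifs with h
  · have := Finset.card_erase_add_one (s := σ.filter (fun x => col x = c)) (a := v) (by simp [hv, h])
    rw [← this]
    push_cast
    have := two_cancel 1
    linear_combination -this
  · rw [Finset.erase_eq_of_notMem (by simp [h])]
    simp

lemma pr_bd (col : α → κ) (K : Finset κ) (c : κ) (hc : c ∈ K) (σ : Finset α)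
    (hσ : ∀ x ∈ σ, col x ∈ K) :
    ∑ v ∈ σ, pr col (K.erase c) (σ.erase v) = pr col K σ := by
  rw [← Finset.sum_fiberwise_of_maps_to (g := col) (t := K) hσ]
  rw [Finset.sum_eq_single c]
  · have : ∀ v ∈ σ.filter (fun x => col x = c), pr col (K.erase c) (σ.erase v)
        = pr col (K.erase c) σ := by
      intro v hv
      obtain ⟨hv, hvc⟩ := Finset.mem_filter.1 hv
      refine Finset.prod_congr rfl fun x hx => ?_
      rw [cnt_erase _ _ _ _ hv, if_neg, add_zero]
      rw [hvc]
      exact (Finset.ne_of_mem_erase hx).symm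
    rw [Finset.sum_congr rfl this, Finset.sum_const, nsmul_eq_mul]
    exact Finset.mul_prod_erase K (fun c => cnt col c σ) hc
  · intro b hb hbc
    have : ∀ v ∈ σ.filter (fun x => col x = b), pr col (K.erase c) (σ.erase v)
        = (cnt col b σ + 1) * pr col ((K.erase c).erase b) σ := by
      intro v hv
      obtain ⟨hv, hvc⟩ := Finset.mem_filter.1 hv
      unfold pr
      rw [← Finset.mul_prod_erase (K.erase c) _ (Finset.mem_erase.2 ⟨hbc, hb⟩)]
      congr 1
      · rw [cnt_erase _ _ _ _ hv, if_pos hvc]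
      · refine Finset.prod_congr rfl fun x hx => ?_
        rw [cnt_erase _ _ _ _ hv, if_neg, add_zero]
        rw [hvc]
        exact (Finset.ne_of_mem_erase hx).symm
    rw [Finset.sum_congr rfl this, Finset.sum_const, nsmul_eq_mul, ← mul_assoc]
    have h2 : ∀ a : ZMod 2, a * (a + 1) = 0 := by decide
    have := h2 (cnt col b σ)
    rw [cnt] at this ⊢
    rw [this, zero_mul]
  · exact fun h => absurd hc h

/-- duality between boundary and erasing -/
lemma bd_dual (p z : Finset α → ZMod 2) :
    ∑ τ, p τ * bd z τ = ∑ σ, z σ * ∑ v ∈ σ, p (σ.erase v) := by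
  have h1 : ∀ τ, p τ * bd z τ = ∑ v ∈ univ.filter (fun v => v ∉ τ), p τ * z (insert v τ) := by
    intro τ
    rw [bd, Finset.mul_sum, Finset.sum_filter]
    refine Finset.sum_congr rfl fun v _ => ?_
    by_cases h : v ∈ τ <;> simp [h]
  simp only [h1, Finset.mul_sum]
  rw [Finset.sum_sigma', Finset.sum_sigma']
  refine Finset.sum_bij' (fun q _ => ⟨insert q.2 q.1, q.2⟩) (fun q _ => ⟨q.1.erase q.2, q.2⟩) ?_ ?_ ?_ ?_ ?_
  · rintro ⟨τ, v⟩ h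
    simp
  · rintro ⟨τ, v⟩ h
    simp
  · rintro ⟨τ, v⟩ h
    simp only [Finset.mem_sigma, Finset.mem_filter, Finset.mem_univ, true_and] at h
    simp [h]
  · rintro ⟨τ, v⟩ h
    simp only [Finset.mem_sigma, Finset.mem_univ, true_and] at h
    simp [h]
  · rintro ⟨τ, v⟩ h
    simp only [Finset.mem_sigma, Finset.mem_filter, Finset.mem_univ, true_and] at h
    simp [h, mul_comm]

theorem hall (R : α → α → Prop) [DecidableRel R] (hR : ∀ x y, R x y → R y x) (wt : α → ℕ)
    (E : Finset α) (col : α → κ) [Fintype κ]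
    (hyp : ∀ K : Finset κ, K.Nonempty → ∃ I ⊆ E.filter (fun x => col x ∈ K), Indep R I ∧
      (∀ w, (∑ v ∈ I, if R w v then wt v else 0) ≤ 2) ∧ 2 * K.card ≤ (∑ v ∈ I, wt v) + 1) :
    ∃ T ⊆ E, Indep R T ∧ ∀ c, ∃ x ∈ T, col x = c := by
  have key : ∀ m : ℕ, ∃ φ : Finset κ → Finset α → ZMod 2, ∀ K : Finset κ, K.card ≤ m →
      Supp R (E.filter (fun x => col x ∈ K)) K.card (φ K) ∧
      bd (φ K) = ∑ c ∈ K, φ (K.erase c) ∧ ∑ σ, φ K σ * pr col K σ = 1 := by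
    intro m
    induction m with
    | zero =>
      refine ⟨fun _ σ => if σ = ∅ then 1 else 0, fun K hK => ?_⟩
      have : K = ∅ := by simpa using hK
      subst this
      refine ⟨?_, ?_, ?_⟩
      · intro σ hσ
        have : σ = ∅ := by
          by_contra h
          simp [h] at hσ
        subst this
        simp [Indep]
      · funext σ
        simp [bd]
      · simp [pr]
    | succ m ih =>
      obtain ⟨φ, hφ⟩ := ih
      have step : ∀ K : Finset κ, ∃ u : Finset α → ZMod 2, K.card = m + 1 →
          Supp R (E.filter (fun x => col x ∈ K)) (m + 1) u ∧
          bd u = ∑ c ∈ K, φ (K.erase c) := by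
        intro K
        by_cases hK : K.card = m + 1
        swap
        · exact ⟨0, fun h => absurd h hK⟩
        have hce : ∀ c ∈ K, (K.erase c).card = m := fun c hc => by
          rw [Finset.card_erase_of_mem hc, hK]; rfl
        obtain ⟨I, hIE, hI, hw, hs⟩ := hyp K (Finset.card_pos.1 (by omega))
        obtain ⟨u, hu⟩ := fill R hR wt _ (E.filter (fun x => col x ∈ K)) I m
          (∑ c ∈ K, φ (K.erase c)) rfl hIE hI (fun w _ => hw w) (by omega)
          (Supp.sum _ fun c hc => by
            have := (hφ (K.erase c) (hce c hc).le).1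
            rw [hce c hc] at this
            refine this.mono ?_
            intro x hx
            simp only [Finset.mem_filter, Finset.mem_erase] at hx ⊢
            exact ⟨hx.1, hx.2.2⟩)
          (by
            rw [bd_sum]
            rw [← double_erase (A := Finset α → ZMod 2) (fun a => by funext σ; exact two_cancel _) φ K]
            exact Finset.sum_congr rfl fun c hc => (hφ _ (hce c hc).le).2.1)
        exact ⟨u, fun _ => hu⟩
      choose ψ hψ using step
      refine ⟨fun K => if K.card = m + 1 then ψ K else φ K, fun K hK => ?_⟩
      by_cases hKm : K.card = m + 1
      swap
      · have hKm' : K.card ≤ m := by omega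
        obtain ⟨h1, h2, h3⟩ := hφ K hKm'
        simp only [hKm, if_false]
        refine ⟨h1, ?_, h3⟩
        rw [h2]
        refine Finset.sum_congr rfl fun c hc => ?_
        rw [if_neg]
        have := Finset.card_erase_le (s := K) (a := c)
        omega
      have hce : ∀ c ∈ K, (K.erase c).card = m := fun c hc => by
        rw [Finset.card_erase_of_mem hc, hKm]; rfl
      obtain ⟨h1, h2⟩ := hψ K hKm
      simp only [hKm, if_true]
      refine ⟨h1, ?_, ?_⟩
      · rw [h2]
        refine Finset.sum_congr rfl fun c hc => ?_
        rw [if_neg]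
        rw [hce c hc]
        omega
      · obtain ⟨c, hc⟩ : K.Nonempty := Finset.card_pos.1 (by omega)
        have e1 := bd_dual (pr col (K.erase c)) (ψ K)
        have e2 : ∑ σ, ψ K σ * ∑ v ∈ σ, pr col (K.erase c) (σ.erase v)
            = ∑ σ, ψ K σ * pr col K σ := by
          refine Finset.sum_congr rfl fun σ _ => ?_
          by_cases h0 : ψ K σ = 0
          · simp [h0]
          · rw [pr_bd col K c hc σ]
            intro x hx
            exact (Finset.mem_filter.1 ((h1 σ h0).1 hx)).2
        rw [← e2, ← e1, h2]
        simp only [Finset.sum_apply, Finset.mul_sum]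
        rw [Finset.sum_comm, Finset.sum_eq_single c]
        · rw [← (hφ (K.erase c) (hce c hc).le).2.2]
          exact Finset.sum_congr rfl fun σ _ => mul_comm _ _
        · intro b hb hbc
          refine Finset.sum_eq_zero fun σ _ => ?_
          by_cases h0 : φ (K.erase b) σ = 0
          · simp [h0]
          · have hs := ((hφ (K.erase b) (hce b hb).le).1 σ h0).1
            have : pr col (K.erase c) σ = 0 := by
              refine Finset.prod_eq_zero (Finset.mem_erase.2 ⟨hbc, hb⟩) ?_
              unfold cnt
              rw [Finset.filter_eq_empty_iff.2]
              · simp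
              · intro x hx hxb
                have := hs hx
                simp [hxb] at this
            rw [this, zero_mul]
        · exact fun h => absurd hc h
  obtain ⟨φ, hφ⟩ := key (Fintype.card κ)
  obtain ⟨h1, -, h3⟩ := hφ univ le_rfl
  obtain ⟨σ, -, hσ⟩ := Finset.exists_ne_zero_of_sum_ne_zero (h3.trans_ne one_ne_zero)
  have ha : φ univ σ ≠ 0 := left_ne_zero_of_mul hσ
  have hb : pr col univ σ ≠ 0 := right_ne_zero_of_mul hσ
  obtain ⟨h4, h5, -⟩ := h1 σ ha
  refine ⟨σ, h4.trans (Finset.filter_subset _ _), h5, fun c => ?_⟩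
  have hc := (Finset.prod_ne_zero_iff.1 hb) c (Finset.mem_univ _)
  by_contra hcon
  push Not at hcon
  apply hc
  unfold cnt
  rw [Finset.filter_eq_empty_iff.2 (fun x hx => hcon x hx)]
  simp

end hall

/-- A bipartite graph carrying a fractional matching of size `r` has a matching of size `r`. -/
lemma bip (n r : ℕ) (g : Fin n → Fin n → ℝ) (D : ℝ) (hD : 0 < D) (hg : ∀ b c, 0 ≤ g b c)
    (hrow : ∀ b, ∑ c, g b c ≤ D) (hcol : ∀ c, ∑ b, g b c ≤ D)
    (htot : (r : ℝ) * D ≤ ∑ b, ∑ c, g b c) :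
    ∃ P : Finset (Fin n × Fin n), P.card = r ∧ (∀ p ∈ P, 0 < g p.1 p.2) ∧
      (∀ p ∈ P, ∀ q ∈ P, p.1 = q.1 → p = q) ∧ (∀ p ∈ P, ∀ q ∈ P, p.2 = q.2 → p = q) := by
  classical
  have hrn : r ≤ n := by
    have h1 : ∑ b, ∑ c, g b c ≤ ∑ b : Fin n, D := Finset.sum_le_sum fun b _ => hrow b
    simp only [Finset.sum_const, Finset.card_univ, Fintype.card_fin, nsmul_eq_mul] at h1
    have h2 := le_of_mul_le_mul_right (htot.trans h1) hD
    exact_mod_cast h2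
  let t : Fin n → Finset (Fin n ⊕ Fin (n - r)) := fun b =>
    (univ.filter (fun c => 0 < g b c)).disjSum univ
  have hall : ∀ S : Finset (Fin n), S.card ≤ (S.biUnion t).card := by
    intro S
    rcases S.eq_empty_or_nonempty with rfl | ⟨b0, hb0⟩
    · simp
    set NS : Finset (Fin n) := univ.filter (fun c => ∃ b ∈ S, 0 < g b c) with hNS
    have hsub : NS.disjSum univ ⊆ S.biUnion t := by
      intro x hx
      rw [Finset.mem_biUnion]
      rcases x with c | j
      · simp only [Finset.inl_mem_disjSum, hNS, Finset.mem_filter, Finset.mem_univ, true_and] at hx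
        obtain ⟨b, hb, h⟩ := hx
        exact ⟨b, hb, by simp [t, h]⟩
      · exact ⟨b0, hb0, by simp [t]⟩
    have hcard := Finset.card_le_card hsub
    rw [Finset.card_disjSum, Finset.card_univ, Fintype.card_fin] at hcard
    have h1 : ∑ b ∈ S, ∑ c, g b c ≤ NS.card * D := by
      have e1 : ∀ b ∈ S, ∑ c, g b c = ∑ c ∈ NS, g b c := by
        intro b hb
        symm
        refine Finset.sum_subset (Finset.subset_univ _) fun c _ hc => ?_
        by_contra h
        exact hc (by
          simp only [hNS, Finset.mem_filter, Finset.mem_univ, true_and]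
          exact ⟨b, hb, lt_of_le_of_ne (hg b c) (Ne.symm h)⟩)
      rw [Finset.sum_congr rfl e1, Finset.sum_comm]
      calc ∑ c ∈ NS, ∑ b ∈ S, g b c ≤ ∑ c ∈ NS, D := by
            refine Finset.sum_le_sum fun c _ => ?_
            exact (Finset.sum_le_sum_of_subset_of_nonneg (Finset.subset_univ S)
              (fun b _ _ => hg b c)).trans (hcol c)
        _ = NS.card * D := by simp
    have h2 : ∑ b ∈ Sᶜ, ∑ c, g b c ≤ (Sᶜ.card : ℝ) * D := by
      calc ∑ b ∈ Sᶜ, ∑ c, g b c ≤ ∑ b ∈ Sᶜ, D := Finset.sum_le_sum fun b _ => hrow b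
        _ = _ := by simp
    have h3 := Finset.sum_add_sum_compl S (fun b => ∑ c, g b c)
    have h4 : (r : ℝ) * D ≤ ((NS.card + Sᶜ.card : ℕ) : ℝ) * D := by
      push_cast
      linarith
    have h5 : r ≤ NS.card + Sᶜ.card := by exact_mod_cast le_of_mul_le_mul_right h4 hD
    have h6 := Finset.card_add_card_compl S
    rw [Fintype.card_fin] at h6
    omega
  obtain ⟨m, hm, hmt⟩ := (Finset.all_card_le_biUnion_card_iff_exists_injective t).1 hall
  let P : Finset (Fin n × Fin n) := univ.filter (fun p => m p.1 = Sum.inl p.2)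
  have hP : ∀ p, p ∈ P ↔ m p.1 = Sum.inl p.2 := fun p => by simp [P]
  have hPc : r ≤ P.card := by
    have : (univ : Finset (Fin n)).card ≤ (P.disjSum (univ : Finset (Fin (n - r)))).card := by
      refine Finset.card_le_card_of_injOn
        (fun b => Sum.map (fun c => (b, c)) id (m b)) ?_ ?_
      · intro b _
        rcases h : m b with c | j
        · simp [h, hP]
        · simp [h]
      · intro b _ b' _ hbb
        apply hm
        rcases h : m b with c | j <;> rcases h' : m b' with c' | j' <;> simp [h, h'] at hbb ⊢
        · exact hbb.2
        · exact hbb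
    rw [Finset.card_disjSum] at this
    simp only [Finset.card_univ, Fintype.card_fin] at this
    omega
  obtain ⟨Q, hQP, hQ⟩ := Finset.exists_subset_card_eq hPc
  refine ⟨Q, hQ, ?_, ?_, ?_⟩
  · intro p hp
    have h1 := (hP p).1 (hQP hp)
    have h2 := hmt p.1
    rw [h1] at h2
    simpa [t] using h2
  · intro p hp q hq hpq
    have h1 := (hP p).1 (hQP hp)
    have h2 := (hP q).1 (hQP hq)
    rw [hpq, h2] at h1
    exact Prod.ext hpq (Sum.inl_injective h1).symm
  · intro p hp q hq hpq
    have h1 := (hP p).1 (hQP hp)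
    have h2 := (hP q).1 (hQP hq)
    rw [hpq, ← h2] at h1
    exact Prod.ext (hm h1) hpq

/-- Large matchings in the links. -/
lemma link_matching (k n : ℕ) (hk : 1 ≤ k) (hkn : k ≤ n)
    (H : Finset (Fin k × Fin n × Fin n)) (hH : TriFracBalanced H) (K : Finset (Fin k)) (r : ℕ)
    (hr : r * k ≤ K.card * n) :
    ∃ P : Finset (Fin k × Fin n × Fin n), P ⊆ H ∧ P.card = r ∧ (∀ p ∈ P, p.1 ∈ K) ∧
      (∀ p ∈ P, ∀ q ∈ P, p.2.1 = q.2.1 → p = q) ∧ (∀ p ∈ P, ∀ q ∈ P, p.2.2 = q.2.2 → p = q) := by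
  classical
  obtain ⟨f, ⟨hf0, hfH, hA, hB, hC⟩, hne⟩ := hH
  have sA : ∀ v : Fin k, (∑ e : Fin k × Fin n × Fin n, if e.1 = v then f e else 0)
      = ∑ b, ∑ c, f (v, b, c) := by
    intro v
    rw [Fintype.sum_prod_type, Finset.sum_eq_single v]
    · simp [Fintype.sum_prod_type]
    · intro b _ hb; simp [hb]
    · simp
  have sB : ∀ v : Fin n, (∑ e : Fin k × Fin n × Fin n, if e.2.1 = v then f e else 0)
      = ∑ a, ∑ c, f (a, v, c) := by
    intro v
    rw [Fintype.sum_prod_type]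
    refine Finset.sum_congr rfl fun a _ => ?_
    rw [Fintype.sum_prod_type, Finset.sum_eq_single v]
    · simp
    · intro b _ hb; simp [hb]
    · simp
  have sC : ∀ v : Fin n, (∑ e : Fin k × Fin n × Fin n, if e.2.2 = v then f e else 0)
      = ∑ a, ∑ b, f (a, b, v) := by
    intro v
    rw [Fintype.sum_prod_type]
    refine Finset.sum_congr rfl fun a _ => ?_
    rw [Fintype.sum_prod_type]
    refine Finset.sum_congr rfl fun b _ => ?_
    simp
  simp only [sA] at hA
  simp only [sB] at hB
  simp only [sC] at hC
  have a0 : Fin k := ⟨0, hk⟩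
  have b0 : Fin n := ⟨0, by omega⟩
  set DA := ∑ b, ∑ c, f (a0, b, c) with hDA
  set DB := ∑ a, ∑ c, f (a, b0, c) with hDB
  set DC := ∑ a, ∑ b, f (a, b, b0) with hDC
  have tA : ∑ a, ∑ b, ∑ c, f (a, b, c) = k * DA := by
    rw [Finset.sum_congr rfl fun a _ => hA a a0]; simp [hDA]
  have tB : ∑ a, ∑ b, ∑ c, f (a, b, c) = n * DB := by
    rw [Finset.sum_comm, Finset.sum_congr rfl fun a _ => hB a b0]; simp [hDB]
  have tC : ∑ a, ∑ b, ∑ c, f (a, b, c) = n * DC := by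
    have : ∑ a, ∑ b, ∑ c, f (a, b, c) = ∑ c, ∑ a, ∑ b, f (a, b, c) := by
      rw [Finset.sum_comm (s := (univ : Finset (Fin n))) (t := (univ : Finset (Fin k)))]
      exact Finset.sum_congr rfl fun a _ => Finset.sum_comm
    rw [this, Finset.sum_congr rfl fun a _ => hC a b0]; simp [hDC]
  have tpos : 0 < ∑ a, ∑ b, ∑ c, f (a, b, c) := by
    have h1 : ∑ a, ∑ b, ∑ c, f (a, b, c) = ∑ e, f e := by
      simp [Fintype.sum_prod_type]
    rw [h1]
    refine lt_of_le_of_ne (Finset.sum_nonneg fun e _ => hf0 e) fun h => hne ?_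
    funext e
    exact (Finset.sum_eq_zero_iff_of_nonneg (fun e _ => hf0 e)).1 h.symm e (Finset.mem_univ _)
  have hn0 : (0 : ℝ) < n := by exact_mod_cast (by omega : 0 < n)
  have hk0 : (0 : ℝ) < k := by exact_mod_cast hk
  have hDBpos : 0 < DB := by
    rw [tB] at tpos
    exact pos_of_mul_pos_right tpos hn0.le
  have hBC : DC = DB := by
    have := tB.symm.trans tC
    exact (mul_left_cancel₀ hn0.ne' this).symm
  have hAB : (k : ℝ) * DA = n * DB := tA.symm.trans tB
  have nn : ∀ a b c, 0 ≤ f (a, b, c) := fun a b c => hf0 _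
  obtain ⟨P, hPr, hPpos, hP1, hP2⟩ := bip n r (fun b c => ∑ a ∈ K, f (a, b, c)) DB hDBpos
    (fun b c => Finset.sum_nonneg fun a _ => nn a b c)
    (fun b => by
      rw [Finset.sum_comm, hDB, ← hB b b0]
      exact Finset.sum_le_sum_of_subset_of_nonneg (Finset.subset_univ K)
        (fun a _ _ => Finset.sum_nonneg fun c _ => nn a b c))
    (fun c => by
      rw [Finset.sum_comm, ← hBC, hDC, ← hC c b0]
      exact Finset.sum_le_sum_of_subset_of_nonneg (Finset.subset_univ K)
        (fun a _ _ => Finset.sum_nonneg fun b _ => nn a b c))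
    (by
      have h1 : ∑ b, ∑ c, ∑ a ∈ K, f (a, b, c) = K.card * DA := by
        have : ∑ b, ∑ c, ∑ a ∈ K, f (a, b, c) = ∑ a ∈ K, ∑ b, ∑ c, f (a, b, c) := by
          rw [Finset.sum_comm (s := K)]
          exact Finset.sum_congr rfl fun b _ => Finset.sum_comm
        rw [this, Finset.sum_congr rfl fun a _ => hA a a0]
        simp [hDA]
      rw [h1]
      have hr' : (r : ℝ) * k ≤ K.card * n := by exact_mod_cast hr
      refine le_of_mul_le_mul_right ?_ hk0
      have := mul_le_mul_of_nonneg_right hr' hDBpos.le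
      calc (r : ℝ) * DB * k = r * k * DB := by ring
        _ ≤ K.card * n * DB := this
        _ = K.card * (k * DA) := by rw [hAB]; ring
        _ = _ := by ring)
  have hex : ∀ p : Fin n × Fin n, ∃ a : Fin k, p ∈ P → a ∈ K ∧ f (a, p.1, p.2) ≠ 0 := by
    intro p
    by_cases hp : p ∈ P
    · obtain ⟨a, ha, h⟩ := Finset.exists_ne_zero_of_sum_ne_zero (hPpos p hp).ne'
      exact ⟨a, fun _ => ⟨ha, h⟩⟩
    · exact ⟨a0, fun h => absurd h hp⟩
  choose α hα using hex
  refine ⟨P.image (fun p => (α p, p)), ?_, ?_, ?_, ?_, ?_⟩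
  · intro e he
    obtain ⟨p, hp, rfl⟩ := Finset.mem_image.1 he
    by_contra h
    exact (hα p hp).2 (hfH _ h)
  · rw [Finset.card_image_of_injective _ (fun p q h => (Prod.ext_iff.1 h).2), hPr]
  · intro e he
    obtain ⟨p, hp, rfl⟩ := Finset.mem_image.1 he
    exact (hα p hp).1
  · intro e he e' he' h
    obtain ⟨p, hp, rfl⟩ := Finset.mem_image.1 he
    obtain ⟨q, hq, rfl⟩ := Finset.mem_image.1 he'
    rw [hP1 p hp q hq h]
  · intro e he e' he' h
    obtain ⟨p, hp, rfl⟩ := Finset.mem_image.1 he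
    obtain ⟨q, hq, rfl⟩ := Finset.mem_image.1 he'
    rw [hP2 p hp q hq h]

/-- conflict relation on edges together with dummy edges -/
def Conf (k n d : ℕ) : (Fin k × Fin n × Fin n) ⊕ (Fin k × Fin d) →
    (Fin k × Fin n × Fin n) ⊕ (Fin k × Fin d) → Prop
  | Sum.inl e, Sum.inl e' => e.2.1 = e'.2.1 ∨ e.2.2 = e'.2.2
  | Sum.inr p, Sum.inr q => p.2 = q.2
  | _, _ => False

def wgt (k n d : ℕ) : (Fin k × Fin n × Fin n) ⊕ (Fin k × Fin d) → ℕ :=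
  Sum.elim (fun _ => 1) (fun _ => 2)

def colr (k n d : ℕ) : (Fin k × Fin n × Fin n) ⊕ (Fin k × Fin d) → Fin k :=
  Sum.elim (fun e => e.1) (fun p => p.1)

lemma arith (k n d κ : ℕ) (hκ : κ ≤ k) (hd : d = k - (n + 1) / 2) :
    (2 * κ - 1 - 2 * d) * k ≤ κ * n := by
  rcases Nat.eq_zero_or_pos (2 * κ - 1 - 2 * d) with h0 | hpos
  · simp [h0]
  obtain ⟨r, hr⟩ : ∃ r, r = 2 * κ - 1 - 2 * d := ⟨_, rfl⟩
  rw [← hr]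
  rcases le_or_gt k ((n + 1) / 2) with h | h
  · have h1 : r + 1 = 2 * κ := by omega
    have h2 : 2 * k ≤ n + 1 := by omega
    nlinarith
  · have h1 : r + 2 * k ≤ 2 * κ + n := by omega
    have h2 : n ≤ 2 * k := by omega
    nlinarith [Nat.mul_le_mul_right k h1, mul_nonneg (sub_nonneg.2 (Int.ofNat_le.2 hκ))
      (sub_nonneg.2 (Int.ofNat_le.2 h2))]

theorem main (k n : ℕ) (hk : 1 ≤ k) (hkn : k ≤ n)
    (H : Finset (Fin k × Fin n × Fin n)) (hH : TriFracBalanced H) :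
    ∃ M, TriMatching H M ∧ M.card = min k ((n + 1) / 2) := by
  classical
  obtain ⟨d, hd⟩ : ∃ d, d = k - (n + 1) / 2 := ⟨_, rfl⟩
  obtain ⟨T, hTE, hT, hTc⟩ := hall (Conf k n d)
    (by
      rintro (e | p) (e' | p') h
      · rcases h with h | h
        · exact Or.inl h.symm
        · exact Or.inr h.symm
      · exact h
      · exact h
      · exact Eq.symm h)
    (wgt k n d) (H.disjSum univ) (colr k n d)
    (by
      rintro K ⟨a0, ha0⟩
      have hKk : K.card ≤ k := by simpa using Finset.card_le_univ K
      obtain ⟨P, hPH, hPc, hPK, hP1, hP2⟩ := link_matching k n hk hkn H hH K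
        (2 * K.card - 1 - 2 * d) (arith k n d K.card hKk hd)
      refine ⟨P.disjSum (univ.image fun j : Fin d => (a0, j)), ?_, ?_, ?_, ?_⟩
      · rintro (e | p) hx
        · simp only [Finset.inl_mem_disjSum, Finset.mem_filter] at hx ⊢
          exact ⟨hPH hx, hPK e hx⟩
        · simp only [Finset.inr_mem_disjSum, Finset.mem_filter, Finset.mem_image] at hx ⊢
          obtain ⟨j, _, rfl⟩ := hx
          exact ⟨Finset.mem_univ _, ha0⟩
      · rintro (e | p) hx (e' | p') hy hne hc
        · simp only [Finset.inl_mem_disjSum] at hx hy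
          rcases hc with hc | hc
          · exact hne (congrArg _ (hP1 e hx e' hy hc))
          · exact hne (congrArg _ (hP2 e hx e' hy hc))
        · exact hc
        · exact hc
        · simp only [Finset.inr_mem_disjSum, Finset.mem_image] at hx hy
          obtain ⟨j, _, rfl⟩ := hx
          obtain ⟨j', _, rfl⟩ := hy
          have hc : j = j' := hc
          exact hne (by rw [hc])
      · rintro (e | p)
        · rw [Finset.sum_disjSum]
          have z2 : ∑ q ∈ univ.image (fun j : Fin d => (a0, j)),
              (if Conf k n d (Sum.inl e) (Sum.inr q) then wgt k n d (Sum.inr q) else 0) = 0 :=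
            Finset.sum_eq_zero fun q _ => if_neg (fun h => h)
          rw [z2, add_zero]
          have z1 : ∑ e' ∈ P, (if Conf k n d (Sum.inl e) (Sum.inl e') then
              wgt k n d (Sum.inl e') else 0) ≤ ∑ e' ∈ P, ((if e.2.1 = e'.2.1 then 1 else 0) +
                (if e.2.2 = e'.2.2 then 1 else 0)) := by
            refine Finset.sum_le_sum fun e' _ => ?_
            simp only [Conf, wgt, Sum.elim_inl]
            by_cases h1 : e.2.1 = e'.2.1 <;> by_cases h2 : e.2.2 = e'.2.2 <;> simp [h1, h2]
          refine z1.trans ?_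
          rw [Finset.sum_add_distrib, ← Finset.card_filter, ← Finset.card_filter]
          have c1 : (P.filter (fun e' => e.2.1 = e'.2.1)).card ≤ 1 := by
            refine Finset.card_le_one.2 fun x hx y hy => ?_
            rw [Finset.mem_filter] at hx hy
            exact hP1 x hx.1 y hy.1 (hx.2.symm.trans hy.2)
          have c2 : (P.filter (fun e' => e.2.2 = e'.2.2)).card ≤ 1 := by
            refine Finset.card_le_one.2 fun x hx y hy => ?_
            rw [Finset.mem_filter] at hx hy
            exact hP2 x hx.1 y hy.1 (hx.2.symm.trans hy.2)
          omega
        · rw [Finset.sum_disjSum]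
          have z1 : ∑ e' ∈ P, (if Conf k n d (Sum.inr p) (Sum.inl e') then
              wgt k n d (Sum.inl e') else 0) = 0 :=
            Finset.sum_eq_zero fun q _ => if_neg (fun h => h)
          rw [z1, zero_add, Finset.sum_image (fun x _ y _ h => (Prod.ext_iff.1 h).2)]
          rw [Finset.sum_eq_single p.2]
          · exact (if_pos (show Conf k n d (Sum.inr p) (Sum.inr (a0, p.2)) from rfl)).le
          · exact fun b _ hb => if_neg (fun h : p.2 = b => hb h.symm)
          · exact fun h => absurd (Finset.mem_univ _) h
      · rw [Finset.sum_disjSum]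
        simp only [wgt, Sum.elim_inl, Sum.elim_inr, Finset.sum_const, smul_eq_mul]
        rw [Finset.card_image_of_injective _ (fun x y h => (Prod.ext_iff.1 h).2), hPc,
          Finset.card_univ, Fintype.card_fin]
        omega)
  choose x hxT hxc using hTc
  let M : Finset (Fin k × Fin n × Fin n) := univ.filter (fun e => x e.1 = Sum.inl e)
  have hM : ∀ e, e ∈ M ↔ x e.1 = Sum.inl e := fun e => by simp [M]
  have hmatch : TriMatching H M := by
    refine ⟨fun e he => ?_, fun e he e' he' hne => ?_⟩
    · have h := hTE (hxT e.1)
      rw [(hM e).1 he] at h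
      simpa using h
    · have h1 := (hM e).1 he
      have h2 := (hM e').1 he'
      have h3 := hxT e.1
      have h4 := hxT e'.1
      rw [h1] at h3
      rw [h2] at h4
      have h5 := hT _ h3 _ h4 (fun h => hne (Sum.inl_injective h))
      refine ⟨fun h => ?_, fun h => h5 (Or.inl h), fun h => h5 (Or.inr h)⟩
      rw [h, h2] at h1
      exact hne (Sum.inl_injective h1).symm
  have hcard : k ≤ M.card + d := by
    have : (univ : Finset (Fin k)).card ≤ (M.disjSum (univ : Finset (Fin d))).card := by
      refine Finset.card_le_card_of_injOn (fun c => Sum.map id (fun p => p.2) (x c)) ?_ ?_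
      · intro c _
        have hc := hxc c
        rcases h : x c with e | p
        · rw [h] at hc
          have hc : e.1 = c := hc
          simp [h, hM, hc]
        · simp [h]
      · intro c _ c' _ hcc
        have hc := hxc c
        have hc' := hxc c'
        suffices x c = x c' by rw [← hc, ← hc', this]
        have t1 := hxT c
        have t2 := hxT c'
        by_contra hne
        have hcon := hT _ t1 _ t2 hne
        rcases h : x c with e | p <;> rcases h' : x c' with e' | p' <;>
          simp only [h, h', Sum.map_inl, Sum.map_inr, id, reduceCtorEq, Sum.inl.injEq,
            Sum.inr.injEq] at hcc hne hcon
        · exact hne hcc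
        · exact hcon hcc
    rw [Finset.card_disjSum] at this
    simpa using this
  obtain ⟨Q, hQM, hQ⟩ := Finset.exists_subset_card_eq
    (show min k ((n + 1) / 2) ≤ M.card by omega)
  exact ⟨Q, ⟨hQM.trans hmatch.1, fun e he e' he' => hmatch.2 e (hQM he) e' (hQM he')⟩, hQ⟩

end BMKNN

/-- For `1 ≤ k ≤ n`, every `(k, n, n)`-fractionally balanced tripartite
hypergraph has a matching of size `min k ⌈n/2⌉`. -/
theorem bm_k_n_n (k n : ℕ) (hk : 1 ≤ k) (hkn : k ≤ n)
    (H : Finset (Fin k × Fin n × Fin n)) (hH : TriFracBalanced H) :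
    ∃ M, TriMatching H M ∧ M.card = min k ((n + 1) / 2) :=
  BMKNN.main k n hk hkn H hH
end

section
/- Let n ≥ 1 be an integer. Then every (n, 2n−1, 2n−1)-fractionally balanced tripartite hypergraph contains a matching of size n. -/
namespace TriTop

open Finset

variable {V : Type*} [Fintype V] [DecidableEq V]

/-- mod 2 (augmented) simplicial boundary -/
def bd (z : Finset V → ZMod 2) (t : Finset V) : ZMod 2 :=
  ∑ v ∈ tᶜ, z (insert v t)

/-- cone operator -/
def cone (e : V) (u : Finset V → ZMod 2) (s : Finset V) : ZMod 2 :=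
  if e ∈ s then u (s.erase e) else 0

/-- a chain supported on `R`-cliques of size `m` inside `E` -/
def Supp (R : V → V → Prop) (E : Finset V) (m : ℕ) (z : Finset V → ZMod 2) : Prop :=
  ∀ s, z s ≠ 0 → s ⊆ E ∧ (∀ x ∈ s, ∀ y ∈ s, x ≠ y → R x y) ∧ s.card = m

lemma two_self (x : ZMod 2) : x + x = 0 := CharTwo.add_self_eq_zero x

lemma bd_add (y z : Finset V → ZMod 2) : bd (y + z) = bd y + bd z := by
  funext t; simp [bd, Finset.sum_add_distrib]

lemma bd_sum {ι : Type*} (K : Finset ι) (c : ι → Finset V → ZMod 2) :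
    bd (∑ i ∈ K, c i) = ∑ i ∈ K, bd (c i) := by
  funext t
  simp only [bd, Finset.sum_apply]
  rw [Finset.sum_comm]

lemma bd_cone (e : V) (u : Finset V → ZMod 2) : bd (cone e u) = u + cone e (bd u) := by
  funext t
  by_cases he : e ∈ t
  · have h1 : (t.erase e)ᶜ = insert e tᶜ := by
      ext x; simp only [mem_compl, mem_erase, mem_insert]; tauto
    have h2 : bd u (t.erase e) = u t + ∑ v ∈ tᶜ, u (insert v (t.erase e)) := by
      rw [bd, h1, sum_insert (by simpa using he), insert_erase he]
    have h3 : bd (cone e u) t = ∑ v ∈ tᶜ, u (insert v (t.erase e)) := by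
      apply sum_congr rfl
      intro v hv
      have hv' : v ∉ t := by simpa using hv
      have hne : v ≠ e := by rintro rfl; exact hv' he
      rw [cone, if_pos (mem_insert_of_mem he), erase_insert_of_ne hne]
    rw [h3, Pi.add_apply, cone, if_pos he, h2, ← add_assoc, two_self, zero_add]
  · have h3 : bd (cone e u) t = u t := by
      rw [bd, sum_eq_single e]
      · rw [cone, if_pos (mem_insert_self _ _), erase_insert he]
      · intro v _ hne
        rw [cone, if_neg]
        simp only [mem_insert, not_or]
        exact ⟨fun h => hne h.symm, he⟩
      · intro h; simp at h; exact absurd h he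
    rw [h3, Pi.add_apply, cone, if_neg he, add_zero]

lemma bd_bd (z : Finset V → ZMod 2) : bd (bd z) = 0 := by
  funext t
  simp only [bd, Pi.zero_apply]
  rw [Finset.sum_sigma']
  refine Finset.sum_involution (fun p _ => ⟨p.2, p.1⟩) ?_ ?_ ?_ ?_
  · rintro ⟨v, w⟩ h
    simp only
    rw [Finset.insert_comm, two_self]
  · rintro ⟨v, w⟩ h _ heq
    simp only [mem_sigma, mem_compl, mem_insert, not_or] at h
    simp only [Sigma.mk.injEq] at heq
    exact h.2.1 heq.1
  · rintro ⟨v, w⟩ h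
    simp only [mem_sigma, mem_compl, mem_insert, not_or] at h ⊢
    exact ⟨h.2.2, fun h' => h.2.1 h'.symm, h.1⟩
  · rintro ⟨v, w⟩ h
    rfl

theorem vanish (R : V → V → Prop) [DecidableRel R] (hsymm : ∀ x y, R x y → R y x)
    (hR : ∀ (e : V) (N : Finset V), (∀ x ∈ N, ∀ y ∈ N, x ≠ y → R x y) →
      (N.filter (fun x => ¬ R e x)).card ≤ 2) (hirr : ∀ x, ¬ R x x) :
    ∀ (k : ℕ) (E : Finset V), E.card = k → ∀ (m : ℕ) (N : Finset V), N ⊆ E →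
      (∀ x ∈ N, ∀ y ∈ N, x ≠ y → R x y) → 2 * m + 1 ≤ N.card →
      ∀ z, Supp R E m z → bd z = 0 → ∃ y, Supp R E (m + 1) y ∧ bd y = z := by
  intro k
  induction k using Nat.strong_induction_on with
  | _ k ih =>
  intro E hE m N hNE hN hcard z hz hbz
  by_cases hEN : E ⊆ N
  · obtain ⟨v, hv⟩ : N.Nonempty := by rw [← card_pos]; omega
    refine ⟨cone v z, ?_, ?_⟩
    · intro s hs
      rw [cone] at hs
      split_ifs at hs with hvs
      · obtain ⟨h1, h2, h3⟩ := hz _ hs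
        have hsE : s ⊆ E := by
          rw [← insert_erase hvs]
          exact insert_subset (hNE hv) h1
        refine ⟨hsE, fun x hx y hy => hN x (hEN (hsE hx)) y (hEN (hsE hy)), ?_⟩
        rw [← h3, card_erase_add_one hvs]
      · exact absurd rfl hs
    · rw [bd_cone, hbz]
      funext t
      simp [cone]
  · obtain ⟨e, heE, heN⟩ := Finset.not_subset.1 hEN
    set E' := E.filter (fun x => R e x) with hE'
    have hE'lt : E'.card < k := by
      rw [← hE]
      apply card_lt_card
      rw [Finset.ssubset_iff_of_subset (filter_subset _ _)]
      exact ⟨e, heE, by simp [hE', hirr]⟩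
    have heE' : e ∉ E' := by simp [hE', hirr]
    let w : Finset V → ZMod 2 := fun t => if e ∈ t then 0 else z (insert e t)
    have hu : ∃ u, Supp R E' m u ∧ bd u = w := by
      rcases Nat.eq_zero_or_pos m with rfl | hm
      · refine ⟨0, fun s hs => absurd rfl hs, ?_⟩
        funext t
        have : w t = 0 := by
          by_contra hne
          simp only [w] at hne
          split_ifs at hne with h
          · exact hne rfl
          · have := (hz _ hne).2.2
            simp at this
        rw [this]; simp [bd]
      · obtain ⟨m', rfl⟩ : ∃ m', m = m' + 1 := ⟨m - 1, by omega⟩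
        refine ih _ hE'lt E' rfl m' (N.filter (fun x => R e x)) ?_ ?_ ?_ w ?_ ?_
        · exact filter_subset_filter _ hNE
        · intro x hx y hy
          exact hN x (filter_subset _ _ hx) y (filter_subset _ _ hy)
        · have := hR e N hN
          have h2 := card_filter_add_card_filter_not (s := N) (fun x => R e x)
          omega
        · intro s hs
          simp only [w] at hs
          split_ifs at hs with h
          · exact absurd rfl hs
          · obtain ⟨h1, h2, h3⟩ := hz _ hs
            refine ⟨?_, fun x hx y hy => h2 x (mem_insert_of_mem hx) y (mem_insert_of_mem hy), ?_⟩
            · intro x hx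
              rw [hE', mem_filter]
              refine ⟨h1 (mem_insert_of_mem hx), h2 e (mem_insert_self _ _) x (mem_insert_of_mem hx) ?_⟩
              rintro rfl; exact h hx
            · rw [card_insert_of_notMem h] at h3; omega
        · funext t
          by_cases he : e ∈ t
          · simp only [bd, w, Pi.zero_apply]
            apply sum_eq_zero
            intro v _
            rw [if_pos (mem_insert_of_mem he)]
          · have h0 : bd z (insert e t) = 0 := by rw [hbz]; rfl
            have h1 : tᶜ = insert e (insert e t)ᶜ := by
              ext x; simp only [mem_compl, mem_insert]
              by_cases hx : x = e
              · subst hx; simp [he]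
              · simp [hx]
            rw [Pi.zero_apply, ← h0, bd, bd, h1, sum_insert (by simp)]
            simp only [w]
            rw [if_pos (mem_insert_self _ _), zero_add]
            apply sum_congr rfl
            intro v hv
            simp only [mem_compl, mem_insert, not_or] at hv
            rw [if_neg, Finset.insert_comm]
            simp only [mem_insert, not_or]
            exact ⟨fun h => hv.1 h.symm, he⟩
    obtain ⟨u, hu1, hu2⟩ := hu
    have hz' : Supp R (E.erase e) m (z + bd (cone e u)) := by
      intro s hs
      rw [bd_cone, hu2] at hs
      by_cases hes : e ∈ s
      · exfalso
        apply hs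
        have hus : u s = 0 := by
          by_contra h
          exact heE' ((hu1 s h).1 hes)
        simp [cone, hes, hus, w, insert_erase hes, two_self]
      · have hs' : z s ≠ 0 ∨ u s ≠ 0 := by
          by_contra hcon
          push Not at hcon
          apply hs
          simp [cone, hes, hcon.1, hcon.2]
        rcases hs' with h | h
        · obtain ⟨h1, h2, h3⟩ := hz _ h
          refine ⟨?_, h2, h3⟩
          intro x hx
          rw [mem_erase]
          exact ⟨by rintro rfl; exact hes hx, h1 hx⟩
        · obtain ⟨h1, h2, h3⟩ := hu1 _ h
          refine ⟨?_, h2, h3⟩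
          intro x hx
          rw [mem_erase]
          exact ⟨by rintro rfl; exact hes hx, filter_subset _ _ (h1 hx)⟩
    have hlt : (E.erase e).card < k := by
      rw [← hE]; exact card_erase_lt_of_mem heE
    obtain ⟨y, hy1, hy2⟩ := ih _ hlt (E.erase e) rfl m N
      (fun x hx => mem_erase.2 ⟨by rintro rfl; exact heN hx, hNE hx⟩) hN hcard _ hz'
      (by rw [bd_add, bd_bd, hbz, add_zero])
    refine ⟨y + cone e u, ?_, ?_⟩
    · intro s hs
      by_cases h : y s = 0
      · have hc : cone e u s ≠ 0 := by
          intro h'; apply hs; simp [h, h']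
        rw [cone] at hc
        split_ifs at hc with hes
        · obtain ⟨h1, h2, h3⟩ := hu1 _ hc
          refine ⟨?_, ?_, ?_⟩
          · rw [← insert_erase hes]
            exact insert_subset heE (h1.trans (filter_subset _ _))
          · intro x hx y hy hxy
            have key : ∀ y ∈ s, y ≠ e → R e y := fun y hy hye =>
              (mem_filter.1 (h1 (mem_erase.2 ⟨hye, hy⟩))).2
            by_cases hxe : x = e
            · subst hxe; exact key y hy (Ne.symm hxy)
            · by_cases hye : y = e
              · subst hye; exact hsymm _ _ (key x hx hxe)
              · exact h2 x (mem_erase.2 ⟨hxe, hx⟩) y (mem_erase.2 ⟨hye, hy⟩) hxy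
          · rw [← h3, card_erase_add_one hes]
        · exact absurd rfl hc
      · obtain ⟨h1, h2, h3⟩ := hy1 _ h
        exact ⟨h1.trans (erase_subset _ _), h2, h3⟩
    · rw [bd_add, hy2, add_assoc]
      funext t
      simp [two_self]

variable {A : Type*} [DecidableEq A]

/-- number mod 2 of rainbow simplices with colour set `K` -/
def rb (col : V → A) (K : Finset A) (z : Finset V → ZMod 2) : ZMod 2 :=
  ∑ s with (s.image col = K ∧ s.card = K.card), z s

lemma rb_sum {ι : Type*} (col : V → A) (K : Finset A) (I : Finset ι) (c : ι → Finset V → ZMod 2) :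
    rb col K (∑ i ∈ I, c i) = ∑ i ∈ I, rb col K (c i) := by
  simp only [rb, Finset.sum_apply]
  rw [Finset.sum_comm]

lemma rb_bd (col : V → A) (K : Finset A) (i : A) (hi : i ∈ K) (z : Finset V → ZMod 2)
    (hz : ∀ s, z s ≠ 0 → s.image col ⊆ K) :
    rb col (K.erase i) (bd z) = rb col K z := by
  simp only [rb, bd]
  rw [Finset.sum_sigma']
  rw [← Finset.sum_filter_add_sum_filter_not _ (fun p => col p.2 = i)]
  have hinj : ∀ t : Finset V, t.image col = K.erase i → t.card = (K.erase i).card →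
      Set.InjOn col t := by
    intro t h1 h2
    rw [← Finset.card_image_iff, h1, h2]
  have hKc : (K.erase i).card + 1 = K.card := card_erase_add_one hi
  have hA : (∑ p ∈ ((Finset.univ.filter (fun s : Finset V => s.image col = K.erase i ∧
      s.card = (K.erase i).card)).sigma (fun t => tᶜ)) with ¬ col p.2 = i,
      z (insert p.2 p.1)) = 0 := by
    have hex : ∀ p : (_ : Finset V) × V, p.1.image col = K.erase i → col p.2 ∈ K → col p.2 ≠ i →
        ∃ v ∈ p.1, col v = col p.2 := by
      intro p h1 h2 h3
      have : col p.2 ∈ p.1.image col := by rw [h1]; exact mem_erase.2 ⟨h3, h2⟩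
      simpa using this
    classical
    -- restrict to colour in K
    rw [← Finset.sum_filter_add_sum_filter_not _ (fun p => col p.2 ∈ K)]
    have h0 : ∀ (S : Finset ((_ : Finset V) × V)),
        ∑ p ∈ S with ¬ col p.2 ∈ K, z (insert p.2 p.1) = 0 := by
      intro S
      apply sum_eq_zero
      intro p hp
      by_contra hne
      apply (mem_filter.1 hp).2
      exact hz _ hne (mem_image_of_mem _ (mem_insert_self _ _))
    rw [h0, add_zero]
    have hex' : ∀ p : (_ : Finset V) × V, ∃ v, (p.1.image col = K.erase i → col p.2 ∈ K →
        col p.2 ≠ i → v ∈ p.1 ∧ col v = col p.2) := by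
      intro p
      by_cases h : p.1.image col = K.erase i ∧ col p.2 ∈ K ∧ col p.2 ≠ i
      · obtain ⟨v, hv⟩ := hex p h.1 h.2.1 h.2.2
        exact ⟨v, fun _ _ _ => hv⟩
      · exact ⟨p.2, fun a b c => absurd ⟨a, b, c⟩ h⟩
    choose g hg using hex'
    refine Finset.sum_involution (fun p _ => ⟨insert p.2 (p.1.erase (g p)), g p⟩) ?_ ?_ ?_ ?_
    all_goals
      rintro ⟨t, v⟩ hp
      simp only [mem_filter, mem_sigma, mem_univ, true_and, mem_compl] at hp
      obtain ⟨⟨⟨⟨h1, h2⟩, h3⟩, h4⟩, h5⟩ := hp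
      obtain ⟨hg1, hg2⟩ := hg ⟨t, v⟩ h1 h5 h4
      simp only at hg1 hg2
      have hne : g ⟨t, v⟩ ≠ v := by rintro h; rw [h] at hg1; exact h3 hg1
    · simp only
      rw [Finset.insert_comm, insert_erase hg1, two_self]
    · intro _ heq
      simp only [Sigma.mk.injEq] at heq
      exact hne (eq_of_heq heq.2)
    · have himg : (insert v (t.erase (g ⟨t, v⟩))).image col = K.erase i := by
        rw [image_insert, ← hg2, ← image_insert, insert_erase hg1, h1]
      simp only [mem_filter, mem_sigma, mem_univ, true_and, mem_compl]
      refine ⟨⟨⟨⟨himg, ?_⟩, ?_⟩, ?_⟩, ?_⟩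
      · rw [card_insert_of_notMem, card_erase_add_one hg1, h2]
        simp [h3]
      · simp [hne]
      · rw [hg2]; exact h4
      · rw [hg2]; exact h5
    · have himg : (insert v (t.erase (g ⟨t, v⟩))).image col = K.erase i := by
        rw [image_insert, ← hg2, ← image_insert, insert_erase hg1, h1]
      have hcd : (insert v (t.erase (g ⟨t, v⟩))).card = (K.erase i).card := by
        rw [card_insert_of_notMem, card_erase_add_one hg1, h2]
        simp [h3]
      obtain ⟨hk1, hk2⟩ := hg ⟨insert v (t.erase (g ⟨t, v⟩)), g ⟨t, v⟩⟩ himg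
        (by simp only [hg2]; exact h5) (by simp only [hg2]; exact h4)
      simp only at hk1 hk2
      have hgv : g ⟨insert v (t.erase (g ⟨t, v⟩)), g ⟨t, v⟩⟩ = v :=
        hinj _ himg hcd hk1 (by simp) (hk2.trans hg2)
      simp only [hgv]
      rw [erase_insert (by simp [h3]), insert_erase hg1]
  rw [hA, add_zero]
  refine Finset.sum_bij (fun p _ => insert p.2 p.1) ?_ ?_ ?_ ?_
  · rintro ⟨t, v⟩ hp
    simp only [mem_filter, mem_sigma, mem_univ, true_and, mem_compl] at hp ⊢
    obtain ⟨⟨⟨h1, h2⟩, h3⟩, h4⟩ := hp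
    rw [image_insert, h1, h4, insert_erase hi, card_insert_of_notMem h3, h2, hKc]
    exact ⟨rfl, rfl⟩
  · rintro ⟨t, v⟩ hp ⟨t', v'⟩ hp' heq
    simp only [mem_filter, mem_sigma, mem_univ, true_and, mem_compl] at hp hp' heq
    obtain ⟨⟨⟨h1, h2⟩, h3⟩, h4⟩ := hp
    obtain ⟨⟨⟨h1', h2'⟩, h3'⟩, h4'⟩ := hp'
    have hv : v ∈ insert v' t' := by rw [← heq]; exact mem_insert_self _ _
    have hvv : v = v' := by
      rcases mem_insert.1 hv with h | h
      · exact h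
      · have := mem_image_of_mem col h
        rw [h1', h4] at this
        simp at this
    subst hvv
    have : t = t' := by
      rw [← erase_insert h3, heq, erase_insert h3']
    rw [this]
  · intro s hs
    simp only [mem_filter, mem_univ, true_and] at hs
    obtain ⟨h1, h2⟩ := hs
    have hsinj : Set.InjOn col s := by
      rw [← Finset.card_image_iff, h1, h2]
    have : i ∈ s.image col := by rw [h1]; exact hi
    obtain ⟨v, hv, hvi⟩ := mem_image.1 this
    refine ⟨⟨s.erase v, v⟩, ?_, insert_erase hv⟩
    simp only [mem_filter, mem_sigma, mem_univ, true_and, mem_compl]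
    refine ⟨⟨⟨?_, ?_⟩, by simp⟩, hvi⟩
    · ext a
      rw [← h1]
      simp only [mem_image, mem_erase]
      constructor
      · rintro ⟨x, ⟨hx1, hx2⟩, rfl⟩
        refine ⟨fun h => hx1 (hsinj hx2 hv (h.trans hvi.symm)), x, hx2, rfl⟩
      · rintro ⟨ha, x, hx, rfl⟩
        exact ⟨x, ⟨by rintro rfl; exact ha hvi, hx⟩, rfl⟩
    · have := card_erase_add_one hv
      omega
  · intro p _
    rfl

theorem rainbow [Fintype A] (R : V → V → Prop) [DecidableRel R] (hsymm : ∀ x y, R x y → R y x)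
    (hR : ∀ (e : V) (N : Finset V), (∀ x ∈ N, ∀ y ∈ N, x ≠ y → R x y) →
      (N.filter (fun x => ¬ R e x)).card ≤ 2) (hirr : ∀ x, ¬ R x x)
    (col : V → A) (H : Finset V)
    (hH : ∀ K : Finset A, K.Nonempty → ∃ N ⊆ H.filter (fun e => col e ∈ K),
      (∀ x ∈ N, ∀ y ∈ N, x ≠ y → R x y) ∧ 2 * K.card - 1 ≤ N.card) :
    ∃ s ⊆ H, (∀ x ∈ s, ∀ y ∈ s, x ≠ y → R x y) ∧ s.image col = univ ∧
      s.card = (univ : Finset A).card := by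
  have hc : ∀ m : ℕ, ∃ c : Finset A → Finset V → ZMod 2,
      c ∅ = (fun s => if s = ∅ then 1 else 0) ∧
      ∀ K : Finset A, K.card ≤ m → Supp R (H.filter (fun e => col e ∈ K)) K.card (c K) ∧
        bd (c K) = ∑ i ∈ K, c (K.erase i) := by
    intro m
    induction m with
    | zero =>
      refine ⟨fun _ s => if s = ∅ then 1 else 0, rfl, ?_⟩
      intro K hK
      have : K = ∅ := by simpa using hK
      subst this
      constructor
      · intro s hs
        have : s = ∅ := by by_contra h; simp [h] at hs
        subst this
        simp
      · funext t
        simp [bd]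
    | succ m ih =>
      obtain ⟨c, hc0, hc⟩ := ih
      have hex : ∀ K : Finset A, ∃ y, K.card = m + 1 →
          Supp R (H.filter (fun e => col e ∈ K)) K.card y ∧ bd y = ∑ i ∈ K, c (K.erase i) := by
        intro K
        by_cases hK : K.card = m + 1
        · obtain ⟨N, hN1, hN2, hN3⟩ := hH K (by rw [← card_pos]; omega)
          have hce : ∀ i ∈ K, (K.erase i).card = m := by
            intro i hi
            have := card_erase_add_one hi
            omega
          obtain ⟨y, hy1, hy2⟩ := vanish R hsymm hR hirr _ (H.filter (fun e => col e ∈ K)) rfl m N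
            hN1 hN2 (by omega) (∑ i ∈ K, c (K.erase i)) (by
              intro s hs
              rw [Finset.sum_apply] at hs
              obtain ⟨i, hi, hne⟩ := exists_ne_zero_of_sum_ne_zero hs
              obtain ⟨h1, h2, h3⟩ := (hc (K.erase i) (hce i hi).le).1 s hne
              refine ⟨?_, h2, by rw [h3, hce i hi]⟩
              intro x hx
              have := h1 hx
              simp only [mem_filter, mem_erase] at this ⊢
              tauto) (by
              rw [bd_sum]
              rw [Finset.sum_congr rfl (fun i hi => (hc (K.erase i) (hce i hi).le).2)]
              rw [Finset.sum_sigma']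
              refine Finset.sum_involution (fun p _ => ⟨p.2, p.1⟩) ?_ ?_ ?_ ?_
              · rintro ⟨v, w⟩ h
                simp only
                rw [Finset.erase_right_comm]
                funext t
                simp [two_self]
              · rintro ⟨v, w⟩ h _ heq
                simp only [mem_sigma, mem_erase] at h
                simp only [Sigma.mk.injEq] at heq
                exact h.2.1 heq.1
              · rintro ⟨v, w⟩ h
                simp only [mem_sigma, mem_erase] at h ⊢
                exact ⟨h.2.2, fun h' => h.2.1 h'.symm, h.1⟩
              · rintro ⟨v, w⟩ h
                rfl)
          exact ⟨y, fun _ => ⟨by rw [hK]; exact hy1, hy2⟩⟩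
        · exact ⟨0, fun h => absurd h hK⟩
      choose y hy using hex
      refine ⟨fun K => if K.card = m + 1 then y K else c K, ?_, ?_⟩
      · simp [hc0]
      · intro K hK
        have hsum : ∑ i ∈ K, (if (K.erase i).card = m + 1 then y (K.erase i) else c (K.erase i))
            = ∑ i ∈ K, c (K.erase i) := by
          apply sum_congr rfl
          intro i hi
          have := card_erase_add_one hi
          rw [if_neg (by omega)]
        simp only [hsum]
        by_cases h : K.card = m + 1
        · rw [if_pos h]
          exact hy K h
        · rw [if_neg h]
          exact hc K (by omega)
  obtain ⟨c, hc0, hc⟩ := hc (univ : Finset A).card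
  have hr : ∀ (k : ℕ) (K : Finset A), K.card = k → rb col K (c K) = 1 := by
    intro k
    induction k with
    | zero =>
      intro K hK
      have : K = ∅ := by simpa using hK
      subst this
      rw [hc0, rb, Finset.sum_eq_single ∅]
      · simp
      · intro s _ hs; simp [hs]
      · intro h; simp at h
    | succ k ih =>
      intro K hK
      obtain ⟨i, hi⟩ : K.Nonempty := by rw [← card_pos]; omega
      have hKle : ∀ K : Finset A, K.card ≤ (univ : Finset A).card := fun K => card_le_univ K
      have hcol : ∀ K s, c K s ≠ 0 → s.image col ⊆ K := by
        intro K s hs a ha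
        obtain ⟨x, hx, rfl⟩ := mem_image.1 ha
        exact (mem_filter.1 (((hc K (hKle K)).1 s hs).1 hx)).2
      rw [← rb_bd col K i hi _ (hcol K), (hc K (hKle K)).2, rb_sum, Finset.sum_eq_single i]
      · apply ih
        have := card_erase_add_one hi
        omega
      · intro j hj hji
        rw [rb]
        apply sum_eq_zero
        intro s hs
        by_contra hne
        have h1 := hcol _ _ hne
        rw [(mem_filter.1 hs).2.1] at h1
        have := h1 (mem_erase.2 ⟨hji, hj⟩)
        simp at this
      · intro h; exact absurd hi h
  have hfin := hr _ univ rfl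
  have hne : rb col univ (c univ) ≠ 0 := by rw [hfin]; exact one_ne_zero
  obtain ⟨s, hs, hsne⟩ := exists_ne_zero_of_sum_ne_zero hne
  obtain ⟨h1, h2, h3⟩ := (hc univ le_rfl).1 s hsne
  exact ⟨s, h1.trans (filter_subset _ _), h2, (mem_filter.1 hs).2.1, h3⟩

/-- Koenig-type lemma. -/
theorem koenig {W B C : Type*} [Fintype B] [Fintype C] [DecidableEq W] [DecidableEq B]
    [DecidableEq C] (p : W → B) (q : W → C) (E : Finset W) (r : ℕ) (hr : r ≤ Fintype.card B)
    (hcov : ∀ (X : Finset B) (Y : Finset C), (∀ e ∈ E, p e ∈ X ∨ q e ∈ Y) → r ≤ X.card + Y.card) :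
    ∃ N ⊆ E, (∀ x ∈ N, ∀ y ∈ N, x ≠ y → p x ≠ p y ∧ q x ≠ q y) ∧ r ≤ N.card := by
  let D := Fin (Fintype.card B - r)
  let t : B → Finset (C ⊕ D) := fun b => ((E.filter (fun e => p e = b)).image q).disjSum univ
  have hall : ∀ S : Finset B, S.card ≤ (S.biUnion t).card := by
    intro S
    rcases S.eq_empty_or_nonempty with rfl | ⟨b0, hb0⟩
    · simp
    have h1 : ((E.filter (fun e => p e ∈ S)).image q).disjSum (univ : Finset D) ⊆ S.biUnion t := by
      intro x hx
      rw [mem_biUnion]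
      rcases x with c | d
      · simp only [inl_mem_disjSum, mem_image, mem_filter] at hx
        obtain ⟨e, ⟨he, hpe⟩, rfl⟩ := hx
        refine ⟨p e, hpe, ?_⟩
        simp only [t, inl_mem_disjSum, mem_image, mem_filter]
        exact ⟨e, ⟨he, rfl⟩, rfl⟩
      · exact ⟨b0, hb0, by simp [t]⟩
    have h2 := card_le_card h1
    rw [card_disjSum, card_univ, Fintype.card_fin] at h2
    have h3 := hcov Sᶜ ((E.filter (fun e => p e ∈ S)).image q) (by
      intro e he
      by_cases h : p e ∈ S
      · right; exact mem_image_of_mem _ (mem_filter.2 ⟨he, h⟩)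
      · left; simpa using h)
    rw [card_compl] at h3
    have h4 := card_le_univ S
    omega
  obtain ⟨f, hf, hft⟩ := (Finset.all_card_le_biUnion_card_iff_exists_injective t).1 hall
  let B1 : Finset B := univ.filter (fun b => (f b).isLeft)
  have hB1 : r ≤ B1.card := by
    have h := card_filter_add_card_filter_not (s := (univ : Finset B)) (fun b => ((f b).isLeft = true))
    have h2 : (univ.filter (fun b => ¬ ((f b).isLeft = true))).card ≤
        ((univ : Finset D).map ⟨(Sum.inr : D → C ⊕ D), Sum.inr_injective⟩).card := by
      apply card_le_card_of_injOn f
      · intro b hb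
        simp only [coe_filter, mem_univ, true_and, Set.mem_ofPred_eq] at hb
        rcases hfb : f b with c | d
        · rw [hfb] at hb; simp at hb
        · simp
      · exact hf.injOn
    rw [card_map, card_univ, Fintype.card_fin] at h2
    rw [card_univ] at h
    change r ≤ (univ.filter (fun b => ((f b).isLeft = true))).card
    omega
  have hex : ∀ b : B1, ∃ e ∈ E, p e = b ∧ f b = Sum.inl (q e) := by
    rintro ⟨b, hb⟩
    have hb' : (f b).isLeft = true := (mem_filter.1 hb).2
    have h := hft b
    rcases hfb : f b with c | d
    · rw [hfb] at h
      simp only [t, inl_mem_disjSum, mem_image, mem_filter] at h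
      obtain ⟨e, ⟨he, hpe⟩, rfl⟩ := h
      exact ⟨e, he, hpe, rfl⟩
    · rw [hfb] at hb'; simp at hb'
  choose g hg1 hg2 hg3 using hex
  have hginj : Function.Injective g := by
    intro b b' h
    apply Subtype.ext
    rw [← hg2 b, ← hg2 b', h]
  refine ⟨univ.image g, ?_, ?_, ?_⟩
  · intro x hx
    obtain ⟨b, _, rfl⟩ := mem_image.1 hx
    exact hg1 b
  · intro x hx y hy hxy
    obtain ⟨b, _, rfl⟩ := mem_image.1 hx
    obtain ⟨b', _, rfl⟩ := mem_image.1 hy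
    have hbb : b ≠ b' := by rintro rfl; exact hxy rfl
    refine ⟨?_, ?_⟩
    · rw [hg2, hg2]; exact fun h => hbb (Subtype.ext h)
    · intro h
      apply hbb
      apply Subtype.ext
      apply hf
      rw [hg3, hg3, h]
  · rw [card_image_of_injective _ hginj, card_univ, Fintype.card_coe]
    exact hB1

end TriTop

/-- For `n ≥ 1`, every `(n, 2n-1, 2n-1)`-fractionally balanced tripartite
hypergraph has a matching of size `n`. -/
theorem bm_n_2n1_2n1 (n : ℕ) (hn : 1 ≤ n)
    (H : Finset (Fin n × Fin (2 * n - 1) × Fin (2 * n - 1)))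
    (hH : TriFracBalanced H) :
    ∃ M, TriMatching H M ∧ M.card = n := by
  classical
  obtain ⟨f, ⟨hf0, hfH, hA, hB, hC⟩, hfne⟩ := hH
  -- total weight
  set T : ℝ := ∑ e, f e with hT
  have hTpos : 0 < T := by
    obtain ⟨e, he⟩ := Function.ne_iff.1 hfne
    exact Finset.sum_pos' (fun e _ => hf0 e)
      ⟨e, Finset.mem_univ _, lt_of_le_of_ne (hf0 e) (Ne.symm he)⟩
  -- generic degree-sum facts
  have deg : ∀ (k : ℕ) (π : Fin n × Fin (2 * n - 1) × Fin (2 * n - 1) → Fin k),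
      (∀ v w, (∑ e, if π e = v then f e else 0) = ∑ e, if π e = w then f e else 0) →
      ∀ S : Finset (Fin k), (k : ℝ) * (∑ e, if π e ∈ S then f e else 0) = S.card * T := by
    intro k π h S
    have h1 : ∀ S : Finset (Fin k), (∑ e, if π e ∈ S then f e else 0) =
        ∑ v ∈ S, ∑ e, if π e = v then f e else 0 := by
      intro S
      rw [Finset.sum_comm]
      apply Finset.sum_congr rfl
      intro e _
      rw [Finset.sum_ite_eq]
    rcases S.eq_empty_or_nonempty with rfl | ⟨v0, _⟩
    · simp
    have h2 : ∀ S : Finset (Fin k), (∑ e, if π e ∈ S then f e else 0) =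
        S.card * ∑ e, if π e = v0 then f e else 0 := by
      intro S
      rw [h1, Finset.sum_congr rfl (fun v _ => h v v0), Finset.sum_const, nsmul_eq_mul]
    have h3 := h2 Finset.univ
    simp only [Finset.mem_univ, if_true, Finset.card_univ, Fintype.card_fin] at h3
    rw [h2 S, hT, h3]
    ring
  obtain ⟨s, hsH, hs1, hs2, hs3⟩ := TriTop.rainbow
    (fun x y : Fin n × Fin (2 * n - 1) × Fin (2 * n - 1) => x.2.1 ≠ y.2.1 ∧ x.2.2 ≠ y.2.2)
    (fun x y h => ⟨h.1.symm, h.2.symm⟩)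
    (by
      intro e N hN
      have hsub : N.filter (fun x => ¬ (e.2.1 ≠ x.2.1 ∧ e.2.2 ≠ x.2.2)) ⊆
          N.filter (fun x => e.2.1 = x.2.1) ∪ N.filter (fun x => e.2.2 = x.2.2) := by
        intro x hx
        simp only [Finset.mem_filter, Finset.mem_union] at hx ⊢
        tauto
      have h1 : (N.filter (fun x => e.2.1 = x.2.1)).card ≤ 1 := by
        rw [Finset.card_le_one]
        intro a ha b hb
        by_contra hab
        rw [Finset.mem_filter] at ha hb
        exact (hN a ha.1 b hb.1 hab).1 (ha.2.symm.trans hb.2)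
      have h2 : (N.filter (fun x => e.2.2 = x.2.2)).card ≤ 1 := by
        rw [Finset.card_le_one]
        intro a ha b hb
        by_contra hab
        rw [Finset.mem_filter] at ha hb
        exact (hN a ha.1 b hb.1 hab).2 (ha.2.symm.trans hb.2)
      have h3 := Finset.card_le_card hsub
      have h4 := Finset.card_union_le (N.filter (fun x => e.2.1 = x.2.1))
        (N.filter (fun x => e.2.2 = x.2.2))
      omega)
    (fun x h => h.1 rfl) (fun e => e.1) H
    (by
      intro K hK
      have hKpos : 1 ≤ K.card := hK.card_pos
      have hKn : K.card ≤ n := by simpa using Finset.card_le_univ K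
      refine TriTop.koenig (fun e : Fin n × Fin (2 * n - 1) × Fin (2 * n - 1) => e.2.1)
        (fun e : Fin n × Fin (2 * n - 1) × Fin (2 * n - 1) => e.2.2) _ _
        (by rw [Fintype.card_fin]; omega) ?_
      intro X Y hXY
      by_contra hlt
      have hle : X.card + Y.card + 2 ≤ 2 * K.card := by omega
      have hineq : (∑ e, if e.1 ∈ K then f e else 0) ≤
          (∑ e, if e.2.1 ∈ X then f e else 0) + ∑ e, if e.2.2 ∈ Y then f e else 0 := by
        rw [← Finset.sum_add_distrib]
        apply Finset.sum_le_sum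
        intro e _
        by_cases heH : e ∈ H
        · have := hf0 e
          by_cases heK : e.1 ∈ K
          · rcases hXY e (Finset.mem_filter.2 ⟨heH, heK⟩) with h | h
            · simp only [heK, if_true, h]
              split_ifs <;> linarith
            · simp only [heK, if_true, h]
              split_ifs <;> linarith
          · simp only [heK, if_false]
            split_ifs <;> linarith
        · simp [hfH e heH]
      have eA := deg n (fun e => e.1) hA K
      have eB := deg (2 * n - 1) (fun e => e.2.1) hB X
      have eC := deg (2 * n - 1) (fun e => e.2.2) hC Y
      have hcast : ((2 * n - 1 : ℕ) : ℝ) = 2 * n - 1 := by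
        rw [Nat.cast_sub (by omega)]; push_cast; ring
      rw [hcast] at eB eC
      have hn1 : (1 : ℝ) ≤ n := by exact_mod_cast hn
      have hKn' : (K.card : ℝ) ≤ n := by exact_mod_cast hKn
      have hle' : (X.card : ℝ) + Y.card + 2 ≤ 2 * K.card := by exact_mod_cast hle
      have m1 := mul_le_mul_of_nonneg_left hineq
        (show (0 : ℝ) ≤ n * (2 * n - 1) by nlinarith)
      have m2 : ((2 * n - 1) * K.card : ℝ) * T ≤ (n * (X.card + Y.card)) * T := by
        calc ((2 * n - 1) * K.card : ℝ) * T
            = (2 * n - 1) * (n * (∑ e, if e.1 ∈ K then f e else 0)) := by rw [eA]; ring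
          _ ≤ n * ((2 * n - 1) * (∑ e, if e.2.1 ∈ X then f e else 0)) +
              n * ((2 * n - 1) * (∑ e, if e.2.2 ∈ Y then f e else 0)) := by linarith
          _ = (n * (X.card + Y.card)) * T := by rw [eB, eC]; ring
      have m3 := le_of_mul_le_mul_right m2 hTpos
      nlinarith)
  rw [Finset.card_univ, Fintype.card_fin] at hs3
  refine ⟨s, ⟨hsH, ?_⟩, hs3⟩
  intro e he e' he' hne
  have hinj : Set.InjOn (fun e : Fin n × Fin (2 * n - 1) × Fin (2 * n - 1) => e.1) s := by
    rw [← Finset.card_image_iff, hs2, hs3, Finset.card_univ, Fintype.card_fin]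
  exact ⟨fun h => hne (hinj he he' h), hs1 e he e' he' hne⟩
end

section
/- For every integer n ≥ 2 there exists an (n, n, n(n−1)/2)-fractionally balanced tripartite hypergraph whose matching number is at most n−1. -/
/-- Labels: a bijective labelling of unordered pairs of distinct elements. -/
theorem exists_pair_label (n : ℕ) :
    ∃ lab : Fin n → Fin n → Fin (n * (n - 1) / 2) → Prop,
      (∀ i j l, lab i j l → lab j i l) ∧
      (∀ i j, i ≠ j → ∃! l, lab i j l) ∧
      (∀ l, ∃ i j, i ≠ j ∧ ∀ a b, lab a b l ↔ (a = i ∧ b = j) ∨ (a = j ∧ b = i)) := by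
  classical
  have hc : Fintype.card {a : Sym2 (Fin n) // ¬ a.IsDiag} = n * (n - 1) / 2 := by
    rw [Sym2.card_subtype_not_diag, Fintype.card_fin, Nat.choose_two_right]
  let φ := Fintype.equivFinOfCardEq hc
  refine ⟨fun i j l => (φ.symm l).1 = s(i, j), ?_, ?_, ?_⟩
  · intro i j l h
    rw [h, Sym2.eq_swap]
  · intro i j hij
    refine ⟨φ ⟨s(i, j), by simpa using hij⟩, by simp, ?_⟩
    intro l hl
    rw [← Equiv.symm_apply_eq]
    exact Subtype.ext hl
  · intro l
    obtain ⟨⟨i, j⟩, h⟩ := Quot.exists_rep (φ.symm l).1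
    have h' : (φ.symm l).1 = s(i, j) := h.symm
    have hd := (φ.symm l).2
    rw [h'] at hd
    refine ⟨i, j, by simpa using hd, ?_⟩
    intro a b
    show (φ.symm l).1 = s(a, b) ↔ _
    rw [h', Sym2.eq_iff]
    constructor
    · rintro (⟨h1, h2⟩ | ⟨h1, h2⟩)
      · exact Or.inl ⟨h1.symm, h2.symm⟩
      · exact Or.inr ⟨h2.symm, h1.symm⟩
    · rintro (⟨h1, h2⟩ | ⟨h1, h2⟩)
      · exact Or.inl ⟨h1.symm, h2.symm⟩
      · exact Or.inr ⟨h2.symm, h1.symm⟩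

/-- Same, with a total labelling function. -/
theorem exists_pair_label_fun (n : ℕ) (hn : 2 ≤ n) :
    ∃ lab : Fin n → Fin n → Fin (n * (n - 1) / 2),
      (∀ i j, i ≠ j → lab i j = lab j i) ∧
      (∀ l, ∃ i j, i ≠ j ∧
        ∀ a b, a ≠ b → (lab a b = l ↔ (a = i ∧ b = j) ∨ (a = j ∧ b = i))) := by
  classical
  obtain ⟨lab, hs, hu, hl⟩ := exists_pair_label n
  have h01 : (⟨0, by omega⟩ : Fin n) ≠ ⟨1, by omega⟩ := by simp
  obtain ⟨l0, -, -⟩ := hu _ _ h01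
  have key : ∀ i j, ∃ l, i ≠ j → ∀ m, lab i j m ↔ l = m := by
    intro i j
    by_cases h : i = j
    · exact ⟨l0, fun h' => absurd h h'⟩
    · obtain ⟨l, h1, h2⟩ := hu i j h
      exact ⟨l, fun _ m => ⟨fun hm => (h2 m hm).symm, fun hm => hm ▸ h1⟩⟩
  choose F hF using key
  refine ⟨F, ?_, ?_⟩
  · intro i j hij
    have h1 := (hF i j hij _).2 rfl
    exact ((hF j i hij.symm _).1 (hs _ _ _ h1)).symm
  · intro l
    obtain ⟨i, j, hij, h⟩ := hl l
    exact ⟨i, j, hij, fun a b hab => by rw [← hF a b hab l, h]⟩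

/-- The row of an arc. -/
def arcRow {n : ℕ} (z : Fin n) (p : Fin n × Fin n) : Fin n :=
  if p.2 = z then z else if p.1 = z then p.2 else p.1

/-- The arcs of the complete digraph. -/
def arcSet (n : ℕ) : Finset (Fin n × Fin n) := Finset.univ.filter fun p => p.1 ≠ p.2

theorem arc_row_count {n : ℕ} (z v : Fin n) :
    ((arcSet n).filter fun p => arcRow z p = v).card = n - 1 := by
  classical
  have h : ((arcSet n).filter fun p => arcRow z p = v) =
      (Finset.univ.erase v).image
        (fun x => if v = z then (x, z) else if x = z then (z, v) else (v, x)) := by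
    ext ⟨a, b⟩
    simp only [arcSet, Finset.mem_filter, Finset.mem_univ, true_and, Finset.mem_image,
      Finset.mem_erase, and_true]
    unfold arcRow
    constructor
    · rintro ⟨h1, h2⟩
      by_cases hv : v = z
      · refine ⟨a, ?_, ?_⟩ <;> grind
      · by_cases ha : a = z
        · refine ⟨z, ?_, ?_⟩ <;> grind
        · refine ⟨b, ?_, ?_⟩ <;> grind
    · rintro ⟨x, h1, h2⟩
      grind
  rw [h, Finset.card_image_of_injOn, Finset.card_erase_of_mem (Finset.mem_univ _),
    Finset.card_univ, Fintype.card_fin]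
  intro x hx y hy hxy
  simp at hx hy
  grind

theorem arc_col_count {n : ℕ} (v : Fin n) :
    ((arcSet n).filter fun p => p.1 = v).card = n - 1 := by
  classical
  have h : ((arcSet n).filter fun p => p.1 = v) =
      (Finset.univ.erase v).image (fun x => (v, x)) := by
    ext ⟨a, b⟩
    simp only [arcSet, Finset.mem_filter, Finset.mem_univ, true_and, Finset.mem_image,
      Finset.mem_erase, and_true, Prod.mk.injEq]
    constructor
    · rintro ⟨h1, h2⟩
      exact ⟨b, by grind, h2.symm, rfl⟩
    · rintro ⟨x, h1, h2, h3⟩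
      grind
  rw [h, Finset.card_image_of_injOn, Finset.card_erase_of_mem (Finset.mem_univ _),
    Finset.card_univ, Fintype.card_fin]
  intro x hx y hy hxy
  grind

theorem sum_multiplicity {α β : Type*} [Fintype β] [DecidableEq β] (A : Finset α) (ρ : α → β)
    (P : β → Prop) [DecidablePred P] :
    (∑ e : β, if P e then (∑ a ∈ A, if ρ a = e then (1 : ℝ) else 0) else 0) =
      ((A.filter fun a => P (ρ a)).card : ℝ) := by
  have : ∀ e : β, (if P e then (∑ a ∈ A, if ρ a = e then (1 : ℝ) else 0) else 0) =
      ∑ a ∈ A, if ρ a = e then (if P (ρ a) then (1 : ℝ) else 0) else 0 := by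
    intro e
    by_cases h : P e
    · rw [if_pos h]
      refine Finset.sum_congr rfl fun a _ => ?_
      by_cases h' : ρ a = e
      · simp [h', h]
      · simp [h']
    · rw [if_neg h]
      symm
      refine Finset.sum_eq_zero fun a _ => ?_
      by_cases h' : ρ a = e
      · simp [h', h]
      · simp [h']
  simp_rw [this]
  rw [Finset.sum_comm]
  simp


/-- For `n ≥ 2` there is an `(n, n, n(n-1)/2)`-fractionally balanced tripartite
hypergraph with matching number at most `n - 1`. -/
theorem bm_upper_n_n_choose2 (n : ℕ) (hn : 2 ≤ n) :
    ∃ H : Finset (Fin n × Fin n × Fin (n * (n - 1) / 2)), TriFracBalanced H ∧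
      ∀ M, TriMatching H M → M.card ≤ n - 1 := by
  classical
  obtain ⟨lab, hs, hl⟩ := exists_pair_label_fun n hn
  let z : Fin n := ⟨0, by omega⟩
  let ρ : Fin n × Fin n → Fin n × Fin n × Fin (n * (n - 1) / 2) :=
    fun p => (arcRow z p, p.1, lab p.1 p.2)
  have hlab : ∀ l, ((arcSet n).filter fun p => lab p.1 p.2 = l).card = 2 := by
    intro l
    obtain ⟨i, j, hij, h⟩ := hl l
    have : ((arcSet n).filter fun p => lab p.1 p.2 = l) = {(i, j), (j, i)} := by
      ext ⟨a, b⟩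
      simp only [arcSet, Finset.mem_filter, Finset.mem_univ, true_and, Finset.mem_insert,
        Finset.mem_singleton, Prod.mk.injEq]
      grind
    rw [this, Finset.card_pair]
    grind
  refine ⟨(arcSet n).image ρ, ⟨fun e => ∑ a ∈ arcSet n, if ρ a = e then (1 : ℝ) else 0,
    ⟨?_, ?_, ?_, ?_, ?_⟩, ?_⟩, ?_⟩
  · intro e
    exact Finset.sum_nonneg fun a _ => by split_ifs <;> norm_num
  · intro e he
    refine Finset.sum_eq_zero fun a ha => if_neg fun h => he ?_
    exact Finset.mem_image.2 ⟨a, ha, h⟩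
  · intro v w
    rw [sum_multiplicity (arcSet n) ρ (fun e => e.1 = v),
      sum_multiplicity (arcSet n) ρ (fun e => e.1 = w), arc_row_count, arc_row_count]
  · intro v w
    rw [sum_multiplicity (arcSet n) ρ (fun e => e.2.1 = v),
      sum_multiplicity (arcSet n) ρ (fun e => e.2.1 = w), arc_col_count, arc_col_count]
  · intro v w
    rw [sum_multiplicity (arcSet n) ρ (fun e => e.2.2 = v),
      sum_multiplicity (arcSet n) ρ (fun e => e.2.2 = w), hlab, hlab]
  · intro h0
    have h1 := sum_multiplicity (arcSet n) ρ (fun e => e.1 = z)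
    rw [arc_row_count] at h1
    have h2 : ∀ e, (∑ a ∈ arcSet n, if ρ a = e then (1 : ℝ) else 0) = 0 :=
      fun e => congrFun h0 e
    simp only [h2, ite_self, Finset.sum_const_zero] at h1
    have h3 : n - 1 = 0 := by exact_mod_cast h1.symm
    omega
  · rintro M ⟨hM, hd⟩
    by_contra hcard
    have hinj : Set.InjOn (fun e : Fin n × Fin n × Fin (n * (n - 1) / 2) => e.1) M := by
      intro e he f hf hef
      by_contra hne
      exact (hd e he f hf hne).1 hef
    have himg : M.image (fun e => e.1) = Finset.univ := by
      apply Finset.eq_univ_of_card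
      have h1 : (M.image (fun e => e.1)).card = M.card := Finset.card_image_of_injOn hinj
      have h2 := Finset.card_le_univ (M.image (fun e => e.1))
      rw [Fintype.card_fin] at h2 ⊢
      omega
    have hrow : ∀ v : Fin n, ∃ a b, a ≠ b ∧ arcRow z (a, b) = v ∧ ρ (a, b) ∈ M := by
      intro v
      have hv : v ∈ M.image (fun e => e.1) := himg ▸ Finset.mem_univ v
      obtain ⟨e, he, hev⟩ := Finset.mem_image.1 hv
      obtain ⟨⟨a, b⟩, hp, hpe⟩ := Finset.mem_image.1 (hM he)
      refine ⟨a, b, by simpa [arcSet] using hp, ?_, hpe ▸ he⟩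
      rw [← hev, ← hpe]
    obtain ⟨j, b, hjb, hr0, hm0⟩ := hrow z
    have hb : b = z := by
      unfold arcRow at hr0
      grind
    subst b
    obtain ⟨a, b, hab, hr1, hm1⟩ := hrow j
    have hne : ρ (j, z) ≠ ρ (a, b) := by
      intro h
      have h' := congrArg (fun e => e.1) h
      have h'' : arcRow z (j, z) = arcRow z (a, b) := h'
      rw [hr0, hr1] at h''
      exact hjb h''.symm
    obtain ⟨-, h2, h3⟩ := hd _ hm0 _ hm1 hne
    have h2' : j ≠ a := h2
    have h3' : lab j z ≠ lab a b := h3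
    have : a = z ∧ b = j := by
      unfold arcRow at hr1
      grind
    obtain ⟨rfl, rfl⟩ := this
    exact h3' (hs _ _ hjb)
end

section
/- Let n, m, d and a_1,…,a_d be positive integers, and suppose that every (n, a_1,…,a_d)-fractionally balanced (d+1)-partite hypergraph contains a matching of size m. Then every cake-division instance with n agents and d cakes, in which cake t is cut into a_t slices, has a placatable set of m agents. -/
/-- The space of partitions of `d` cakes, cake `t` being cut into `a t` slices:
each coordinate lies in the standard simplex. -/
def PartitionSpace (d : ℕ) (a : Fin d → ℕ) : Set (∀ t, Fin (a t) → ℝ) :=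
  {P | ∀ t, P t ∈ stdSimplex ℝ (Fin (a t))}

/-- A cake-division instance with `n` agents and `d` cakes, cake `t` cut into
`a t` slices: for each agent `i` and index vector `j`, a set `A i j ⊆ 𝒫` of
partitions in which agent `i` accepts the `d`-tuple of slices indexed by `j`.
The sets are closed and the hungry-agents condition holds. -/
structure CakeInstance (n d : ℕ) (a : Fin d → ℕ) where
  A : Fin n → (∀ t, Fin (a t)) → Set (∀ t, Fin (a t) → ℝ)
  subset_partitionSpace : ∀ i j, A i j ⊆ PartitionSpace d a
  isClosed : ∀ i j, IsClosed (A i j)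
  hungry : ∀ i, ∀ P ∈ PartitionSpace d a, ∃ j : ∀ t, Fin (a t),
    P ∈ A i j ∧ ∀ t, 0 < P t (j t)

/-- A set `Q` of agents is placatable: there exist a partition `P` and index
vectors, one acceptable at `P` for each agent of `Q`, such that the index
vectors of distinct agents of `Q` differ in every coordinate. -/
def Placatable {n d : ℕ} {a : Fin d → ℕ} (C : CakeInstance n d a)
    (Q : Finset (Fin n)) : Prop :=
  ∃ P ∈ PartitionSpace d a, ∃ φ : Fin n → ∀ t, Fin (a t),
    (∀ q ∈ Q, P ∈ C.A q (φ q)) ∧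
    ∀ q ∈ Q, ∀ q' ∈ Q, q ≠ q' → ∀ t, φ q t ≠ φ q' t

/-- The degree of vertex `v` (on side `t`) for a weight function `f` on a
multipartite hypergraph with sides `Fin (b t)`. -/
def degree {k : ℕ} {b : Fin k → ℕ} (f : (∀ t, Fin (b t)) → ℝ)
    (t : Fin k) (v : Fin (b t)) : ℝ :=
  ∑ e : ∀ t, Fin (b t), if e t = v then f e else 0

/-- `f` is a balanced weight function on the hypergraph `H`. -/
def IsBalanced {k : ℕ} {b : Fin k → ℕ} (H : Finset (∀ t, Fin (b t)))
    (f : (∀ t, Fin (b t)) → ℝ) : Prop :=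
  (∀ e, 0 ≤ f e) ∧ (∀ e, e ∉ H → f e = 0) ∧
    ∀ t : Fin k, ∀ v w : Fin (b t), degree f t v = degree f t w

/-- `H` is fractionally balanced. -/
def FracBalanced {k : ℕ} {b : Fin k → ℕ} (H : Finset (∀ t, Fin (b t))) : Prop :=
  ∃ f, IsBalanced H f ∧ f ≠ 0

/-- `M` is a matching in `H`. -/
def IsMatching {k : ℕ} {b : Fin k → ℕ} (H M : Finset (∀ t, Fin (b t))) : Prop :=
  M ⊆ H ∧ ∀ e ∈ M, ∀ f ∈ M, e ≠ f → ∀ t, e t ≠ f t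

set_option linter.unusedSectionVars false

section Scarf
variable {I T : Type} [Fintype I] [DecidableEq I] [Fintype T] [DecidableEq T]

def ScDom (r : I → T → ℕ) (σ : Finset T) : Prop := ∀ x, ∃ i, ∀ y ∈ σ, r i x ≤ r i y

/-- the points lying strictly above the minima `m` in all orders except `k` -/
def ScAbove (r : I → T → ℕ) (m : I → T) (k : I) (x : T) : Prop := ∀ l, l ≠ k → r l (m l) < r l x

def ScTop (r : I → T → ℕ) (m : I → T) (k : I) (x : T) : Prop :=
  ScAbove r m k x ∧ ∀ z, ScAbove r m k z → r k z ≤ r k x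

lemma sc_min (r : I → T → ℕ) (τ : Finset T) (hne : τ.Nonempty) :
    ∃ m : I → T, ∀ i, m i ∈ τ ∧ ∀ y ∈ τ, r i (m i) ≤ r i y := by
  have : ∀ i, ∃ y ∈ τ, ∀ z ∈ τ, r i y ≤ r i z := fun i => Finset.exists_min_image τ (r i) hne
  choose m h1 h2 using this
  exact ⟨m, fun i => ⟨h1 i, h2 i⟩⟩

lemma sc_door (r : I → T → ℕ) (hr : ∀ i, Function.Injective (r i)) (τ : Finset T)
    (hne : τ.Nonempty) (hD : ScDom r τ) (hc : τ.card + 1 = Fintype.card I)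
    (m : I → T) (hm : ∀ i, m i ∈ τ ∧ ∀ y ∈ τ, r i (m i) ≤ r i y) :
    ∃ i j : I, i ≠ j ∧ m i = m j ∧
      (∀ x, (x ∉ τ ∧ ScDom r (insert x τ)) ↔ (ScTop r m i x ∨ ScTop r m j x)) ∧
      (∀ x, ¬ (ScTop r m i x ∧ ScTop r m j x)) := by
  have hsurj : ∀ y ∈ τ, ∃ i, m i = y := by
    intro y hy
    obtain ⟨i, hi⟩ := hD y
    exact ⟨i, hr i (le_antisymm ((hm i).2 y hy) (hi _ (hm i).1))⟩
  obtain ⟨i, -, j, -, hij, hmij⟩ := Finset.exists_ne_map_eq_of_card_lt_of_maps_to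
    (s := (Finset.univ : Finset I)) (t := τ) (f := m) (by rw [Finset.card_univ]; omega)
    (fun a _ => (hm a).1)
  have key : ∀ i j : I, i ≠ j → m i = m j →
      (∀ y ∈ τ, ∃ l, l ≠ i ∧ m l = y) ∧ (∀ l l', l ≠ i → l' ≠ i → m l = m l' → l = l') := by
    intro i j hij hmij
    have h1 : ∀ y ∈ τ, ∃ l, l ≠ i ∧ m l = y := by
      intro y hy
      obtain ⟨l, hl⟩ := hsurj y hy
      by_cases h : l = i
      · exact ⟨j, hij.symm, by rw [← hmij, ← h, hl]⟩
      · exact ⟨l, h, hl⟩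
    refine ⟨h1, ?_⟩
    have himg : (Finset.univ.erase i).image m = τ := by
      ext y
      simp only [Finset.mem_image, Finset.mem_erase, Finset.mem_univ, and_true]
      constructor
      · rintro ⟨l, _, rfl⟩; exact (hm l).1
      · exact h1 y
    have hinj : Set.InjOn m (Finset.univ.erase i : Finset I) := by
      rw [← Finset.card_image_iff, himg, Finset.card_erase_of_mem (Finset.mem_univ _),
        Finset.card_univ]
      omega
    intro l l' hl hl' h
    exact hinj (by simpa using hl) (by simpa using hl') h
  obtain ⟨kis, kii⟩ := key i j hij hmij
  obtain ⟨kjs, kji⟩ := key j i hij.symm hmij.symm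
  -- uniqueness of the order in which a new vertex is minimal
  have huniq : ∀ x, x ∉ τ → ScDom r (insert x τ) → ∀ l l', r l x < r l (m l) →
      r l' x < r l' (m l') → l = l' := by
    intro x hx hDx l l' hl hl'
    by_contra hne'
    have hsub : τ ⊆ ((Finset.univ.erase l).erase l').image m := by
      intro y hy
      obtain ⟨k, hk⟩ := hDx y
      have hky : m k = y := hr k (le_antisymm ((hm k).2 y hy)
        (hk _ (Finset.mem_insert_of_mem (hm k).1)))
      have hkx := hk x (Finset.mem_insert_self _ _)
      rw [← hky] at hkx
      refine Finset.mem_image.2 ⟨k, ?_, hky⟩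
      simp only [Finset.mem_erase, Finset.mem_univ, and_true]
      constructor
      · rintro rfl; omega
      · rintro rfl; omega
    have h1 := Finset.card_le_card hsub
    have h2 := Finset.card_image_le (s := ((Finset.univ.erase l).erase l')) (f := m)
    rw [Finset.card_erase_of_mem (by simp [Ne.symm hne']),
      Finset.card_erase_of_mem (Finset.mem_univ _), Finset.card_univ] at h2
    have := hne.card_pos
    omega
  have hfwd : ∀ x, x ∉ τ → ScDom r (insert x τ) → ∀ k, r k x < r k (m k) → ScTop r m k x := by
    intro x hx hDx k hk
    constructor
    · intro l hl
      by_contra h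
      push Not at h
      have hne' : r l x ≠ r l (m l) := fun h' => hx ((hr l h') ▸ (hm l).1)
      exact hl (huniq x hx hDx l k (lt_of_le_of_ne h hne') hk)
    · intro z hz
      obtain ⟨l, hl⟩ := hDx z
      have : l = k := by
        by_contra hlk
        have h1 := hz l hlk
        have h2 := hl _ (Finset.mem_insert_of_mem (hm l).1)
        omega
      subst this
      exact hl x (Finset.mem_insert_self _ _)
  have hbwd : ∀ k, (∀ y ∈ τ, ∃ l, l ≠ k ∧ m l = y) → ∀ x, ScTop r m k x →
      x ∉ τ ∧ ScDom r (insert x τ) ∧ r k x < r k (m k) := by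
    intro k hks x hx
    have hxτ : x ∉ τ := by
      intro h
      obtain ⟨l, hl, rfl⟩ := hks x h
      exact lt_irrefl _ (hx.1 l hl)
    have hle : r k x ≤ r k (m k) := by
      obtain ⟨l, hl⟩ := hD x
      have : l = k := by
        by_contra hlk
        have h1 := hx.1 l hlk
        have h2 := hl _ (hm l).1
        omega
      subst this
      exact hl _ (hm l).1
    have hlt : r k x < r k (m k) :=
      lt_of_le_of_ne hle (fun h' => hxτ ((hr k h') ▸ (hm k).1))
    refine ⟨hxτ, ?_, hlt⟩
    intro z
    by_cases hz : ScAbove r m k z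
    · refine ⟨k, fun y hy => ?_⟩
      have h1 := hx.2 z hz
      rcases Finset.mem_insert.1 hy with rfl | hy
      · exact h1
      · have := (hm k).2 y hy
        omega
    · unfold ScAbove at hz
      push Not at hz
      obtain ⟨l, hlk, hl⟩ := hz
      refine ⟨l, fun y hy => ?_⟩
      rcases Finset.mem_insert.1 hy with rfl | hy
      · exact hl.trans (hx.1 l hlk).le
      · exact hl.trans ((hm l).2 y hy)
  refine ⟨i, j, hij, hmij, ?_, ?_⟩
  · intro x
    constructor
    · rintro ⟨hx, hDx⟩
      obtain ⟨l, hl⟩ := hDx x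
      have hlt : r l x < r l (m l) := lt_of_le_of_ne (hl _ (Finset.mem_insert_of_mem (hm l).1))
        (fun h' => hx ((hr l h') ▸ (hm l).1))
      have hl' : l = i ∨ l = j := by
        by_contra hcon
        push Not at hcon
        obtain ⟨k, hk⟩ := hDx (m l)
        have hkl : m k = m l := hr k (le_antisymm ((hm k).2 _ (hm l).1)
          (hk _ (Finset.mem_insert_of_mem (hm k).1)))
        have hkne : k ≠ l := by
          rintro rfl
          have := hk x (Finset.mem_insert_self _ _)
          omega
        by_cases hki : k = i
        · subst hki
          exact hcon.2 (kii l j hcon.1 hij.symm (hkl.symm.trans hmij))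
        · exact hkne (kii k l hki hcon.1 hkl)
      rcases hl' with rfl | rfl
      · exact Or.inl (hfwd x hx hDx _ hlt)
      · exact Or.inr (hfwd x hx hDx _ hlt)
    · rintro (h | h)
      · obtain ⟨h1, h2, _⟩ := hbwd i kis x h
        exact ⟨h1, h2⟩
      · obtain ⟨h1, h2, _⟩ := hbwd j kjs x h
        exact ⟨h1, h2⟩
  · rintro x ⟨h, h'⟩
    obtain ⟨h1, h2, h3⟩ := hbwd i kis x h
    obtain ⟨_, _, h4⟩ := hbwd j kjs x h'
    exact hij (huniq x h1 h2 _ _ h3 h4)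

lemma sc_top_exists (r : I → T → ℕ) (m : I → T) (k : I) (x0 : T) (h : ScAbove r m k x0) :
    ∃ x, ScTop r m k x := by
  classical
  obtain ⟨x, hx, hmax⟩ := Finset.exists_max_image (Finset.univ.filter (ScAbove r m k)) (r k)
    ⟨x0, by simpa using h⟩
  refine ⟨x, by simpa using hx, fun z hz => hmax z (by simpa using hz)⟩

lemma sc_top_unique (r : I → T → ℕ) (hr : ∀ i, Function.Injective (r i)) (m : I → T) (k : I)
    (x y : T) (hx : ScTop r m k x) (hy : ScTop r m k y) : x = y :=
  hr k (le_antisymm (hy.2 x hx.1) (hx.2 y hy.1))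

open Classical in
lemma sc_door_regular (r : I → T → ℕ) (hr : ∀ i, Function.Injective (r i)) (s : I → T)
    (hs2 : ∀ i k x, k ≠ i → x ∉ Set.range s → r i x < r i (s k))
    (τ : Finset T) (hD : ScDom r τ) (hc : τ.card + 1 = Fintype.card I)
    (y0 : T) (hy0 : y0 ∈ τ) (hy0s : y0 ∉ Set.range s) :
    (Finset.univ.filter (fun x => x ∉ τ ∧ ScDom r (insert x τ))).card = 2 := by
  obtain ⟨m, hm⟩ := sc_min r τ ⟨y0, hy0⟩
  obtain ⟨i, j, hij, hmij, h1, h2⟩ := sc_door r hr τ ⟨y0, hy0⟩ hD hc m hm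
  have hab : ∀ k, ScAbove r m k (s k) := by
    intro k l hl
    exact lt_of_le_of_lt ((hm l).2 y0 hy0) (hs2 l k y0 hl.symm hy0s)
  obtain ⟨x, hx⟩ := sc_top_exists r m i _ (hab i)
  obtain ⟨y, hy⟩ := sc_top_exists r m j _ (hab j)
  rw [Finset.card_eq_two]
  refine ⟨x, y, ?_, ?_⟩
  · rintro rfl; exact h2 x ⟨hx, hy⟩
  · ext z
    simp only [Finset.mem_filter, Finset.mem_univ, true_and, Finset.mem_insert,
      Finset.mem_singleton, h1]
    constructor
    · rintro (h | h)
      · exact Or.inl (sc_top_unique r hr m i _ _ h hx)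
      · exact Or.inr (sc_top_unique r hr m j _ _ h hy)
    · rintro (rfl | rfl)
      · exact Or.inl hx
      · exact Or.inr hy

open Classical in
lemma sc_door_slack (r : I → T → ℕ) (hr : ∀ i, Function.Injective (r i)) (s : I → T)
    (hs : Function.Injective s)
    (hs1 : ∀ i x, r i (s i) ≤ r i x)
    (hs2 : ∀ i k x, k ≠ i → x ∉ Set.range s → r i x < r i (s k))
    (x0 : T) (hx0 : x0 ∉ Set.range s) (i0 : I) [Nontrivial I]
    (hD : ScDom r ((Finset.univ.erase i0).image s)) :
    (Finset.univ.filter (fun x => x ∉ (Finset.univ.erase i0).image s ∧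
      ScDom r (insert x ((Finset.univ.erase i0).image s)))).card = 1 := by
  set τ := (Finset.univ.erase i0).image s with hτ
  have hmem : ∀ y, y ∈ τ ↔ ∃ k, k ≠ i0 ∧ s k = y := by
    intro y; simp [hτ]
  have hne : τ.Nonempty := by
    obtain ⟨k, hk⟩ := exists_ne i0
    exact ⟨s k, (hmem _).2 ⟨k, hk, rfl⟩⟩
  have hc : τ.card + 1 = Fintype.card I := by
    rw [hτ, Finset.card_image_of_injective _ hs, Finset.card_erase_of_mem (Finset.mem_univ _),
      Finset.card_univ]
    have := Fintype.card_pos (α := I)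
    omega
  obtain ⟨m, hm⟩ := sc_min r τ hne
  have hml : ∀ l, l ≠ i0 → m l = s l := fun l hl =>
    hr l (le_antisymm ((hm l).2 _ ((hmem _).2 ⟨l, hl, rfl⟩)) (hs1 l _))
  obtain ⟨i, j, hij, hmij, h1, h2⟩ := sc_door r hr τ hne hD hc m hm
  have hA : ScAbove r m i0 x0 := by
    intro l hl
    rw [hml l hl]
    exact lt_of_le_of_ne (hs1 l x0) (fun h => hx0 ⟨l, hr l h⟩)
  have hB : ∀ k, k ≠ i0 → m i0 = m k → ∀ x, ¬ ScTop r m k x := by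
    intro k hk hmk x hx
    have hx1 := hx.1
    have hi0 := hx1 i0 hk.symm
    rw [hmk, hml k hk] at hi0
    by_cases hxs : x ∈ Set.range s
    · obtain ⟨p, rfl⟩ := hxs
      by_cases hpk : p = k
      · subst hpk; exact lt_irrefl _ hi0
      · by_cases hp0 : p = i0
        · subst hp0
          have := hs1 p (s k)
          omega
        · have := hx1 p hpk
          rw [hml p hp0] at this
          exact lt_irrefl _ this
    · have := hs2 i0 k x hk hxs
      omega
  obtain ⟨x, hx⟩ := sc_top_exists r m i0 _ hA
  rw [Finset.card_eq_one]
  refine ⟨x, ?_⟩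
  ext z
  simp only [Finset.mem_filter, Finset.mem_univ, true_and, Finset.mem_singleton, h1]
  by_cases hi : i = i0
  · subst hi
    have := hB j hij.symm hmij z
    constructor
    · rintro (h | h)
      · exact sc_top_unique r hr m _ _ _ h hx
      · exact absurd h this
    · rintro rfl; exact Or.inl hx
  · by_cases hj : j = i0
    · subst hj
      have := hB i hij hmij.symm z
      constructor
      · rintro (h | h)
        · exact absurd h this
        · exact sc_top_unique r hr m _ _ _ h hx
      · rintro rfl; exact Or.inr hx
    · rw [hml i hi, hml j hj] at hmij
      exact absurd (hs hmij) hij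

open Classical in
lemma sc_room (c : T → I) (i0 : I) (σ : Finset T) (hc : σ.card = Fintype.card I)
    (hncol : σ.image c ≠ Finset.univ) :
    Even (σ.filter (fun y => (σ.erase y).image c = Finset.univ.erase i0)).card := by
  by_cases hex : ∃ y ∈ σ, (σ.erase y).image c = Finset.univ.erase i0
  · obtain ⟨y, hy, hyc⟩ := hex
    have hinj : Set.InjOn c (σ.erase y : Finset T) := by
      rw [← Finset.card_image_iff, hyc, Finset.card_erase_of_mem (Finset.mem_univ _),
        Finset.card_erase_of_mem hy, hc, Finset.card_univ]
    have hins : σ.image c = insert (c y) (Finset.univ.erase i0) := by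
      rw [← hyc, ← Finset.image_insert, Finset.insert_erase hy]
    have hcy : c y ≠ i0 := by
      intro h
      apply hncol
      rw [hins, h, Finset.insert_erase (Finset.mem_univ _)]
    have : c y ∈ (σ.erase y).image c := by rw [hyc]; simpa using hcy
    obtain ⟨y', hy', hcy'⟩ := Finset.mem_image.1 this
    have hyy' := (Finset.mem_erase.1 hy')
    suffices h : σ.filter (fun y => (σ.erase y).image c = Finset.univ.erase i0) = {y, y'} by
      rw [h, Finset.card_pair hyy'.1.symm]; exact even_two
    ext z
    simp only [Finset.mem_filter, Finset.mem_insert, Finset.mem_singleton]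
    constructor
    · rintro ⟨hz, hzc⟩
      by_contra hcon
      push Not at hcon
      have hcz : c z ∈ (σ.erase z).image c := by
        rw [hzc, ← hyc]
        exact Finset.mem_image_of_mem _ (Finset.mem_erase.2 ⟨hcon.1, hz⟩)
      obtain ⟨w, hw, hcw⟩ := Finset.mem_image.1 hcz
      have hw' := Finset.mem_erase.1 hw
      by_cases hwy : w = y
      · subst hwy
        have : y' = z := hinj hy' (Finset.mem_erase.2 ⟨hcon.1, hz⟩) (hcy'.trans hcw)
        exact hcon.2 this.symm
      · exact hw'.1 (hinj (Finset.mem_erase.2 ⟨hwy, hw'.2⟩)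
          (Finset.mem_erase.2 ⟨hcon.1, hz⟩) hcw)
    · rintro (rfl | rfl)
      · exact ⟨hy, hyc⟩
      · refine ⟨hyy'.2, ?_⟩
        rw [← hyc]
        ext k
        simp only [Finset.mem_image, Finset.mem_erase]
        constructor
        · rintro ⟨w, ⟨hw1, hw2⟩, rfl⟩
          by_cases hwy : w = y
          · exact ⟨z, ⟨hyy'.1, hyy'.2⟩, by rw [hwy, hcy']⟩
          · exact ⟨w, ⟨hwy, hw2⟩, rfl⟩
        · rintro ⟨w, ⟨hw1, hw2⟩, rfl⟩
          by_cases hwy : w = z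
          · exact ⟨y, ⟨hyy'.1.symm, hy⟩, by rw [hwy, hcy']⟩
          · exact ⟨w, ⟨hwy, hw2⟩, rfl⟩
  · have : σ.filter (fun y => (σ.erase y).image c = Finset.univ.erase i0) = ∅ := by
      rw [Finset.filter_eq_empty_iff]
      intro y hy h
      exact hex ⟨y, hy, h⟩
    rw [this]; simp

lemma sc_dom_mono (r : I → T → ℕ) {σ τ : Finset T} (h : τ ⊆ σ) (hσ : ScDom r σ) : ScDom r τ := by
  intro x
  obtain ⟨i, hi⟩ := hσ x
  exact ⟨i, fun y hy => hi y (h hy)⟩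

open Classical in
theorem scarf [Nontrivial I] (r : I → T → ℕ) (hr : ∀ i, Function.Injective (r i)) (s : I → T)
    (hs : Function.Injective s)
    (hs1 : ∀ i x, r i (s i) ≤ r i x)
    (hs2 : ∀ i k x, k ≠ i → x ∉ Set.range s → r i x < r i (s k))
    (x0 : T) (hx0 : x0 ∉ Set.range s) (c : T → I) (hcs : ∀ i, c (s i) = i) :
    ∃ σ : Finset T, ScDom r σ ∧ σ.image c = Finset.univ := by
  by_contra hcon
  push Not at hcon
  obtain ⟨i0, _⟩ := exists_pair_ne I
  let doors : Finset (Finset T) := Finset.univ.filter (fun τ =>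
    ScDom r τ ∧ τ.card + 1 = Fintype.card I ∧ τ.image c = Finset.univ.erase i0)
  let rooms : Finset (Finset T) := Finset.univ.filter (fun σ =>
    ScDom r σ ∧ σ.card = Fintype.card I)
  let X : Finset T → Finset T := fun τ =>
    Finset.univ.filter (fun x => x ∉ τ ∧ ScDom r (insert x τ))
  let Y : Finset T → Finset T := fun σ =>
    σ.filter (fun y => (σ.erase y).image c = Finset.univ.erase i0)
  have hcount : ∑ τ ∈ doors, (X τ).card = ∑ σ ∈ rooms, (Y σ).card := by
    rw [← Finset.card_sigma, ← Finset.card_sigma]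
    refine Finset.card_bij' (fun p _ => ⟨insert p.2 p.1, p.2⟩) (fun p _ => ⟨p.1.erase p.2, p.2⟩)
      ?_ ?_ ?_ ?_
    · rintro ⟨τ, x⟩ h
      simp only [Finset.mem_sigma, doors, X, rooms, Y, Finset.mem_filter, Finset.mem_univ,
        true_and] at h ⊢
      obtain ⟨⟨h1, h2, h3⟩, h4, h5⟩ := h
      refine ⟨⟨h5, ?_⟩, Finset.mem_insert_self _ _, ?_⟩
      · rw [Finset.card_insert_of_notMem h4, h2]
      · rw [Finset.erase_insert h4, h3]
    · rintro ⟨σ, y⟩ h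
      simp only [Finset.mem_sigma, doors, X, rooms, Y, Finset.mem_filter, Finset.mem_univ,
        true_and] at h ⊢
      obtain ⟨⟨h1, h2⟩, h3, h4⟩ := h
      refine ⟨⟨sc_dom_mono r (Finset.erase_subset _ _) h1, ?_, h4⟩, Finset.notMem_erase _ _, ?_⟩
      · rw [Finset.card_erase_add_one h3, h2]
      · rw [Finset.insert_erase h3]; exact h1
    · rintro ⟨τ, x⟩ h
      simp only [Finset.mem_sigma, doors, X, Finset.mem_filter, Finset.mem_univ,
        true_and] at h
      simp [Finset.erase_insert h.2.1]
    · rintro ⟨σ, y⟩ h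
      simp only [Finset.mem_sigma, rooms, Y, Finset.mem_filter, Finset.mem_univ,
        true_and] at h
      simp [Finset.insert_erase h.2.1]
  have heven : Even (∑ σ ∈ rooms, (Y σ).card) := by
    refine Finset.even_sum _ (fun σ hσ => ?_)
    simp only [rooms, Finset.mem_filter, Finset.mem_univ, true_and] at hσ
    exact sc_room c i0 σ hσ.2 (hcon σ hσ.1)
  let τ0 : Finset T := (Finset.univ.erase i0).image s
  have hD0 : ScDom r τ0 := by
    intro x
    by_cases hx : x ∈ Set.range s
    · obtain ⟨k, rfl⟩ := hx
      exact ⟨k, fun y _ => hs1 k y⟩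
    · refine ⟨i0, fun y hy => ?_⟩
      simp only [τ0, Finset.mem_image, Finset.mem_erase, Finset.mem_univ, and_true] at hy
      obtain ⟨k, hk, rfl⟩ := hy
      exact (hs2 i0 k x hk hx).le
  have hτ0 : τ0 ∈ doors := by
    simp only [doors, Finset.mem_filter, Finset.mem_univ, true_and]
    refine ⟨hD0, ?_, ?_⟩
    · simp only [τ0]
      rw [Finset.card_image_of_injective _ hs, Finset.card_erase_of_mem (Finset.mem_univ _),
        Finset.card_univ]
      have := Fintype.card_pos (α := I)
      omega
    · ext k
      simp [τ0, hcs]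
  have hsplit : ∑ τ ∈ doors, (X τ).card = (X τ0).card + ∑ τ ∈ doors.erase τ0, (X τ).card :=
    (Finset.add_sum_erase _ _ hτ0).symm
  have h1 : (X τ0).card = 1 := sc_door_slack r hr s hs hs1 hs2 x0 hx0 i0 hD0
  have h2 : Even (∑ τ ∈ doors.erase τ0, (X τ).card) := by
    refine Finset.even_sum _ (fun τ hτ => ?_)
    simp only [doors, Finset.mem_erase, Finset.mem_filter, Finset.mem_univ, true_and] at hτ
    obtain ⟨hne, hD, hc, hcol⟩ := hτ
    by_cases hy : ∃ y ∈ τ, y ∉ Set.range s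
    · obtain ⟨y, hy, hys⟩ := hy
      have : (X τ).card = 2 := sc_door_regular r hr s hs2 τ hD hc y hy hys
      rw [this]; exact even_two
    · exfalso
      push Not at hy
      apply hne
      have hk0 : ∀ k, (∃ y ∈ τ, c y = k) ↔ k ≠ i0 := by
        intro k
        rw [← Finset.mem_image, hcol]; simp
      ext y
      simp only [τ0, Finset.mem_image, Finset.mem_erase, Finset.mem_univ, and_true]
      constructor
      · intro h
        obtain ⟨k, rfl⟩ := hy y h
        exact ⟨k, (hk0 k).1 ⟨_, h, hcs k⟩, rfl⟩
      · rintro ⟨k, hk, rfl⟩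
        obtain ⟨y, hyτ, hyk⟩ := (hk0 k).2 hk
        obtain ⟨k', rfl⟩ := hy y hyτ
        rw [hcs] at hyk
        rwa [← hyk]
  rw [← hcount, hsplit, h1] at heven
  rw [Nat.even_add] at heven
  simp [h2] at heven
end Scarf

section Grid
variable {I : Type} [Fintype I] [DecidableEq I]

lemma mul_add_lt_aux (M a b p q : ℕ) (hp : p < M) (h : a * M + p = b * M + q) (hq : q < M) :
    a = b ∧ p = q := by
  have h1 : (a * M + p) / M = a := by
    rw [mul_comm, Nat.mul_add_div (by omega), Nat.div_eq_of_lt hp, add_zero]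
  have h2 : (b * M + q) / M = b := by
    rw [mul_comm, Nat.mul_add_div (by omega), Nat.div_eq_of_lt hq, add_zero]
  have : a = b := by rw [← h1, ← h2, h]
  subst this
  exact ⟨rfl, by omega⟩

theorem grid_scarf [Nontrivial I] (k : ℕ) (c : (I → ℕ) → I) :
    ∃ z : I → ℕ, ∑ i, z i = k ∧ ∀ i, z i ≤ Fintype.card I ∨
      ∃ y : I → ℕ, ∑ i, y i = k ∧ c y = i ∧
        ∀ l, z l ≤ y l + Fintype.card I ∧ y l ≤ z l + Fintype.card I := by
  classical
  let G := {x : I → Fin (k + 1) // ∑ i, (x i : ℕ) = k}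
  let M := Fintype.card G
  let idx : G ≃ Fin M := Fintype.equivFin G
  let idI : I ≃ Fin (Fintype.card I) := Fintype.equivFin I
  let r : I → (G ⊕ I) → ℕ := fun i => Sum.elim (fun x => 1 + ((x.1 i : ℕ) * M + (idx x : ℕ)))
    (fun j => if j = i then 0 else 1 + ((k + 1) * M + (idI j : ℕ)))
  have hlt : ∀ i (x : G), ((x.1 i : ℕ) * M + (idx x : ℕ)) < (k + 1) * M := by
    intro i x
    have h1 : (x.1 i : ℕ) + 1 ≤ k + 1 := (x.1 i).2
    have h2 := (idx x).2
    have := Nat.mul_le_mul_right M h1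
    rw [add_mul, one_mul] at this
    omega
  have hr : ∀ i, Function.Injective (r i) := by
    intro i
    rintro (x | x) (y | y) h
    · simp only [r, Sum.elim_inl] at h
      have := (mul_add_lt_aux M _ _ _ _ (idx x).2 (add_left_cancel h) (idx y).2).2
      rw [idx.injective (Fin.ext this)]
    · simp only [r, Sum.elim_inl, Sum.elim_inr] at h
      have := hlt i x
      split_ifs at h <;> omega
    · simp only [r, Sum.elim_inl, Sum.elim_inr] at h
      have := hlt i y
      split_ifs at h <;> omega
    · simp only [r, Sum.elim_inr] at h
      split_ifs at h with h1 h2 h2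
      · rw [h1, h2]
      · omega
      · omega
      · have : (idI x : ℕ) = idI y := by omega
        rw [idI.injective (Fin.ext this)]
  -- building grid points
  have mk : ∀ x : I → ℕ, ∑ i, x i = k → ∃ g : G, ∀ i, (g.1 i : ℕ) = x i := by
    intro x hx
    have hle : ∀ i, x i < k + 1 := fun i => by
      have := Finset.single_le_sum (f := x) (fun j _ => Nat.zero_le _) (Finset.mem_univ i)
      omega
    exact ⟨⟨fun i => ⟨x i, hle i⟩, hx⟩, fun i => rfl⟩
  obtain ⟨i1, _⟩ := exists_pair_ne I
  obtain ⟨g0, _⟩ := mk (fun i => if i = i1 then k else 0) (by simp)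
  let val : G → (I → ℕ) := fun g i => (g.1 i : ℕ)
  let c' : G ⊕ I → I := Sum.elim (fun g => c (val g)) id
  obtain ⟨σ, hσ, hcol⟩ := scarf r hr Sum.inr Sum.inr_injective
    (by intro i x; simp [r])
    (by
      rintro i j (x | x) hj hx
      · have := hlt i x
        simp only [r, Sum.elim_inl, Sum.elim_inr, if_neg hj]
        omega
      · exact absurd ⟨x, rfl⟩ hx)
    (Sum.inl g0) (by simp) c' (by intro i; rfl)
  have hdom : ∀ g : G, ∃ i, Sum.inr i ∉ σ ∧ ∀ y : G, Sum.inl y ∈ σ →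
      r i (Sum.inl g) ≤ r i (Sum.inl y) := by
    intro g
    obtain ⟨i, hi⟩ := hσ (Sum.inl g)
    refine ⟨i, ?_, fun y hy => hi _ hy⟩
    intro h
    have := hi _ h
    simp [r] at this
  have hcolor : ∀ i, Sum.inr i ∉ σ → ∃ y : G, Sum.inl y ∈ σ ∧ c (val y) = i := by
    intro i hi
    have : i ∈ σ.image c' := by rw [hcol]; exact Finset.mem_univ _
    obtain ⟨y, hy, hyi⟩ := Finset.mem_image.1 this
    rcases y with y | y
    · exact ⟨y, hy, hyi⟩
    · have : y = i := hyi
      subst this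
      exact absurd hy hi
  obtain ⟨is, his, _⟩ := hdom g0
  obtain ⟨z, hz, _⟩ := hcolor is his
  have hmin : ∀ i, ∃ y : G, Sum.inl y ∈ σ ∧ ∀ w : G, Sum.inl w ∈ σ → val y i ≤ val w i := by
    intro i
    obtain ⟨y, hy, h⟩ := Finset.exists_min_image
      (Finset.univ.filter (fun g : G => (Sum.inl g : G ⊕ I) ∈ σ))
      (fun g => val g i) ⟨z, by simpa using hz⟩
    exact ⟨y, by simpa using hy, fun w hw => h w (by simpa using hw)⟩
  choose mm hmm1 hmm2 using hmin
  let b : I → ℕ := fun i => if Sum.inr i ∉ σ then val (mm i) i else 0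
  let b1 : I → ℕ := fun i => if Sum.inr i ∉ σ then val (mm i) i + 1 else 0
  have hb1 : k < ∑ i, b1 i := by
    by_contra hcon
    push Not at hcon
    obtain ⟨g, hg⟩ := mk (fun i => b1 i + if i = is then k - ∑ i, b1 i else 0) (by
      rw [Finset.sum_add_distrib]; simp; omega)
    obtain ⟨i, hi, hle⟩ := hdom g
    have h1 := hle _ (hmm1 i)
    have h2 := hg i
    have h3 : b1 i = val (mm i) i + 1 := by simp only [b1, if_pos hi]
    have h4 : val (mm i) i + 1 ≤ (g.1 i : ℕ) := by omega
    have h5 := Nat.mul_le_mul_right M h4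
    simp only [r, Sum.elim_inl] at h1
    have h6 := (idx (mm i)).2
    have h7 : val (mm i) i = ((mm i).1 i : ℕ) := rfl
    rw [add_mul, one_mul, h7] at h5
    omega
  have hb : k ≤ ∑ i, b i + Fintype.card I := by
    have : ∑ i, b1 i ≤ ∑ i, (b i + 1) := by
      refine Finset.sum_le_sum (fun i _ => ?_)
      simp only [b, b1]
      split_ifs <;> omega
    rw [Finset.sum_add_distrib] at this
    simp at this
    omega
  have hble : ∀ y : G, Sum.inl y ∈ σ → ∀ i, b i ≤ val y i := by
    intro y hy i
    simp only [b]
    split_ifs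
    · exact Nat.zero_le _
    · exact hmm2 i y hy
  have hbge : ∀ y : G, Sum.inl y ∈ σ → ∀ i, val y i ≤ b i + Fintype.card I := by
    intro y hy i
    have h1 : ∑ i, val y i = k := y.2
    have h2 : ∑ j ∈ Finset.univ.erase i, b j ≤ ∑ j ∈ Finset.univ.erase i, val y j :=
      Finset.sum_le_sum (fun j _ => hble y hy j)
    have h3 := Finset.add_sum_erase Finset.univ (val y) (Finset.mem_univ i)
    have h4 := Finset.add_sum_erase Finset.univ b (Finset.mem_univ i)
    omega
  refine ⟨val z, z.2, fun i => ?_⟩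
  by_cases hi : Sum.inr i ∈ σ
  · left
    have := hbge z hz i
    have h0 : b i = 0 := by simp [b, hi]
    omega
  · right
    obtain ⟨y, hy, hyc⟩ := hcolor i hi
    refine ⟨val y, y.2, hyc, fun l => ?_⟩
    have h1 := hbge z hz l
    have h2 := hbge y hy l
    have h3 := hble z hz l
    have h4 := hble y hy l
    omega

/-- Brouwer's theorem on the standard simplex. -/
theorem brouwer_simplex [Nonempty I] (f : (I → ℝ) → (I → ℝ))
    (hf : ContinuousOn f (stdSimplex ℝ I)) (hmaps : Set.MapsTo f (stdSimplex ℝ I) (stdSimplex ℝ I)) :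
    ∃ x ∈ stdSimplex ℝ I, f x = x := by
  classical
  obtain ⟨i1⟩ := ‹Nonempty I›
  have hne : (stdSimplex ℝ I).Nonempty := ⟨_, single_mem_stdSimplex ℝ i1⟩
  suffices hsuff : ∃ x ∈ stdSimplex ℝ I, ∀ i, x i ≤ f x i by
    obtain ⟨x, hx, hle⟩ := hsuff
    refine ⟨x, hx, ?_⟩
    have hfx := hmaps hx
    have hsum : ∑ i, x i = ∑ i, f x i := by rw [hx.2, hfx.2]
    have := (Finset.sum_eq_sum_iff_of_le (fun i _ => hle i)).1 hsum
    funext i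
    exact (this i (Finset.mem_univ i)).symm
  rcases subsingleton_or_nontrivial I with hI | hI
  · obtain ⟨x, hx⟩ := hne
    refine ⟨x, hx, fun i => ?_⟩
    have h1 := hx.2
    have h2 := (hmaps hx).2
    rw [Fintype.sum_subsingleton _ i] at h1 h2
    rw [h1, h2]
  have hcomp : IsCompact (stdSimplex ℝ I) := isCompact_stdSimplex ℝ I
  have hN : 0 < Fintype.card I := Fintype.card_pos
  -- approximate version
  have happrox : ∀ ε > 0, ∃ z ∈ stdSimplex ℝ I, ∀ i, z i - f z i ≤ ε := by
    intro ε hε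
    have huc := hcomp.uniformContinuousOn_of_continuous hf
    obtain ⟨δ, hδ, hδf⟩ := Metric.uniformContinuousOn_iff.1 huc (ε / 2) (by positivity)
    obtain ⟨k, hk⟩ := exists_nat_gt ((Fintype.card I : ℝ) / min δ (ε / 2))
    have hmin : 0 < min δ (ε / 2) := by positivity
    have hkpos : (0 : ℝ) < k := lt_of_le_of_lt (by positivity) hk
    have hNk : (Fintype.card I : ℝ) / k < min δ (ε / 2) := by
      rw [div_lt_iff₀ hmin] at hk
      rw [div_lt_iff₀ hkpos]; linarith
    let sc : (I → ℕ) → (I → ℝ) := fun x i => (x i : ℝ) / k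
    have hsc : ∀ x : I → ℕ, ∑ i, x i = k → sc x ∈ stdSimplex ℝ I := by
      intro x hx
      refine ⟨fun i => by positivity, ?_⟩
      simp only [sc]
      rw [← Finset.sum_div, ← Nat.cast_sum, hx, div_self hkpos.ne']
    have hcol : ∀ x : I → ℕ, ∃ i, sc x ∈ stdSimplex ℝ I → sc x i ≤ f (sc x) i := by
      intro x
      by_cases hx : sc x ∈ stdSimplex ℝ I
      · by_contra hcon
        push Not at hcon
        have h1 : ∑ i, f (sc x) i < ∑ i, sc x i :=
          Finset.sum_lt_sum_of_nonempty ⟨i1, Finset.mem_univ _⟩ (fun i _ => (hcon i).2)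
        rw [hx.2, (hmaps hx).2] at h1
        exact lt_irrefl _ h1
      · exact ⟨i1, fun h => absurd h hx⟩
    choose c hc using hcol
    obtain ⟨z, hz, hzi⟩ := grid_scarf k c
    refine ⟨sc z, hsc z hz, fun i => ?_⟩
    rcases hzi i with h | ⟨y, hy, hyc, hyz⟩
    · have h0 := (hmaps (hsc z hz)).1 i
      have h1 : sc z i ≤ (Fintype.card I : ℝ) / k := by
        simp only [sc]; gcongr
      have := hNk.trans_le (min_le_right _ _)
      linarith
    · have hd : ∀ l, |sc z l - sc y l| ≤ (Fintype.card I : ℝ) / k := by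
        intro l
        obtain ⟨h1, h2⟩ := hyz l
        have h1' : (z l : ℝ) ≤ y l + Fintype.card I := by exact_mod_cast h1
        have h2' : (y l : ℝ) ≤ z l + Fintype.card I := by exact_mod_cast h2
        simp only [sc]
        rw [← sub_div, abs_div, abs_of_pos hkpos]
        gcongr
        rw [abs_le]; constructor <;> linarith
      have hdist : dist (sc z) (sc y) < δ := by
        refine lt_of_le_of_lt ?_ (hNk.trans_le (min_le_left _ _))
        rw [dist_pi_le_iff (by positivity)]
        intro l
        rw [Real.dist_eq]; exact hd l
      have h1 := hδf _ (hsc z hz) _ (hsc y hy) hdist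
      have h2 : dist (f (sc z) i) (f (sc y) i) < ε / 2 := lt_of_le_of_lt (dist_le_pi_dist _ _ i) h1
      rw [Real.dist_eq, abs_lt] at h2
      have h3 := hc y (hsc y hy)
      rw [hyc] at h3
      have h4 := (abs_le.1 (hd i)).2
      have := hNk.trans_le (min_le_right _ _)
      linarith [h2.1]
  let g : (I → ℝ) → ℝ := fun z => Finset.univ.sup' ⟨i1, Finset.mem_univ _⟩ (fun i => z i - f z i)
  have hg : ContinuousOn g (stdSimplex ℝ I) := by
    refine ContinuousOn.finset_sup'_apply _ (fun i _ => ?_)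
    exact (continuous_apply i).continuousOn.sub ((continuous_apply i).comp_continuousOn hf)
  obtain ⟨x, hx, hxmin⟩ := hcomp.exists_isMinOn hne hg
  refine ⟨x, hx, fun i => ?_⟩
  have hle : g x ≤ 0 := by
    refine le_of_forall_pos_le_add (fun ε hε => ?_)
    obtain ⟨z, hz, hzi⟩ := happrox ε hε
    have h1 : g x ≤ g z := hxmin hz
    have h2 : g z ≤ ε := Finset.sup'_le _ _ (fun i _ => hzi i)
    linarith
  have : x i - f x i ≤ g x := Finset.le_sup' (fun i => x i - f x i) (Finset.mem_univ i)
  linarith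
end Grid

section Cake

theorem brouwer_partition (d : ℕ) (hd : 0 < d) (a : Fin d → ℕ) (ha : ∀ t, 0 < a t)
    (F : (∀ t, Fin (a t) → ℝ) → (∀ t, Fin (a t) → ℝ))
    (hF : ContinuousOn F (PartitionSpace d a))
    (hmaps : Set.MapsTo F (PartitionSpace d a) (PartitionSpace d a)) :
    ∃ P ∈ PartitionSpace d a, F P = P := by
  have hd' : (0 : ℝ) < d := by exact_mod_cast hd
  have ha' : ∀ t, (0 : ℝ) < a t := fun t => by exact_mod_cast ha t
  let I := (t : Fin d) × Fin (a t)
  have : Nonempty I := ⟨⟨⟨0, hd⟩, ⟨0, ha _⟩⟩⟩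
  let sm : (I → ℝ) → Fin d → ℝ := fun x t => ∑ v, d * x ⟨t, v⟩
  let ret : (I → ℝ) → (∀ t, Fin (a t) → ℝ) := fun x t v =>
    (d * x ⟨t, v⟩ + max 0 (1 - sm x t) / a t) / max 1 (sm x t)
  let emb : (∀ t, Fin (a t) → ℝ) → (I → ℝ) := fun P p => P p.1 p.2 / d
  have hret_cont : Continuous ret := by
    refine continuous_pi (fun t => continuous_pi (fun v => ?_))
    simp only [ret, sm]
    refine Continuous.div (by fun_prop) (by fun_prop) (fun x => ?_)
    exact (lt_of_lt_of_le one_pos (le_max_left _ _)).ne'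
  have hemb_cont : Continuous emb := by
    refine continuous_pi (fun p => ?_)
    simp only [emb]
    fun_prop
  have hret : Set.MapsTo ret (stdSimplex ℝ I) (PartitionSpace d a) := by
    intro x hx t
    have hpos : 0 < max 1 (sm x t) := lt_of_lt_of_le one_pos (le_max_left _ _)
    refine ⟨fun v => ?_, ?_⟩
    · have := hx.1 ⟨t, v⟩
      simp only [ret]
      have h1 : 0 ≤ max 0 (1 - sm x t) := le_max_left _ _
      have h2 := ha' t
      positivity
    · simp only [ret]
      rw [← Finset.sum_div, Finset.sum_add_distrib, div_eq_one_iff_eq hpos.ne']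
      simp only [Finset.sum_const, Finset.card_univ, Fintype.card_fin, nsmul_eq_mul]
      rw [mul_div_cancel₀ _ (ha' t).ne']
      change sm x t + _ = _
      rcases le_total (sm x t) 1 with h | h
      · rw [max_eq_right (by linarith), max_eq_left h]; ring
      · rw [max_eq_left (by linarith), max_eq_right h]; ring
  have hemb : Set.MapsTo emb (PartitionSpace d a) (stdSimplex ℝ I) := by
    intro P hP
    refine ⟨fun p => div_nonneg ((hP p.1).1 p.2) hd'.le, ?_⟩
    simp only [emb]
    rw [← Finset.sum_div, Fintype.sum_sigma]
    have : ∀ t, ∑ v, P t v = 1 := fun t => (hP t).2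
    simp [this, hd'.ne']
  have hre : ∀ P ∈ PartitionSpace d a, ret (emb P) = P := by
    intro P hP
    funext t v
    have h1 : sm (emb P) t = 1 := by
      simp only [sm, emb]
      rw [← (hP t).2]
      refine Finset.sum_congr rfl (fun v _ => ?_)
      field_simp
    simp only [ret, h1, emb]
    simp
    field_simp
  obtain ⟨x, hx, hfx⟩ := brouwer_simplex (fun x => emb (F (ret x)))
    (hemb_cont.comp_continuousOn (hF.comp hret_cont.continuousOn hret))
    (fun x hx => hemb (hmaps (hret hx)))
  refine ⟨ret x, hret hx, ?_⟩
  have := hre _ (hmaps (hret hx))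
  rw [← this]
  exact congrArg ret hfx

/-- A face-preserving self-map of a product of simplices hits the barycenter. -/
theorem hits_barycenter (d : ℕ) (hd : 0 < d) (a : Fin d → ℕ) (ha : ∀ t, 0 < a t)
    (g : (∀ t, Fin (a t) → ℝ) → (∀ t, Fin (a t) → ℝ))
    (hg : ContinuousOn g (PartitionSpace d a))
    (hmaps : Set.MapsTo g (PartitionSpace d a) (PartitionSpace d a))
    (hface : ∀ P ∈ PartitionSpace d a, ∀ t v, P t v = 0 → g P t v = 0) :
    ∃ P ∈ PartitionSpace d a, ∀ t v, g P t v = 1 / a t := by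
  have ha' : ∀ t, (0 : ℝ) < a t := fun t => by exact_mod_cast ha t
  let q : (∀ t, Fin (a t) → ℝ) → (∀ t, Fin (a t) → ℝ) := fun P t v => max 0 (1 / a t - g P t v)
  have hq0 : ∀ P t v, 0 ≤ q P t v := fun P t v => le_max_left _ _
  have hS0 : ∀ P t, 0 ≤ ∑ v, q P t v := fun P t => Finset.sum_nonneg (fun v _ => hq0 P t v)
  let F : (∀ t, Fin (a t) → ℝ) → (∀ t, Fin (a t) → ℝ) := fun P t v =>
    (P t v + q P t v) / (1 + ∑ w, q P t w)
  have hgc : ∀ t v, ContinuousOn (fun P => g P t v) (PartitionSpace d a) := fun t v =>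
    (continuous_apply v).comp_continuousOn ((continuous_apply t).comp_continuousOn hg)
  have hqc : ∀ t v, ContinuousOn (fun P => q P t v) (PartitionSpace d a) := fun t v =>
    continuousOn_const.sup (continuousOn_const.sub (hgc t v))
  obtain ⟨P, hP, hfix⟩ := brouwer_partition d hd a ha F
    (by
      refine continuousOn_pi.2 (fun t => continuousOn_pi.2 (fun v => ?_))
      refine ContinuousOn.div ?_ ?_ (fun P _ => by have := hS0 P t; positivity)
      · exact ContinuousOn.add (Continuous.continuousOn (by fun_prop)) (hqc t v)
      · exact continuousOn_const.add (continuousOn_finsetSum _ (fun w _ => hqc t w)))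
    (by
      intro P hP t
      have := hS0 P t
      refine ⟨fun v => ?_, ?_⟩
      · have h1 := (hP t).1 v
        have h2 := hq0 P t v
        simp only [F]
        positivity
      · simp only [F]
        rw [← Finset.sum_div, Finset.sum_add_distrib, (hP t).2, div_self (by positivity)])
  refine ⟨P, hP, fun t => ?_⟩
  have hP1 : ∀ v, q P t v = P t v * ∑ w, q P t w := by
    intro v
    have h := congrFun (congrFun hfix t) v
    simp only [F] at h
    have := hS0 P t
    rw [div_eq_iff (by positivity)] at h
    linarith
  have hgs := (hmaps hP t).2
  have hsum1 : ∑ _v : Fin (a t), (1 : ℝ) / a t = 1 := by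
    simp [(ha' t).ne']
  have hge : ∀ v, 1 / (a t : ℝ) ≤ g P t v := by
    by_contra hcon
    push Not at hcon
    obtain ⟨v0, hv0⟩ := hcon
    have hpos : 0 < ∑ w, q P t w := by
      refine Finset.sum_pos' (fun w _ => hq0 P t w) ⟨v0, Finset.mem_univ _, ?_⟩
      exact lt_max_of_lt_right (by linarith)
    have hlt : ∀ v, g P t v < 1 / a t := by
      intro v
      rcases eq_or_lt_of_le ((hP t).1 v) with h | h
      · rw [hface P hP t v h.symm]
        have := ha' t
        positivity
      · have h1 : 0 < q P t v := by rw [hP1 v]; positivity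
        rcases lt_max_iff.1 h1 with h2 | h2
        · exact absurd h2 (lt_irrefl _)
        · linarith
    have : ∑ v, g P t v < ∑ _v : Fin (a t), (1 : ℝ) / a t :=
      Finset.sum_lt_sum_of_nonempty ⟨v0, Finset.mem_univ _⟩ (fun v _ => hlt v)
    rw [hgs, hsum1] at this
    exact lt_irrefl _ this
  have := (Finset.sum_eq_sum_iff_of_le (fun v (_ : v ∈ Finset.univ) => hge v)).1
    (by rw [hsum1, hgs])
  exact fun v => (this v (Finset.mem_univ v)).symm

lemma partition_compact (d : ℕ) (a : Fin d → ℕ) : IsCompact (PartitionSpace d a) := by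
  have : PartitionSpace d a = Set.pi Set.univ (fun t => stdSimplex ℝ (Fin (a t))) := by
    ext P; simp [PartitionSpace]
  rw [this]
  exact isCompact_univ_pi (fun t => isCompact_stdSimplex ℝ _)

/-- Approximate weights. -/
theorem approx_weights (n d : ℕ) (hn : 0 < n) (hd : 0 < d) (a : Fin d → ℕ) (ha : ∀ t, 0 < a t)
    (C : CakeInstance n d a) (ε : ℝ) (hε : 0 < ε) :
    ∃ P ∈ PartitionSpace d a, ∃ w : Fin n → (∀ t, Fin (a t)) → ℝ,
      (∀ i j, 0 ≤ w i j) ∧ (∀ i, ∑ j, w i j = 1) ∧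
      (∀ t v, ∑ i, ∑ j, (if j t = v then w i j else 0) = n / a t) ∧
      ∀ i j, w i j ≠ 0 → (C.A i j).Nonempty ∧ Metric.infDist P (C.A i j) < ε := by
  classical
  have hn' : (0 : ℝ) < n := by exact_mod_cast hn
  let φ : Fin n → (∀ t, Fin (a t)) → (∀ t, Fin (a t) → ℝ) → ℝ := fun i j P =>
    if (C.A i j).Nonempty then max 0 (ε - Metric.infDist P (C.A i j)) * ∏ t, P t (j t) else 0
  have hφc : ∀ i j, Continuous (φ i j) := by
    intro i j
    simp only [φ]
    split_ifs
    · refine Continuous.mul ?_ ?_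
      · exact continuous_const.max (continuous_const.sub (Metric.continuous_infDist_pt _))
      · fun_prop
    · exact continuous_const
  have hφ0 : ∀ i j, ∀ P ∈ PartitionSpace d a, 0 ≤ φ i j P := by
    intro i j P hP
    simp only [φ]
    split_ifs
    · exact mul_nonneg (le_max_left _ _) (Finset.prod_nonneg (fun t _ => (hP t).1 _))
    · exact le_rfl
  have hφz : ∀ i j P t, P t (j t) = 0 → φ i j P = 0 := by
    intro i j P t h
    simp only [φ]
    split_ifs
    · rw [Finset.prod_eq_zero (Finset.mem_univ t) h, mul_zero]
    · rfl
  have hφne : ∀ i j P, φ i j P ≠ 0 → (C.A i j).Nonempty ∧ Metric.infDist P (C.A i j) < ε := by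
    intro i j P h
    simp only [φ] at h
    split_ifs at h with h1
    · refine ⟨h1, ?_⟩
      by_contra hcon
      push Not at hcon
      rw [max_eq_left (by linarith), zero_mul] at h
      exact h rfl
    · exact absurd rfl h
  have hS : ∀ i, ∀ P ∈ PartitionSpace d a, 0 < ∑ j, φ i j P := by
    intro i P hP
    obtain ⟨j, hj, hjp⟩ := C.hungry i P hP
    refine Finset.sum_pos' (fun j _ => hφ0 i j P hP) ⟨j, Finset.mem_univ _, ?_⟩
    simp only [φ]
    rw [if_pos ⟨P, hj⟩, Metric.infDist_zero_of_mem hj]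
    refine mul_pos (lt_max_of_lt_right (by linarith)) (Finset.prod_pos (fun t _ => hjp t))
  let w : (∀ t, Fin (a t) → ℝ) → Fin n → (∀ t, Fin (a t)) → ℝ := fun P i j =>
    φ i j P / ∑ j, φ i j P
  have hw0 : ∀ P ∈ PartitionSpace d a, ∀ i j, 0 ≤ w P i j := fun P hP i j =>
    div_nonneg (hφ0 i j P hP) (hS i P hP).le
  have hw1 : ∀ P ∈ PartitionSpace d a, ∀ i, ∑ j, w P i j = 1 := by
    intro P hP i
    simp only [w]
    rw [← Finset.sum_div, div_self (hS i P hP).ne']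
  have hwc : ∀ i j, ContinuousOn (fun P => w P i j) (PartitionSpace d a) := by
    intro i j
    refine ContinuousOn.div (hφc i j).continuousOn ?_ (fun P hP => (hS i P hP).ne')
    exact (continuous_finsetSum _ (fun j _ => hφc i j)).continuousOn
  let g : (∀ t, Fin (a t) → ℝ) → (∀ t, Fin (a t) → ℝ) := fun P t v =>
    (∑ i, ∑ j, (if j t = v then w P i j else 0)) / n
  obtain ⟨P, hP, hPg⟩ := hits_barycenter d hd a ha g
    (by
      refine continuousOn_pi.2 (fun t => continuousOn_pi.2 (fun v => ?_))
      refine ContinuousOn.div_const ?_ _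
      refine continuousOn_finsetSum _ (fun i _ => continuousOn_finsetSum _ (fun j _ => ?_))
      split_ifs
      · exact hwc i j
      · exact continuousOn_const)
    (by
      intro P hP t
      refine ⟨fun v => ?_, ?_⟩
      · refine div_nonneg (Finset.sum_nonneg (fun i _ => Finset.sum_nonneg (fun j _ => ?_))) hn'.le
        split_ifs
        · exact hw0 P hP i j
        · exact le_rfl
      · simp only [g]
        rw [← Finset.sum_div, Finset.sum_comm]
        have : ∀ i, ∑ v, ∑ j, (if j t = v then w P i j else 0) = 1 := by
          intro i
          rw [Finset.sum_comm]
          simp [hw1 P hP i]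
        simp [this, hn'.ne'])
    (by
      intro P hP t v h
      simp only [g]
      rw [Finset.sum_eq_zero, zero_div]
      intro i _
      refine Finset.sum_eq_zero (fun j _ => ?_)
      split_ifs with hj
      · subst hj
        simp only [w]
        rw [hφz i j P t h, zero_div]
      · rfl)
  refine ⟨P, hP, w P, hw0 P hP, hw1 P hP, ?_, ?_⟩
  · intro t v
    have h := hPg t v
    simp only [g] at h
    rw [div_eq_iff hn'.ne'] at h
    rw [h]; ring
  · intro i j h
    refine hφne i j P (fun h0 => h ?_)
    simp only [w]
    rw [h0, zero_div]

end Cake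

theorem bm_implies_ad (n m d : ℕ) (hn : 0 < n) (hm : 0 < m) (hd : 0 < d)
    (a : Fin d → ℕ) (ha : ∀ t, 0 < a t)
    (hyp : ∀ H : Finset (∀ t : Fin (d + 1), Fin (Fin.cons (α := fun _ => ℕ) n a t)),
      FracBalanced H → ∃ M, IsMatching H M ∧ M.card = m) :
    ∀ C : CakeInstance n d a, ∃ Q : Finset (Fin n), Q.card = m ∧ Placatable C Q := by
  classical
  intro C
  let E := ∀ t : Fin (d + 1), Fin (Fin.cons (α := fun _ => ℕ) n a t)
  let hd0 : E → Fin n := fun e => e 0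
  let tl : E → (∀ t, Fin (a t)) := fun e t => e t.succ
  let eqv : (Fin n × (∀ t, Fin (a t))) ≃ E :=
    Fin.consEquiv (fun t : Fin (d + 1) => Fin (Fin.cons (α := fun _ => ℕ) n a t))
  have heqv : ∀ p, hd0 (eqv p) = p.1 ∧ tl (eqv p) = p.2 := fun p => ⟨rfl, rfl⟩
  let AA : E → Set (∀ t, Fin (a t) → ℝ) := fun e => C.A (hd0 e) (tl e)
  let Valid : Finset E → Prop := fun M => M.card = m ∧
    (∀ e ∈ M, ∀ f ∈ M, e ≠ f → ∀ t, e t ≠ f t) ∧ ∀ e ∈ M, (AA e).Nonempty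
  have hstep : ∀ ε : ℝ, 0 < ε → ∃ P ∈ PartitionSpace d a, ∃ M, Valid M ∧
      ∀ e ∈ M, Metric.infDist P (AA e) < ε := by
    intro ε hε
    obtain ⟨P, hP, w, hw0, hw1, hwt, hwne⟩ := approx_weights n d hn hd a ha C ε hε
    let f : E → ℝ := fun e => w (hd0 e) (tl e)
    have hdeg0 : ∀ v : Fin n, degree (b := Fin.cons (α := fun _ => ℕ) n a) f 0 v = 1 := by
      intro v
      unfold degree
      rw [← eqv.sum_comp, Fintype.sum_prod_type]
      change ∑ x : Fin n, ∑ y : (∀ t, Fin (a t)), (if x = v then w x y else 0) = 1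
      rw [Finset.sum_comm]
      simp [hw1 v]
    have hdegt : ∀ (t : Fin d) (v : Fin (a t)),
        degree (b := Fin.cons (α := fun _ => ℕ) n a) f t.succ v = n / a t := by
      intro t v
      unfold degree
      rw [← eqv.sum_comp, Fintype.sum_prod_type]
      exact hwt t v
    obtain ⟨M, ⟨hMH, hM⟩, hMc⟩ := hyp (Finset.univ.filter (fun e => f e ≠ 0)) (by
      refine ⟨f, ⟨fun e => hw0 _ _, ?_, ?_⟩, ?_⟩
      · intro e he
        simpa using he
      · intro t
        refine Fin.cases ?_ (fun t => ?_) t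
        · intro v w
          exact (hdeg0 v).trans (hdeg0 w).symm
        · intro v w
          exact (hdegt t v).trans (hdegt t w).symm
      · intro h
        have := hdeg0 ⟨0, hn⟩
        rw [h] at this
        simp [degree] at this)
    have hMf : ∀ e ∈ M, f e ≠ 0 := fun e he => by simpa using hMH he
    exact ⟨P, hP, M, ⟨hMc, hM, fun e he => (hwne _ _ (hMf e he)).1⟩,
      fun e he => (hwne _ _ (hMf e he)).2⟩
  -- passing to the limit
  have hlim : ∃ P ∈ PartitionSpace d a, ∃ M, Valid M ∧ ∀ e ∈ M, P ∈ AA e := by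
    by_contra hcon
    push Not at hcon
    obtain ⟨P0, hP0, _⟩ := hstep 1 one_pos
    have hδ : ∀ M : Finset E, ∃ δ : ℝ, 0 < δ ∧ (Valid M → ∀ P ∈ PartitionSpace d a,
        δ ≤ ∑ e ∈ M, Metric.infDist P (AA e)) := by
      intro M
      by_cases hV : Valid M
      · obtain ⟨P, hP, hmin⟩ := (partition_compact d a).exists_isMinOn ⟨P0, hP0⟩
          (f := fun P => ∑ e ∈ M, Metric.infDist P (AA e))
          (continuous_finsetSum _ (fun e _ => Metric.continuous_infDist_pt _)).continuousOn
        refine ⟨_, ?_, fun _ Q hQ => hmin hQ⟩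
        obtain ⟨e, he, hPe⟩ := hcon P hP M hV
        refine Finset.sum_pos' (fun e _ => Metric.infDist_nonneg) ⟨e, he, ?_⟩
        exact ((C.isClosed _ _).notMem_iff_infDist_pos (hV.2.2 e he)).1 hPe
      · exact ⟨1, one_pos, fun h => absurd h hV⟩
    choose δ hδ0 hδ using hδ
    obtain ⟨M0, hM0⟩ := Finite.exists_min δ
    have hm' : (0 : ℝ) < m := by exact_mod_cast hm
    obtain ⟨P, hP, M, hV, hlt⟩ := hstep (δ M0 / m) (div_pos (hδ0 M0) hm')
    have h1 := hδ M hV P hP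
    have hne : M.Nonempty := by
      rw [← Finset.card_pos, hV.1]; exact hm
    have h2 : ∑ e ∈ M, Metric.infDist P (AA e) < ∑ _e ∈ M, δ M0 / m :=
      Finset.sum_lt_sum_of_nonempty hne hlt
    rw [Finset.sum_const, hV.1, nsmul_eq_mul, mul_div_cancel₀ _ hm'.ne'] at h2
    linarith [hM0 M]
  obtain ⟨P, hP, M, ⟨hMc, hM, _⟩, hPM⟩ := hlim
  have hinj : Set.InjOn hd0 M := by
    intro e he f hf h
    by_contra hne
    exact hM e he f hf hne 0 h
  refine ⟨M.image hd0, by rw [Finset.card_image_of_injOn hinj, hMc], P, hP, ?_⟩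
  have hch : ∀ q : Fin n, ∃ j : ∀ t, Fin (a t), q ∈ M.image hd0 → ∃ e ∈ M, hd0 e = q ∧ tl e = j := by
    intro q
    by_cases hq : q ∈ M.image hd0
    · obtain ⟨e, he, h⟩ := Finset.mem_image.1 hq
      exact ⟨tl e, fun _ => ⟨e, he, h, rfl⟩⟩
    · exact ⟨fun t => ⟨0, ha t⟩, fun h => absurd h hq⟩
  choose ψ hψ using hch
  refine ⟨ψ, ?_, ?_⟩
  · intro q hq
    obtain ⟨e, he, h1, h2⟩ := hψ q hq
    have := hPM e he
    simp only [AA] at this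
    rwa [h1, h2] at this
  · intro q hq q' hq' hne t
    obtain ⟨e, he, h1, h2⟩ := hψ q hq
    obtain ⟨e', he', h1', h2'⟩ := hψ q' hq'
    have hee : e ≠ e' := by
      rintro rfl
      exact hne (h1.symm.trans h1')
    rw [← h2, ← h2']
    exact hM e he e' he' hee t.succ
end
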